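/- Let K be a convex body in Euclidean 3-space ℝ³ and let p be a point of ℝ³. Suppose that for every plane H through p, the section H ∩ K is centrally symmetric (with the convention that the empty set is symmetric). Then either p is a centre of symmetry of K, or K is an ellipsoid. -/

import Mathlib

/-- A set is centrally symmetric with center `c` if its reflection through `c` equals itself.
Note the empty set satisfies this for any `c`, matching the convention that ∅ is symmetric. -/
def SymmWith (A : Set (EuclideanSpace ℝ (Fin 3))) (c : EuclideanSpace ℝ (Fin 3)) : Prop :=
  (fun x => (2 : ℝ) • c - x) '' A = A

namespace FalseCentre

open Matrix Set Filter Topology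

section

/-- Coordinate 3-space, with vectors also used as functionals through `⬝ᵥ`. -/
abbrev V3 := Fin 3 → ℝ

lemma dual_repr (f : V3 →L[ℝ] ℝ) : ∃ g : V3, ∀ y, f y = g ⬝ᵥ y := by
  refine ⟨fun i => f (Pi.single i 1), fun y => ?_⟩
  have h : y = ∑ i, y i • (Pi.single i (1 : ℝ) : V3) := by
    ext j; simp [Finset.sum_apply, Pi.single_apply]
  conv_lhs => rw [h]
  rw [map_sum]
  simp [dotProduct, mul_comm]

lemma dual_repr_ne {f : V3 →L[ℝ] ℝ} (hf : f ≠ 0) : ∃ g : V3, g ≠ 0 ∧ ∀ y, f y = g ⬝ᵥ y := by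
  obtain ⟨g, hg⟩ := dual_repr f
  refine ⟨g, ?_, hg⟩
  rintro rfl
  exact hf (by ext y; simp [hg])

lemma dot_self_pos {g : V3} (hg : g ≠ 0) : 0 < g ⬝ᵥ g := by
  have h0 : 0 ≤ g ⬝ᵥ g := by
    simp only [dotProduct, Fin.sum_univ_three]
    nlinarith [sq_nonneg (g 0), sq_nonneg (g 1), sq_nonneg (g 2)]
  exact lt_of_le_of_ne h0 fun h => hg (dotProduct_self_eq_zero.1 h.symm)

lemma dot_self_nonneg (g : V3) : 0 ≤ g ⬝ᵥ g := by
  simp only [dotProduct, Fin.sum_univ_three]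
  nlinarith [sq_nonneg (g 0), sq_nonneg (g 1), sq_nonneg (g 2)]

@[fun_prop]
lemma continuous_dot {X : Type*} [TopologicalSpace X] {a b : X → V3} (ha : Continuous a)
    (hb : Continuous b) : Continuous fun x => a x ⬝ᵥ b x := by
  simp only [dotProduct]; fun_prop

@[fun_prop]
lemma continuous_cross {X : Type*} [TopologicalSpace X] {a b : X → V3} (ha : Continuous a)
    (hb : Continuous b) : Continuous fun x => a x ⨯₃ b x := by
  simp only [cross_apply]
  refine continuous_pi fun i => ?_
  fin_cases i <;> simp <;> fun_prop

lemma cross_smul_sub (u z k : V3) : (u ⨯₃ z) ⨯₃ k = (u ⬝ᵥ k) • z - (z ⬝ᵥ k) • u := by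
  ext i; fin_cases i <;> simp [cross_apply, dotProduct, Fin.sum_univ_three] <;> ring

lemma smul_of_cross {a b : V3} (h : a ⨯₃ b = 0) (ha : a ≠ 0) : b = (a ⬝ᵥ b / a ⬝ᵥ a) • a := by
  have h1 := cross_smul_sub a b a
  rw [h] at h1
  have h2 := dot_self_pos ha
  have h3 : (a ⬝ᵥ a) • b = (b ⬝ᵥ a) • a := by
    have : (0 : V3) ⨯₃ a = 0 := by simp
    rw [this] at h1
    exact (sub_eq_zero.1 h1.symm)
  rw [dotProduct_comm b a] at h3
  rw [div_eq_inv_mul, mul_smul, ← h3, smul_smul, inv_mul_cancel₀ h2.ne', one_smul]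

lemma exists_smul_of_cross {a b : V3} (h : a ⨯₃ b = 0) (ha : a ≠ 0) : ∃ t : ℝ, b = t • a :=
  ⟨_, smul_of_cross h ha⟩

lemma exists_smul_cross {a b z : V3} (hab : a ⨯₃ b ≠ 0) (ha : a ⬝ᵥ z = 0) (hb : b ⬝ᵥ z = 0) :
    ∃ t : ℝ, z = t • (a ⨯₃ b) := by
  refine exists_smul_of_cross ?_ hab
  rw [cross_smul_sub, ha, hb]; simp

lemma left_ne_of_cross {a b : V3} (hab : a ⨯₃ b ≠ 0) : a ≠ 0 := by
  rintro rfl; simp at hab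

lemma right_ne_of_cross {a b : V3} (hab : a ⨯₃ b ≠ 0) : b ≠ 0 := by
  rintro rfl; simp at hab

lemma cross_swap_ne {a b : V3} (hab : a ⨯₃ b ≠ 0) : b ⨯₃ a ≠ 0 := by
  rw [← cross_anticomm]; exact neg_ne_zero.2 hab

lemma exists_orth {u : V3} (hu : u ≠ 0) : ∃ k : V3, k ≠ 0 ∧ k ⬝ᵥ u = 0 := by
  by_contra! h
  have h1 : ∀ w : V3, u ⨯₃ w = 0 := by
    intro w; by_contra hw
    exact h _ hw (by rw [dotProduct_comm]; exact dot_self_cross _ _)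
  have h2 := h1 ![1, 0, 0]
  have h3 := h1 ![0, 1, 0]
  apply hu
  have a0 := congrFun h2 1
  have a1 := congrFun h2 2
  have a2 := congrFun h3 2
  simp [cross_apply] at a0 a1 a2
  ext i; fin_cases i <;> simp [a0, a1, a2]

lemma eq_zero_of_const {K : Set V3} (hint : (interior K).Nonempty) {g : V3} {r : ℝ}
    (h : ∀ y ∈ K, g ⬝ᵥ y = r) : g = 0 := by
  by_contra hg
  obtain ⟨y, hy⟩ := hint
  have hc : Continuous fun t : ℝ => y + t • g := by fun_prop
  have : ∀ᶠ t in 𝓝 (0 : ℝ), y + t • g ∈ interior K :=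
    hc.continuousAt.eventually (by simpa using isOpen_interior.mem_nhds hy)
  obtain ⟨ε, hε, hb⟩ := Metric.eventually_nhds_iff.1 this
  have h1 := h _ (interior_subset (hb (y := ε / 2) (by simp [abs_of_pos hε]; linarith)))
  have h2 := h _ (interior_subset hy)
  simp [dotProduct_add, h2] at h1
  rcases h1 with h1 | h1
  · linarith
  · exact hg h1

/-- Central symmetry of all plane sections through `p`. -/
def SectSym (K : Set V3) (p : V3) : Prop :=
  ∀ g : V3, g ≠ 0 → ∃ c : V3, ∀ y ∈ K, g ⬝ᵥ y = g ⬝ᵥ p →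
    (2 : ℝ) • c - y ∈ K ∧ g ⬝ᵥ ((2 : ℝ) • c - y) = g ⬝ᵥ p

lemma pencil_sym {K : Set V3} (hconv : Convex ℝ K) (hcl : IsClosed K)
    (hint : (interior K).Nonempty) {u p k m : V3} (hu : u ≠ 0) (hk : k ≠ 0) (hku : k ⬝ᵥ u = 0)
    (h : ∀ g : V3, g ≠ 0 → g ⬝ᵥ u = 0 → g ⨯₃ k ≠ 0 → ∀ y ∈ K, g ⬝ᵥ y = g ⬝ᵥ p →
      (2 : ℝ) • m - y ∈ K) : ∀ y ∈ K, (2 : ℝ) • m - y ∈ K := by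
  have h1 : ∀ y ∈ K, k ⬝ᵥ (y - p) ≠ 0 → (2 : ℝ) • m - y ∈ K := by
    intro y hy hky
    have hc : (u ⨯₃ (y - p)) ⨯₃ k ≠ 0 := by
      rw [cross_smul_sub, dotProduct_comm u k, hku, dotProduct_comm _ k]
      simpa [hu] using hky
    refine h (u ⨯₃ (y - p)) (left_ne_of_cross hc) ?_ hc y hy ?_
    · rw [dotProduct_comm]; exact dot_self_cross _ _
    · have : (u ⨯₃ (y - p)) ⬝ᵥ (y - p) = 0 := by
        rw [dotProduct_comm]; exact dot_cross_self _ _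
      rw [dotProduct_sub] at this; linarith
  have hC : IsClosed {y : V3 | (2 : ℝ) • m - y ∈ K} := hcl.preimage (by fun_prop)
  have h2 : interior K ⊆ {y : V3 | (2 : ℝ) • m - y ∈ K} := by
    intro y hy
    by_cases hky : k ⬝ᵥ (y - p) = 0
    · have hc : Continuous fun t : ℝ => y + t • k := by fun_prop
      have hev : ∀ᶠ t in 𝓝 (0 : ℝ), y + t • k ∈ interior K :=
        hc.continuousAt.eventually (by simpa using isOpen_interior.mem_nhds hy)
      have ht : Tendsto (fun t : ℝ => y + t • k) (𝓝[≠] 0) (𝓝 y) := by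
        have := hc.tendsto 0
        simp only [zero_smul, add_zero] at this
        exact this.mono_left nhdsWithin_le_nhds
      refine hC.mem_of_tendsto ht ?_
      filter_upwards [nhdsWithin_le_nhds hev, self_mem_nhdsWithin] with t ht ht0
      refine h1 _ (interior_subset ht) ?_
      have : y + t • k - p = (y - p) + t • k := by abel
      rw [this, dotProduct_add, hky, dotProduct_smul]
      simpa [hk] using ht0
    · exact h1 y (interior_subset hy) hky
  have h3 : K ⊆ closure (interior K) := by
    rw [hconv.closure_interior_eq_closure_of_nonempty_interior hint]; exact subset_closure
  exact fun y hy => (closure_minimal h2 hC) (h3 hy)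

lemma mid_eq {a b s : ℝ} (h1 : (2 * s - a - a) * (2 * s - a - b) ≤ 0)
    (h2 : (2 * s - b - a) * (2 * s - b - b) ≤ 0) : 2 * s = a + b := by
  have : (2 * s - a - b) ^ 2 ≤ 0 := by nlinarith
  have := pow_eq_zero_iff (two_ne_zero) |>.1 (le_antisymm this (sq_nonneg _))
  linarith

lemma no_expand {A : Set V3} (hA : IsCompact A) (φ : V3 → V3) (hφ : ∀ y ∈ A, φ y ∈ A) {ρ : ℝ}
    (hρ : 1 < ρ ^ 2) (h : ∀ y ∈ A, ∀ y' ∈ A, φ y - φ y' = ρ • (y - y')) {a b : V3} (ha : a ∈ A)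
    (hb : b ∈ A) : a = b := by
  obtain ⟨q, hq, hmax⟩ := (hA.prod hA).exists_isMaxOn (f := fun q : V3 × V3 =>
    (q.1 - q.2) ⬝ᵥ (q.1 - q.2)) ⟨(a, b), ha, hb⟩ (by fun_prop)
  by_contra hab
  have h1 : 0 < (a - b) ⬝ᵥ (a - b) := dot_self_pos (sub_ne_zero.2 hab)
  have h2 : (a - b) ⬝ᵥ (a - b) ≤ (q.1 - q.2) ⬝ᵥ (q.1 - q.2) :=
    hmax (show (a, b) ∈ A ×ˢ A from ⟨ha, hb⟩)
  have h3 : (φ q.1 - φ q.2) ⬝ᵥ (φ q.1 - φ q.2) ≤ (q.1 - q.2) ⬝ᵥ (q.1 - q.2) :=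
    hmax (show (φ q.1, φ q.2) ∈ A ×ˢ A from ⟨hφ _ hq.1, hφ _ hq.2⟩)
  rw [h _ hq.1 _ hq.2, smul_dotProduct, dotProduct_smul, smul_eq_mul, smul_eq_mul] at h3
  nlinarith

/-- Cutting a fat face by planes through the origin: points of the opposite face lift. -/
lemma lift_face {K : Set V3} (hK : IsCompact K) (hconv : Convex ℝ K) (hs : SectSym K 0)
    {f : V3} {M κ : ℝ} (hM : M ≠ 0) (hκ : κ ≠ 0)
    (hf : ∀ y ∈ K, (f ⬝ᵥ y - M) * (f ⬝ᵥ y - κ * M) ≤ 0) {e : Fin 3 → V3}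
    (he : ∀ i, e i ∈ K) (hfe : ∀ i, f ⬝ᵥ e i = M) (hκe : ∀ i, κ • e i ∈ K)
    (hind : (e 1 - e 0) ⨯₃ (e 2 - e 0) ≠ 0) :
    ∀ x ∈ K, f ⬝ᵥ x = κ * M → κ⁻¹ • x ∈ K := by
  intro x hx hfx
  by_contra hxt
  set x' := κ⁻¹ • x with hx'
  have hfx' : f ⬝ᵥ x' = M := by rw [hx', dotProduct_smul, hfx, smul_eq_mul]; field_simp
  have hκx' : κ • x' = x := by rw [hx', smul_smul, mul_inv_cancel₀ hκ, one_smul]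
  set F := K ∩ {y | f ⬝ᵥ y = M} with hF
  have hFc : IsCompact F := hK.inter_right (isClosed_eq (by fun_prop) (by fun_prop))
  obtain ⟨φ, u, v, hφ1, huv, hφ2⟩ := geometric_hahn_banach_compact_closed hconv hK
    (convex_singleton x') isClosed_singleton (by simpa using hxt)
  obtain ⟨n, hn⟩ := dual_repr φ
  simp only [hn] at hφ1 hφ2
  have hnx := hφ2 x' rfl
  obtain ⟨q, hq, hqmax⟩ := hFc.exists_isMaxOn (f := fun y => y ⬝ᵥ (y - x'))
    ⟨e 0, he 0, hfe 0⟩ (by fun_prop)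
  obtain ⟨N, hN0, hN⟩ : ∃ N : ℝ, 0 < N ∧ q ⬝ᵥ (q - x') < N * (n ⬝ᵥ x' - u) := by
    have hd : 0 < n ⬝ᵥ x' - u := by linarith
    refine ⟨(|q ⬝ᵥ (q - x')| + 1) / (n ⬝ᵥ x' - u), by positivity, ?_⟩
    rw [div_mul_cancel₀ _ hd.ne']
    linarith [le_abs_self (q ⬝ᵥ (q - x'))]
  obtain ⟨y, hy, hymax⟩ := hFc.exists_isMaxOn (f := fun y => N * (n ⬝ᵥ y) + (1 / 2) * (y ⬝ᵥ y))
    ⟨e 0, he 0, hfe 0⟩ (by fun_prop)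
  set t := N • n + y with ht
  have hexp : ∀ z ∈ F, t ⬝ᵥ z ≤ t ⬝ᵥ y - (1 / 2) * ((z - y) ⬝ᵥ (z - y)) := by
    intro z hz
    have h1 : N * (n ⬝ᵥ z) + (1 / 2) * (z ⬝ᵥ z) ≤ N * (n ⬝ᵥ y) + (1 / 2) * (y ⬝ᵥ y) := hymax hz
    simp only [ht, add_dotProduct, smul_dotProduct, smul_eq_mul, dotProduct_sub, sub_dotProduct]
    rw [dotProduct_comm z y]; linarith
  have huniq : ∀ z ∈ F, t ⬝ᵥ z = t ⬝ᵥ y → z = y := by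
    intro z hz h
    have h1 := hexp z hz
    have h2 := dot_self_nonneg (z - y)
    exact sub_eq_zero.1 (dotProduct_self_eq_zero.1 (by linarith))
  have htx : t ⬝ᵥ y < t ⬝ᵥ x' := by
    have h1 := hφ1 y hy.1
    have h2 : y ⬝ᵥ (y - x') ≤ q ⬝ᵥ (q - x') := hqmax hy
    simp only [ht, add_dotProduct, smul_dotProduct, smul_eq_mul]
    rw [dotProduct_sub] at h2
    nlinarith
  set β := t ⬝ᵥ y with hβ
  have hex : ∀ i, ∃ s : ℝ, 0 ≤ s ∧ s < 1 ∧ t ⬝ᵥ (e i + s • (x' - e i)) = β := by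
    intro i
    have h1 := hexp (e i) ⟨he i, hfe i⟩
    have h2 := dot_self_nonneg (e i - y)
    have h3 : 0 < t ⬝ᵥ x' - t ⬝ᵥ e i := by linarith
    refine ⟨(β - t ⬝ᵥ e i) / (t ⬝ᵥ x' - t ⬝ᵥ e i), div_nonneg (by linarith) h3.le, ?_, ?_⟩
    · rw [div_lt_one h3]; linarith
    · simp only [dotProduct_add, dotProduct_smul, dotProduct_sub, smul_eq_mul]
      rw [div_mul_cancel₀ _ h3.ne']; ring
  choose s hs0 hs1 hst using hex
  set w : Fin 3 → V3 := fun i => e i + s i • (x' - e i) with hw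
  have hfw : ∀ i, f ⬝ᵥ w i = M := by
    intro i; simp [hw, dotProduct_add, dotProduct_sub, hfe, hfx']
  have hκw : ∀ i, κ • w i ∈ K := by
    intro i
    have : κ • w i = (1 - s i) • (κ • e i) + s i • x := by
      rw [← hκx']; simp only [hw]; module
    rw [this]
    exact hconv (hκe i) hx (by linarith [hs1 i]) (hs0 i) (by ring)
  set g := t - (β / M) • f with hg
  have hgF : ∀ z, f ⬝ᵥ z = M → g ⬝ᵥ z = t ⬝ᵥ z - β := by
    intro z hz
    simp only [hg, sub_dotProduct, smul_dotProduct, hz, smul_eq_mul]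
    field_simp
  have hg0 : g ≠ 0 := by
    intro h0
    have := hgF x' hfx'
    rw [h0, zero_dotProduct] at this
    linarith
  obtain ⟨c, hc⟩ := hs g hg0
  simp only [dotProduct_zero] at hc
  have hcy := hc y hy.1 (by rw [hgF y hy.2]; ring)
  have hcw : ∀ i, (2 : ℝ) • c - κ • w i ∈ K ∧ g ⬝ᵥ ((2 : ℝ) • c - κ • w i) = 0 := fun i =>
    hc _ (hκw i) (by rw [dotProduct_smul, hgF _ (hfw i)]; simp only [hw]; rw [hst]; simp)
  have hfy : f ⬝ᵥ y = M := hy.2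
  have hmid : 2 * (f ⬝ᵥ c) = M + κ * M := by
    have h1 := hf _ hcy.1
    have h2 := hf _ (hcw 0).1
    simp only [dotProduct_sub, dotProduct_smul, smul_eq_mul, hfy, hfw] at h1 h2
    exact mid_eq h1 h2
  have heq : ∀ i, (2 : ℝ) • c - κ • w i = y := by
    intro i
    have hfi : f ⬝ᵥ ((2 : ℝ) • c - κ • w i) = M := by
      simp only [dotProduct_sub, dotProduct_smul, smul_eq_mul, hfw]; linarith
    refine huniq _ ⟨(hcw i).1, hfi⟩ ?_
    have := (hcw i).2
    rw [hgF _ hfi] at this; linarith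
  have hww : ∀ i, w i = w 0 := by
    intro i
    have h1 : κ • w i = κ • w 0 := by
      have := (heq i).trans (heq 0).symm
      exact sub_right_injective this
    exact smul_right_injective _ hκ h1
  have hei : ∀ i, e i = x' + (1 - s i)⁻¹ • (w 0 - x') := by
    intro i
    have h1 : (1 - s i) ≠ 0 := by linarith [hs1 i]
    have h2 : w 0 - x' = (1 - s i) • (e i - x') := by
      rw [← hww i]; simp only [hw]; module
    rw [h2, smul_smul, inv_mul_cancel₀ h1, one_smul]; abel
  apply hind
  have h1 : e 1 - e 0 = ((1 - s 1)⁻¹ - (1 - s 0)⁻¹) • (w 0 - x') := by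
    rw [hei 1, hei 0]; module
  have h2 : e 2 - e 0 = ((1 - s 2)⁻¹ - (1 - s 0)⁻¹) • (w 0 - x') := by
    rw [hei 2, hei 0]; module
  rw [h1, h2]; simp

/-- A fat face opposite to a boundary point through which all sections are symmetric is absurd. -/
lemma no_fat_face {K : Set V3} (hK : IsCompact K) (hconv : Convex ℝ K) (hs : SectSym K 0)
    (h0 : (0 : V3) ∈ K) {f : V3} {M : ℝ} (hM : M ≠ 0)
    (hf : ∀ y ∈ K, (f ⬝ᵥ y - M) * (f ⬝ᵥ y) ≤ 0) {e : Fin 3 → V3}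
    (he : ∀ i, e i ∈ K) (hfe : ∀ i, f ⬝ᵥ e i = M)
    (hind : (e 1 - e 0) ⨯₃ (e 2 - e 0) ≠ 0) : False := by
  set F := K ∩ {y | f ⬝ᵥ y = M} with hF
  have hFc : IsCompact F := hK.inter_right (isClosed_eq (by fun_prop) (by fun_prop))
  obtain ⟨t, ht, htmax⟩ := hFc.exists_isMaxOn (f := fun y => y ⬝ᵥ y)
    ⟨e 0, he 0, hfe 0⟩ (by fun_prop)
  have huniq : ∀ z ∈ F, t ⬝ᵥ z = t ⬝ᵥ t → z = t := by
    intro z hz h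
    have h1 : z ⬝ᵥ z ≤ t ⬝ᵥ t := htmax hz
    have h2 := dot_self_nonneg (z - t)
    refine sub_eq_zero.1 (dotProduct_self_eq_zero.1 (le_antisymm ?_ h2))
    simp only [dotProduct_sub, sub_dotProduct]
    rw [dotProduct_comm z t]; linarith
  have hgF : ∀ (β : ℝ) z, f ⬝ᵥ z = M → (t - (β / M) • f) ⬝ᵥ z = t ⬝ᵥ z - β := by
    intro β z hz
    simp only [sub_dotProduct, smul_dotProduct, hz, smul_eq_mul]
    field_simp
  have hg0F : ∀ (β : ℝ) z, f ⬝ᵥ z = 0 → (t - (β / M) • f) ⬝ᵥ z = t ⬝ᵥ z := by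
    intro β z hz
    simp [sub_dotProduct, smul_dotProduct, hz]
  have hne : ∀ β : ℝ, t - (β / M) • f ≠ 0 := by
    intro β h
    have h1 : ∀ z ∈ F, t ⬝ᵥ z = β := by
      intro z hz
      have := hgF β z hz.2
      rw [h, zero_dotProduct] at this; linarith
    have h2 : ∀ i, e i = t := fun i =>
      huniq _ ⟨he i, hfe i⟩ ((h1 _ ⟨he i, hfe i⟩).trans (h1 _ ht).symm)
    apply hind; simp [h2]
  have hft : f ⬝ᵥ t = M := ht.2
  have key : ∀ (g c : V3), (∀ y ∈ K, g ⬝ᵥ y = 0 → (2 : ℝ) • c - y ∈ K ∧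
      g ⬝ᵥ ((2 : ℝ) • c - y) = 0) → ∀ y ∈ F, g ⬝ᵥ y = 0 → 2 * (f ⬝ᵥ c) = M := by
    intro g c hc y hy hgy
    have h1 := hf _ (hc y hy.1 hgy).1
    have h2 := hf _ (hc 0 h0 (by simp)).1
    have hfy : f ⬝ᵥ y = M := hy.2
    simp only [dotProduct_sub, dotProduct_smul, smul_eq_mul, hfy, dotProduct_zero] at h1 h2
    have := mid_eq (a := M) (b := 0) (s := f ⬝ᵥ c) (by linarith) (by linarith)
    linarith
  obtain ⟨c, hc⟩ := hs _ (hne (t ⬝ᵥ t))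
  simp only [dotProduct_zero] at hc
  have hmid := key _ c hc t ht (by rw [hgF _ _ hft]; ring)
  have hz : ∀ z ∈ K, f ⬝ᵥ z = 0 → t ⬝ᵥ z = 0 → (2 : ℝ) • c - z = t := by
    intro z hz hfz htz
    have h1 := hc z hz (by rw [hg0F _ _ hfz, htz])
    have h2 : f ⬝ᵥ ((2 : ℝ) • c - z) = M := by
      simp only [dotProduct_sub, dotProduct_smul, smul_eq_mul, hfz]; linarith
    refine huniq _ ⟨h1.1, h2⟩ ?_
    have h3 := h1.2
    rw [hgF _ _ h2] at h3; linarith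
  have hz0 : ∀ z ∈ K, f ⬝ᵥ z = 0 → t ⬝ᵥ z = 0 → z = 0 := by
    intro z h1 h2 h3
    have := (hz z h1 h2 h3).trans (hz 0 h0 (by simp) (by simp)).symm
    exact sub_right_injective this
  obtain ⟨w, hw0, hwt, α₁, α₂, hwe⟩ : ∃ w : V3, w ≠ 0 ∧ t ⬝ᵥ w = 0 ∧
      ∃ α₁ α₂ : ℝ, w = α₁ • (e 1 - e 0) + α₂ • (e 2 - e 0) := by
    by_cases h1 : t ⬝ᵥ (e 1 - e 0) = 0
    · exact ⟨e 1 - e 0, left_ne_of_cross hind, h1, 1, 0, by simp⟩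
    · refine ⟨_, ?_, ?_, t ⬝ᵥ (e 2 - e 0), -(t ⬝ᵥ (e 1 - e 0)), rfl⟩
      · intro h
        apply h1
        have h2 : (e 1 - e 0) ⨯₃ ((t ⬝ᵥ (e 2 - e 0)) • (e 1 - e 0)) +
            (e 1 - e 0) ⨯₃ ((-(t ⬝ᵥ (e 1 - e 0))) • (e 2 - e 0)) = 0 := by
          rw [← map_add, h]; simp
        simp only [map_smul, cross_self, smul_zero, zero_add] at h2
        rcases smul_eq_zero.1 h2 with h3 | h3
        · linarith
        · exact absurd h3 hind
      · simp only [dotProduct_add, dotProduct_smul, smul_eq_mul]; ring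
  set q : V3 := e 0 + (1 / 3 : ℝ) • (e 1 - e 0) + (1 / 3 : ℝ) • (e 2 - e 0) with hq
  set s : ℝ := 1 / (6 * (|α₁| + |α₂| + 1)) with hs'
  have hspos : 0 < s := by positivity
  have hsα : s * (|α₁| + |α₂| + 1) = 1 / 6 := by rw [hs']; field_simp
  have hb1 := neg_abs_le (s * α₁)
  have hb2 := neg_abs_le (s * α₂)
  have hb3 := le_abs_self (s * α₁)
  have hb4 := le_abs_self (s * α₂)
  rw [abs_mul, abs_of_pos hspos] at hb1 hb2 hb3 hb4
  have hp1 : 0 ≤ s * |α₁| := by positivity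
  have hp2 : 0 ≤ s * |α₂| := by positivity
  have hmem : ∀ r₁ r₂ : ℝ, 0 ≤ r₁ → 0 ≤ r₂ → r₁ + r₂ ≤ 1 →
      e 0 + r₁ • (e 1 - e 0) + r₂ • (e 2 - e 0) ∈ F := by
    intro r₁ r₂ h1 h2 h3
    constructor
    · have : e 0 + r₁ • (e 1 - e 0) + r₂ • (e 2 - e 0) =
        ∑ i, (![1 - r₁ - r₂, r₁, r₂] : Fin 3 → ℝ) i • e i := by
        simp [Fin.sum_univ_three]; module
      rw [this]
      refine hconv.sum_mem ?_ ?_ (fun i _ => he i)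
      · intro i _; fin_cases i <;> simp <;> linarith
      · simp [Fin.sum_univ_three]; ring
    · simp [dotProduct_add, dotProduct_sub, hfe]
  have hqF : q ∈ F := hmem _ _ (by norm_num) (by norm_num) (by norm_num)
  have hq'F : q + s • w ∈ F := by
    have : q + s • w = e 0 + (1 / 3 + s * α₁) • (e 1 - e 0) + (1 / 3 + s * α₂) • (e 2 - e 0) := by
      rw [hwe, hq]; module
    rw [this]
    exact hmem _ _ (by nlinarith) (by nlinarith) (by nlinarith)
  obtain ⟨c', hc'⟩ := hs _ (hne (t ⬝ᵥ q))
  simp only [dotProduct_zero] at hc'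
  have hmid' := key _ c' hc' q hqF (by rw [hgF _ _ hqF.2]; ring)
  have hfin : ∀ z ∈ F, t ⬝ᵥ z = t ⬝ᵥ q → (2 : ℝ) • c' - z = 0 := by
    intro z hz htz
    have hfz : f ⬝ᵥ z = M := hz.2
    have h1 := hc' z hz.1 (by rw [hgF _ _ hz.2, htz]; ring)
    have h2 : f ⬝ᵥ ((2 : ℝ) • c' - z) = 0 := by
      simp only [dotProduct_sub, dotProduct_smul, smul_eq_mul, hfz]; linarith
    refine hz0 _ h1.1 h2 ?_
    have h3 := h1.2
    rwa [hg0F _ _ h2] at h3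
  have h1 := (hfin q hqF rfl).trans (hfin _ hq'F (by simp [dotProduct_add, hwt])).symm
  have h2 := sub_right_injective h1
  have h3 : s • w = 0 := by simpa using h2
  rcases smul_eq_zero.1 h3 with h | h
  · exact hspos.ne' h
  · exact hw0 h

end

section

lemma sym_of_homothetic_faces {K : Set V3} (hK : IsCompact K) (hconv : Convex ℝ K)
    (hint : (interior K).Nonempty) (hs : SectSym K 0) {f e : V3} {κ : ℝ} (hM : f ⬝ᵥ e ≠ 0)
    (hκ1 : κ < 1) (hκ2 : -1 < κ) (hf : ∀ y ∈ K, (f ⬝ᵥ y - f ⬝ᵥ e) * (f ⬝ᵥ y - κ * f ⬝ᵥ e) ≤ 0)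
    (he : e ∈ K) (hκe : κ • e ∈ K)
    (hκK : ∀ δ : V3, f ⬝ᵥ δ = 0 → e + δ ∈ K → κ • e + δ ∈ K → κ • (e + δ) ∈ K) :
    ∃ o : V3, ∀ y ∈ K, (2 : ℝ) • o - y ∈ K := by
  have he0 : e ≠ 0 := by rintro rfl; simp at hM
  choose c hc using fun g : {g : V3 // g ≠ 0} => hs g.1 g.2
  simp only [dotProduct_zero] at hc
  set m : V3 := ((κ + 1) / 2) • e with hm
  have hδ : ∀ g : {g : V3 // g ≠ 0}, g.1 ⬝ᵥ e = 0 → f ⬝ᵥ (c g - m) = 0 ∧ g.1 ⬝ᵥ (c g - m) = 0 ∧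
      e + (2 : ℝ) • (c g - m) ∈ K ∧ κ • e + (2 : ℝ) • (c g - m) ∈ K := by
    intro g hg
    have h1 := hc g e he hg
    have h2 := hc g (κ • e) hκe (by rw [dotProduct_smul, hg]; simp)
    have h3 := hf _ h1.1
    have h4 := hf _ h2.1
    simp only [dotProduct_sub, dotProduct_smul, smul_eq_mul] at h3 h4
    have h5 := mid_eq h3 h4
    refine ⟨?_, ?_, ?_, ?_⟩
    · simp only [hm, dotProduct_sub, dotProduct_smul, smul_eq_mul]; linarith
    · have h6 := h1.2
      simp only [dotProduct_sub, dotProduct_smul, smul_eq_mul, hg] at h6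
      simp only [hm, dotProduct_sub, dotProduct_smul, smul_eq_mul, hg]; linarith
    · convert h2.1 using 1; rw [hm]; module
    · convert h1.1 using 1; rw [hm]; module
  by_cases hex : ∃ g₁ g₂ : {g : V3 // g ≠ 0}, g₁.1 ⬝ᵥ e = 0 ∧ g₂.1 ⬝ᵥ e = 0 ∧ c g₁ ≠ m ∧ c g₂ ≠ m ∧
      g₁.1 ⨯₃ g₂.1 ≠ 0
  · exfalso
    obtain ⟨g₁, g₂, hg₁, hg₂, hc₁, hc₂, hcr⟩ := hex
    obtain ⟨f₁, k₁, a₁, b₁⟩ := hδ g₁ hg₁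
    obtain ⟨f₂, k₂, a₂, b₂⟩ := hδ g₂ hg₂
    have hd₁ : c g₁ - m ≠ 0 := sub_ne_zero.2 hc₁
    have hd₂ : c g₂ - m ≠ 0 := sub_ne_zero.2 hc₂
    set δ₁ := c g₁ - m with hδ₁
    set δ₂ := c g₂ - m with hδ₂
    have hind : δ₁ ⨯₃ δ₂ ≠ 0 := by
      intro h
      obtain ⟨t, ht⟩ := exists_smul_of_cross h hd₁
      have ht0 : t ≠ 0 := by rintro rfl; simp at ht; exact hd₂ ht
      have h1 : g₂.1 ⬝ᵥ δ₁ = 0 := by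
        rw [ht, dotProduct_smul, smul_eq_mul] at k₂
        exact (mul_eq_zero.1 k₂).resolve_left ht0
      obtain ⟨x, hx⟩ := exists_smul_cross hcr k₁ h1
      obtain ⟨z, hz⟩ := exists_smul_cross hcr hg₁ hg₂
      have hx0 : x ≠ 0 := by rintro rfl; simp at hx; exact hd₁ hx
      have : e = (z * x⁻¹) • δ₁ := by
        rw [hx, smul_smul, mul_assoc, inv_mul_cancel₀ hx0, mul_one, ← hz]
      rw [this, dotProduct_smul, f₁] at hM
      simp at hM
    have hind' : (e + (2 : ℝ) • δ₁ - e) ⨯₃ (e + (2 : ℝ) • δ₂ - e) ≠ 0 := by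
      simpa using hind
    set E : Fin 3 → V3 := ![e, e + (2 : ℝ) • δ₁, e + (2 : ℝ) • δ₂] with hE
    have hEK : ∀ i, E i ∈ K := by intro i; fin_cases i <;> simp [hE] <;> assumption
    have hEf : ∀ i, f ⬝ᵥ E i = f ⬝ᵥ e := by
      intro i; fin_cases i <;> simp [hE, dotProduct_add, f₁, f₂]
    by_cases hκ0 : κ = 0
    · subst hκ0
      refine no_fat_face hK hconv hs (by simpa using hκe) hM (fun y hy => ?_) hEK hEf hind'
      simpa using hf y hy
    · have hlift := lift_face hK hconv hs hM hκ0 hf hEK hEf (by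
        intro i
        fin_cases i
        · simpa [hE] using hκe
        · exact hκK _ (by simp [f₁]) a₁ b₁
        · exact hκK _ (by simp [f₂]) a₂ b₂) hind'
      have hc1e := hc g₁ e he hg₁
      set A := K ∩ {y | f ⬝ᵥ y = f ⬝ᵥ e} ∩ {y | g₁.1 ⬝ᵥ y = 0} with hA
      have hAc : IsCompact A :=
        (hK.inter_right (isClosed_eq (by fun_prop) (by fun_prop))).inter_right
        (isClosed_eq (by fun_prop) (by fun_prop))
      have heA : e ∈ A := ⟨⟨he, rfl⟩, hg₁⟩
      have hfc : 2 * (f ⬝ᵥ c g₁) = (κ + 1) * f ⬝ᵥ e := by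
        have : c g₁ = δ₁ + m := by rw [hδ₁]; abel
        rw [this, dotProduct_add, f₁, hm, dotProduct_smul, smul_eq_mul]; ring
      have := no_expand hAc (fun y => κ⁻¹ • ((2 : ℝ) • c g₁ - y)) (ρ := -κ⁻¹) ?_ ?_ ?_ heA
        (b := e + (2 : ℝ) • δ₁) ⟨⟨a₁, ?_⟩, ?_⟩
      · apply hd₁
        have h2 : (2 : ℝ) • δ₁ = 0 := by simpa using this
        simpa using h2
      · rintro y ⟨⟨hy, hyf⟩, hyg⟩
        simp only [mem_ofPred_eq] at hyf hyg
        have h1 := hc g₁ y hy hyg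
        have h2 : f ⬝ᵥ ((2 : ℝ) • c g₁ - y) = κ * f ⬝ᵥ e := by
          rw [dotProduct_sub, dotProduct_smul, smul_eq_mul, hyf]; linarith
        refine ⟨⟨hlift _ h1.1 h2, ?_⟩, ?_⟩
        · show f ⬝ᵥ (κ⁻¹ • ((2 : ℝ) • c g₁ - y)) = _
          rw [dotProduct_smul, h2, smul_eq_mul]; field_simp
        · show g₁.1 ⬝ᵥ (κ⁻¹ • ((2 : ℝ) • c g₁ - y)) = _
          rw [dotProduct_smul, h1.2]; simp
      · rw [neg_sq, inv_pow]
        exact (one_lt_inv₀ (by positivity)).2 (by nlinarith)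
      · intro y _ y' _; module
      · simp [dotProduct_add, f₁]
      · simp [dotProduct_add, hg₁, k₁]
  · push Not at hex
    by_cases h1 : ∃ g₁ : {g : V3 // g ≠ 0}, g₁.1 ⬝ᵥ e = 0 ∧ c g₁ ≠ m
    · obtain ⟨g₁, hg₁, hc₁⟩ := h1
      refine ⟨m, pencil_sym hconv hK.isClosed hint he0 g₁.2 hg₁ (p := 0) ?_⟩
      intro g hg hge hgk y hy hgy
      by_cases hcg : c ⟨g, hg⟩ = m
      · rw [← hcg]; exact (hc ⟨g, hg⟩ y hy (by simpa using hgy)).1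
      · exact absurd (hex ⟨g, hg⟩ g₁ hge hg₁ hcg hc₁) hgk
    · push Not at h1
      obtain ⟨k, hk, hke⟩ := exists_orth he0
      refine ⟨m, pencil_sym hconv hK.isClosed hint he0 hk hke (p := 0) ?_⟩
      intro g hg hge hgk y hy hgy
      rw [← h1 ⟨g, hg⟩ hge]; exact (hc ⟨g, hg⟩ y hy (by simpa using hgy)).1

lemma exists_supporting {K : Set V3} (hconv : Convex ℝ K) (hint : (interior K).Nonempty) {x : V3}
    (hx : x ∉ interior K) : ∃ f : V3, f ≠ 0 ∧ ∀ y ∈ K, f ⬝ᵥ x ≤ f ⬝ᵥ y := by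
  obtain ⟨φ, hφ, h⟩ := geometric_hahn_banach_of_nonempty_interior_point hconv hx hint
  obtain ⟨g, hg, hgφ⟩ := dual_repr_ne hφ
  refine ⟨-g, neg_ne_zero.2 hg, fun y hy => ?_⟩
  have := h y hy
  rw [hgφ, hgφ] at this
  simp only [neg_dotProduct]; linarith

theorem exists_centre {K : Set V3} (hK : IsCompact K) (hconv : Convex ℝ K)
    (hint : (interior K).Nonempty) (hs : SectSym K 0) :
    ∃ o : V3, ∀ y ∈ K, (2 : ℝ) • o - y ∈ K := by
  by_cases h0 : (0 : V3) ∈ K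
  · by_cases h0i : (0 : V3) ∈ interior K
    · -- interior point
      set I : Set ℝ := Icc 0 1 ∩ {s | ∀ y ∈ K, (-s) • y ∈ K} with hI
      have hIc : IsCompact I := by
        refine isCompact_Icc.inter_right ?_
        have : {s : ℝ | ∀ y ∈ K, (-s) • y ∈ K} = ⋂ y ∈ K, (fun s : ℝ => (-s) • y) ⁻¹' K := by
          ext s; simp
        rw [this]
        exact isClosed_biInter fun y _ => hK.isClosed.preimage (by fun_prop)
      obtain ⟨μ, hμ, hmax⟩ := hIc.exists_isMaxOn (f := fun s : ℝ => s)
        ⟨0, by simp, fun y _ => by simpa using h0⟩ (by fun_prop)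
      have hmaj : ∀ s : ℝ, 0 ≤ s → s ≤ 1 → (∀ y ∈ K, (-s) • y ∈ K) → s ≤ μ :=
        fun s h1 h2 h3 => hmax (show s ∈ I from ⟨⟨h1, h2⟩, h3⟩)
      have hthick : (∀ e ∈ K, (-μ) • e ∈ interior K) → ∀ᶠ s in 𝓝 μ, ∀ y ∈ K, (-s) • y ∈ K := by
        intro h
        refine hK.eventually_forall_of_forall_eventually fun e he => ?_
        have hc : Continuous fun z : ℝ × V3 => (-z.1) • z.2 := by fun_prop
        exact hc.continuousAt.preimage_mem_nhds
          (mem_of_superset (isOpen_interior.mem_nhds (h e he)) interior_subset)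
      have hμ0 : 0 < μ := by
        by_contra hneg
        have h1 : μ = 0 := le_antisymm (not_lt.1 hneg) hμ.1.1
        have h2 := hthick (by intro e _; rw [h1]; simpa using h0i)
        rw [h1] at h2
        obtain ⟨ε, hε, hb⟩ := Metric.eventually_nhds_iff.1 h2
        have hlt : 0 < min (ε / 2) 1 := by positivity
        have := hmaj (min (ε / 2) 1) hlt.le (min_le_right _ _) (hb (by
          rw [Real.dist_eq, sub_zero, abs_of_pos hlt]
          exact lt_of_le_of_lt (min_le_left _ _) (by linarith)))
        linarith
      rcases hμ.1.2.lt_or_eq with hμ1 | hμ1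
      · obtain ⟨e, he, hei⟩ : ∃ e ∈ K, (-μ) • e ∉ interior K := by
          by_contra! h
          obtain ⟨ε, hε, hb⟩ := Metric.eventually_nhds_iff.1 (hthick h)
          have hlt : 0 < min (ε / 2) (1 - μ) := lt_min (by positivity) (by linarith)
          have := hmaj (μ + min (ε / 2) (1 - μ)) (by linarith)
            (by linarith [min_le_right (ε / 2) (1 - μ)]) (hb (by
            rw [Real.dist_eq, add_sub_cancel_left, abs_of_pos hlt]
            exact lt_of_le_of_lt (min_le_left _ _) (by linarith)))
          linarith
        obtain ⟨f, hf0, hf⟩ := exists_supporting hconv hint hei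
        have hfe : ∀ y ∈ K, f ⬝ᵥ y ≤ f ⬝ᵥ e := by
          intro y hy
          have := hf _ (hμ.2 y hy)
          simp only [dotProduct_smul, smul_eq_mul] at this
          nlinarith
        have hM : f ⬝ᵥ e ≠ 0 := by
          intro h
          apply hf0
          refine eq_zero_of_const hint (r := 0) fun y hy => le_antisymm ?_ ?_
          · rw [← h]; exact hfe y hy
          · have := hf y hy
            rwa [dotProduct_smul, h, smul_zero] at this
        refine sym_of_homothetic_faces hK hconv hint hs hM (κ := -μ) (by linarith) (by linarith)
          (fun y hy => ?_) he (hμ.2 e he) (fun δ _ h _ => hμ.2 _ h)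
        have h1 := hfe y hy
        have h2 := hf y hy
        rw [dotProduct_smul, smul_eq_mul] at h2
        exact mul_nonpos_of_nonpos_of_nonneg (by linarith) (by linarith)
      · refine ⟨0, fun y hy => ?_⟩
        have := hμ.2 y hy
        rw [hμ1] at this
        simpa using this
    · obtain ⟨f, hf0, hf⟩ := exists_supporting hconv hint h0i
      simp only [dotProduct_zero] at hf
      obtain ⟨e, he, hmax⟩ := hK.exists_isMaxOn (f := fun y => f ⬝ᵥ y) ⟨0, h0⟩ (by fun_prop)
      have hfe : ∀ y ∈ K, f ⬝ᵥ y ≤ f ⬝ᵥ e := fun y hy => hmax hy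
      have hM : f ⬝ᵥ e ≠ 0 := by
        intro h
        exact hf0 (eq_zero_of_const hint (r := 0) fun y hy =>
          le_antisymm (by rw [← h]; exact hfe y hy) (hf y hy))
      refine sym_of_homothetic_faces hK hconv hint hs hM (κ := 0) (by norm_num) (by norm_num)
        (fun y hy => ?_) he (by simpa using h0) (fun δ _ _ _ => by simpa using h0)
      have h1 := hfe y hy
      have h2 := hf y hy
      exact mul_nonpos_of_nonpos_of_nonneg (by linarith) (by linarith)
  · -- exterior point
    obtain ⟨y₀, hy₀⟩ := hint
    obtain ⟨R, hR⟩ : ∃ R : ℝ, ∀ s : ℝ, ∀ y ∈ K, s • y ∈ K → s ≤ R := by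
      obtain ⟨ψ, a, b, h1, h2, h3⟩ := geometric_hahn_banach_compact_closed hconv hK
        (convex_singleton (0 : V3)) isClosed_singleton (by simpa using h0)
      have h4 : b < 0 := by simpa using h3 0 rfl
      obtain ⟨q, hq, hmin⟩ := hK.exists_isMinOn (f := ψ) ⟨y₀, interior_subset hy₀⟩ (by fun_prop)
      refine ⟨(ψ q) / a, fun s y hy hsy => ?_⟩
      have h5 : ψ q ≤ s * ψ y := by simpa using hmin hsy
      have h6 := h1 y hy
      have ha : a < 0 := by linarith
      rw [le_div_iff_of_neg ha]
      by_contra hcon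
      have h7 : s * a < s * ψ y := by linarith
      have h8 : ψ y < 0 := by linarith
      have h10 : ψ q < 0 := by linarith [h1 q hq]
      have h9 : 0 < s := by
        by_contra hs0
        nlinarith
      nlinarith
    set I : Set (ℝ × V3) := (Icc 1 R ×ˢ K) ∩ {z | z.1 • z.2 ∈ K} with hI
    have hIc : IsCompact I := (isCompact_Icc.prod hK).inter_right
      (hK.isClosed.preimage (by fun_prop))
    have hext : ∀ y ∈ interior K, ∃ s : ℝ, 1 < s ∧ s • y ∈ K := by
      intro y hy
      have hc : Continuous fun s : ℝ => s • y := by fun_prop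
      have : ∀ᶠ s : ℝ in 𝓝 1, s • y ∈ interior K := hc.continuousAt.preimage_mem_nhds
        (isOpen_interior.mem_nhds (show (1 : ℝ) • y ∈ interior K by simpa using hy))
      obtain ⟨ε, hε, hb⟩ := Metric.eventually_nhds_iff.1 this
      exact ⟨1 + ε / 2, by linarith, interior_subset (hb (by
        rw [Real.dist_eq, add_sub_cancel_left, abs_of_pos (by linarith)]; linarith))⟩
    have hmemI : ∀ s : ℝ, 1 ≤ s → ∀ y ∈ K, s • y ∈ K → (s, y) ∈ I :=
      fun s h1 y hy h2 => ⟨⟨⟨h1, hR s y hy h2⟩, hy⟩, h2⟩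
    obtain ⟨s₀, hs₀, hs₀K⟩ := hext y₀ hy₀
    obtain ⟨⟨l, d⟩, hld, hmax⟩ := hIc.exists_isMaxOn (f := fun z : ℝ × V3 => z.1)
      ⟨_, hmemI s₀ hs₀.le y₀ (interior_subset hy₀) hs₀K⟩ (by fun_prop)
    have hmaj : ∀ s : ℝ, 1 ≤ s → ∀ y ∈ K, s • y ∈ K → s ≤ l :=
      fun s h1 y hy h2 => hmax (hmemI s h1 y hy h2)
    have hl1 : 1 < l := lt_of_lt_of_le hs₀ (hmaj s₀ hs₀.le y₀ (interior_subset hy₀) hs₀K)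
    have hd : d ∈ K := hld.1.2
    have hldK : l • d ∈ K := hld.2
    have hdisj : Disjoint (interior K) ((fun y : V3 => l • y) '' K) := by
      rw [Set.disjoint_left]
      rintro _ hx ⟨y, hy, rfl⟩
      obtain ⟨s, hs1, hsK⟩ := hext _ hx
      have := hmaj (s * l) (by nlinarith) y hy (by rw [mul_smul]; exact hsK)
      nlinarith
    obtain ⟨φ, u, h1, h2⟩ := geometric_hahn_banach_open hconv.interior isOpen_interior
      (hconv.smul l) hdisj
    obtain ⟨f, hf⟩ := dual_repr φ
    simp only [hf] at h1 h2
    have h1' : ∀ a ∈ K, f ⬝ᵥ a ≤ u := by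
      have hcl : K ⊆ closure (interior K) := by
        rw [hconv.closure_interior_eq_closure_of_nonempty_interior ⟨y₀, hy₀⟩]; exact subset_closure
      have hcs : IsClosed {a : V3 | f ⬝ᵥ a ≤ u} := isClosed_le (by fun_prop) (by fun_prop)
      exact fun a ha => closure_minimal (fun a ha => (h1 a ha).le) hcs (hcl ha)
    have h2' : ∀ y ∈ K, u ≤ l * f ⬝ᵥ y := by
      intro y hy
      have := h2 (l • y) ⟨y, hy, rfl⟩
      simpa using this
    have hfe : f ⬝ᵥ (l • d) = u := le_antisymm (h1' _ hldK) (by simpa using h2' d hd)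
    have hu : u ≠ 0 := by
      intro h
      have h3 := h1 y₀ hy₀
      have h4 := h2' y₀ (interior_subset hy₀)
      rw [h] at h3 h4
      nlinarith
    have hl0 : l ≠ 0 := by linarith
    have hll : l⁻¹ * l = 1 := inv_mul_cancel₀ hl0
    have hli : 0 < l⁻¹ := by positivity
    have hli1 : l⁻¹ < 1 := inv_lt_one_of_one_lt₀ hl1
    refine sym_of_homothetic_faces hK hconv ⟨y₀, hy₀⟩ hs (f := f) (e := l • d) (κ := l⁻¹)
      (by rw [hfe]; exact hu) hli1 (by linarith) (fun y hy => ?_) hldK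
      (by rw [smul_smul, hll, one_smul]; exact hd) ?_
    · rw [hfe]
      have h3 := h1' y hy
      have h4 := h2' y hy
      refine mul_nonpos_of_nonpos_of_nonneg (by linarith) ?_
      have h5 : l⁻¹ * u ≤ l⁻¹ * (l * f ⬝ᵥ y) := mul_le_mul_of_nonneg_left h4 hli.le
      rw [← mul_assoc, hll, one_mul] at h5
      linarith
    · intro δ _ _ h3
      rw [smul_smul, hll, one_smul] at h3
      have : l⁻¹ • (l • d + δ) = (1 - l⁻¹) • d + l⁻¹ • (d + δ) := by
        rw [smul_add, smul_smul, hll]; module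
      rw [this]
      exact hconv hd h3 (by linarith) hli.le (by ring)

end

section

lemma no_translate {A : Set V3} (hA : IsCompact A) (hne : A.Nonempty) {d : V3}
    (h : ∀ y ∈ A, y + d ∈ A) : d = 0 := by
  obtain ⟨q, hq, hmax⟩ := hA.exists_isMaxOn (f := fun y => d ⬝ᵥ y) hne (by fun_prop)
  have h1 : d ⬝ᵥ (q + d) ≤ d ⬝ᵥ q := hmax (h q hq)
  rw [dotProduct_add] at h1
  exact dotProduct_self_eq_zero.1 (le_antisymm (by linarith) (dot_self_nonneg d))

/-- A symmetric convex body with a point `-e` other than its centre through which all plane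
sections are symmetric; `-v g` is the centre of the section orthogonal to `g`. -/
structure FC (K : Set V3) (e : V3) (v : V3 → V3) : Prop where
  cpt : IsCompact K
  conv : Convex ℝ K
  int : (interior K).Nonempty
  symm : ∀ y ∈ K, -y ∈ K
  ne : e ≠ 0
  dot : ∀ g : V3, g ≠ 0 → g ⬝ᵥ v g = g ⬝ᵥ e
  refl : ∀ g : V3, g ≠ 0 → ∀ y ∈ K, g ⬝ᵥ y = -(g ⬝ᵥ e) → y + (2 : ℝ) • v g ∈ K

/-- The plane through `-e` orthogonal to `g` meets the interior of `K`. -/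
def Good (K : Set V3) (e g : V3) : Prop := ∃ y ∈ interior K, g ⬝ᵥ y = -(g ⬝ᵥ e)

variable {K : Set V3} {e : V3} {v : V3 → V3}

lemma Good.smul {g : V3} (h : Good K e g) (t : ℝ) : Good K e (t • g) := by
  obtain ⟨y, hy, h⟩ := h
  exact ⟨y, hy, by simp [h]⟩

lemma Good.of_line {u g : V3} {t : ℝ} (h : -e + t • u ∈ interior K) (hg : g ⬝ᵥ u = 0) :
    Good K e g := ⟨_, h, by simp [dotProduct_add, hg]⟩

lemma tendsto_slide {g y : V3} (hg : g ≠ 0) (hgy : g ⬝ᵥ y = -(g ⬝ᵥ e)) :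
    Tendsto (fun g' : V3 => y - ((g' ⬝ᵥ (y + e)) / (g' ⬝ᵥ g')) • g') (𝓝 g) (𝓝 y) := by
  have h1 : ContinuousAt (fun g' : V3 => y - ((g' ⬝ᵥ (y + e)) / (g' ⬝ᵥ g')) • g') g := by
    have h0 : ContinuousAt (fun g' : V3 => (g' ⬝ᵥ (y + e)) / (g' ⬝ᵥ g')) g :=
      (continuous_dot continuous_id continuous_const).continuousAt.div
        (continuous_dot continuous_id continuous_id).continuousAt (dot_self_pos hg).ne'
    exact continuousAt_const.sub (h0.smul continuousAt_id)
  have h2 : g ⬝ᵥ (y + e) = 0 := by rw [dotProduct_add, hgy]; ring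
  simpa [ContinuousAt, h2] using h1

lemma slide_mem {g y : V3} (hg : g ≠ 0) :
    g ⬝ᵥ (y - ((g ⬝ᵥ (y + e)) / (g ⬝ᵥ g)) • g) = -(g ⬝ᵥ e) := by
  rw [dotProduct_sub, dotProduct_smul, smul_eq_mul, div_mul_cancel₀ _ (dot_self_pos hg).ne',
    dotProduct_add]; ring

lemma Good.eventually {g : V3} (hg : g ≠ 0) (h : Good K e g) : ∀ᶠ g' in 𝓝 g, Good K e g' := by
  obtain ⟨y, hy, hgy⟩ := h
  filter_upwards [(tendsto_slide hg hgy).eventually (isOpen_interior.mem_nhds hy),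
    isOpen_ne.mem_nhds hg] with g' h1 h2
  exact ⟨_, h1, slide_mem h2⟩

lemma section_dense (hconv : Convex ℝ K) {g : V3} (h : Good K e g) {P : Set V3} (hP : IsClosed P)
    (hint : ∀ y ∈ interior K, g ⬝ᵥ y = -(g ⬝ᵥ e) → y ∈ P) :
    ∀ y ∈ K, g ⬝ᵥ y = -(g ⬝ᵥ e) → y ∈ P := by
  intro y hy hgy
  obtain ⟨y₀, hy₀, hg₀⟩ := h
  have hc : Continuous fun t : ℝ => (1 - t) • y + t • y₀ := by fun_prop
  have ht : Tendsto (fun t : ℝ => (1 - t) • y + t • y₀) (𝓝[>] 0) (𝓝 y) := by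
    have := hc.tendsto 0
    simp only [sub_zero, one_smul, zero_smul, add_zero] at this
    exact this.mono_left nhdsWithin_le_nhds
  refine hP.mem_of_tendsto ht ?_
  filter_upwards [Ioo_mem_nhdsGT (zero_lt_one (α := ℝ))] with t ht
  refine hint _ (hconv.combo_self_interior_mem_interior hy hy₀ (by linarith [ht.2])
    ht.1 (by ring)) ?_
  simp only [dotProduct_add, dotProduct_smul, hgy, hg₀, smul_eq_mul]; ring

namespace FC

lemma unique (F : FC K e v) {g w : V3} (hg : g ≠ 0) (hgood : Good K e g)
    (hw : g ⬝ᵥ w = g ⬝ᵥ e) (h : ∀ y ∈ K, g ⬝ᵥ y = -(g ⬝ᵥ e) → y + (2 : ℝ) • w ∈ K) : w = v g := by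
  obtain ⟨y₀, hy₀, hg₀⟩ := hgood
  have hA : IsCompact (K ∩ {y | g ⬝ᵥ y = -(g ⬝ᵥ e)}) :=
    F.cpt.inter_right (isClosed_eq (by fun_prop) (by fun_prop))
  have := no_translate hA ⟨y₀, interior_subset hy₀, hg₀⟩ (d := (2 : ℝ) • (w - v g)) (by
    rintro y ⟨hy, hgy⟩
    simp only [mem_ofPred_eq] at hgy
    have h1 := F.symm _ (F.refl g hg y hy hgy)
    have h2 : g ⬝ᵥ (-(y + (2 : ℝ) • v g)) = -(g ⬝ᵥ e) := by
      simp only [dotProduct_neg, dotProduct_add, dotProduct_smul, smul_eq_mul, F.dot g hg, hgy]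
      ring
    have h3 := h _ h1 h2
    refine ⟨?_, ?_⟩
    · have h4 := F.refl g hg y hy hgy
      have h5 : g ⬝ᵥ (-(y + (2 : ℝ) • w)) = -(g ⬝ᵥ e) := by
        simp only [dotProduct_neg, dotProduct_add, dotProduct_smul, smul_eq_mul, hw, hgy]; ring
      have h6 := F.refl g hg _ (F.symm _ (h y hy hgy)) h5
      have h7 := F.symm _ h6
      convert h7 using 1; module
    · show g ⬝ᵥ _ = _
      simp only [dotProduct_add, dotProduct_smul, dotProduct_sub, hw, F.dot g hg, hgy]; simp)
  have h2 : w - v g = 0 := by simpa using this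
  exact sub_eq_zero.1 h2

lemma smul_eq (F : FC K e v) {g : V3} (hg : g ≠ 0) (hgood : Good K e g) {t : ℝ} (ht : t ≠ 0) :
    v (t • g) = v g := by
  refine F.unique hg hgood ?_ ?_
  · have := F.dot (t • g) (smul_ne_zero ht hg)
    simp only [smul_dotProduct, smul_eq_mul] at this
    exact mul_left_cancel₀ ht this
  · intro y hy hgy
    exact F.refl (t • g) (smul_ne_zero ht hg) y hy (by simp [hgy])

lemma v_int (F : FC K e v) {g : V3} (hg : g ≠ 0) (hgood : Good K e g) : -v g ∈ interior K := by
  obtain ⟨y, hy, hgy⟩ := hgood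
  have h1 := F.symm _ (F.refl g hg y (interior_subset hy) hgy)
  have h2 := F.conv.combo_interior_self_mem_interior hy h1 (a := 1 / 2) (b := 1 / 2)
    (by norm_num) (by norm_num) (by norm_num)
  convert h2 using 1; module

lemma symm_int (F : FC K e v) {y : V3} (hy : y ∈ interior K) : -y ∈ interior K := by
  have h : K = -K := by
    ext z; exact ⟨fun h => F.symm z h, fun h => by simpa using F.symm _ h⟩
  have h2 : (Homeomorph.neg V3) ⁻¹' interior K = interior ((Homeomorph.neg V3) ⁻¹' K) :=
    (Homeomorph.neg V3).preimage_interior K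
  have h3 : (Homeomorph.neg V3) ⁻¹' K = K := h.symm
  rw [h3] at h2
  exact h2.symm.subset hy

lemma zero_int (F : FC K e v) : (0 : V3) ∈ interior K := by
  obtain ⟨y, hy⟩ := F.int
  have := F.conv.interior hy (F.symm_int hy) (a := 1 / 2) (b := 1 / 2)
    (by norm_num) (by norm_num) (by norm_num)
  convert this using 1; module

lemma good_of_orth (F : FC K e v) {g : V3} (h : g ⬝ᵥ e = 0) : Good K e g :=
  ⟨0, F.zero_int, by simp [h]⟩

lemma v_eq_zero (F : FC K e v) {g : V3} (hg : g ≠ 0) (h : g ⬝ᵥ e = 0) : v g = 0 := by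
  refine (F.unique hg (F.good_of_orth h) (by simp [h]) ?_).symm
  intro y hy _; simpa using hy

lemma continuousAt (F : FC K e v) {g : V3} (hg : g ≠ 0) (hgood : Good K e g) :
    ContinuousAt v g := by
  refine F.cpt.tendsto_nhds_of_unique_mapClusterPt ?_ ?_
  · filter_upwards [hgood.eventually hg, isOpen_ne.mem_nhds hg] with g' h1 h2
    simpa using F.symm _ (interior_subset (F.v_int h2 h1))
  · intro w _ hcl
    obtain ⟨U, hU, hUw⟩ := mapClusterPt_iff_ultrafilter.1 hcl
    have hne : ∀ᶠ g' in (U : Filter V3), g' ≠ 0 := hU (isOpen_ne.mem_nhds hg)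
    have hid : Tendsto (fun g' : V3 => g') U (𝓝 g) := hU
    have hdotc : Continuous fun z : V3 × V3 => z.1 ⬝ᵥ z.2 := by fun_prop
    refine F.unique hg hgood ?_ ?_
    · have h1 : Tendsto (fun g' => g' ⬝ᵥ v g') U (𝓝 (g ⬝ᵥ w)) :=
        (hdotc.tendsto (g, w)).comp (hid.prodMk_nhds hUw)
      have h2 : Tendsto (fun g' => g' ⬝ᵥ e) U (𝓝 (g ⬝ᵥ e)) :=
        (hdotc.tendsto (g, e)).comp (hid.prodMk_nhds tendsto_const_nhds)
      exact tendsto_nhds_unique (h1.congr' (hne.mono fun g' h => F.dot g' h)) h2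
    · refine section_dense F.conv hgood (P := {y | y + (2 : ℝ) • w ∈ K})
        (F.cpt.isClosed.preimage (by fun_prop)) ?_
      intro y hy hgy
      have hs := (tendsto_slide hg hgy).mono_left hU
      have h1 := hs.add (hUw.const_smul (2 : ℝ))
      refine F.cpt.isClosed.mem_of_tendsto h1 ?_
      filter_upwards [hs.eventually (isOpen_interior.mem_nhds hy), hne] with g' h2 h3
      exact F.refl g' h3 _ (interior_subset h2) (slide_mem h3)

end FC

end

section

variable {K : Set V3} {e : V3} {v : V3 → V3}

lemma cross_dot_self (a b : V3) : (a ⨯₃ b) ⬝ᵥ a = 0 := by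
  rw [dotProduct_comm]; exact dot_self_cross _ _

lemma cross_dot_right (a b : V3) : (a ⨯₃ b) ⬝ᵥ b = 0 := by
  rw [dotProduct_comm]; exact dot_cross_self _ _

lemma exists_dot_bound (hK : IsCompact K) (g : V3) : ∃ C : ℝ, ∀ y ∈ K, |g ⬝ᵥ y| ≤ C := by
  obtain ⟨C, hC⟩ := hK.exists_bound_of_continuousOn (f := fun y => g ⬝ᵥ y) (by fun_prop)
  exact ⟨C, fun y hy => by simpa using hC y hy⟩

lemma eventually_line {z u : V3} (hz : z ∈ interior K) :
    ∀ᶠ s in 𝓝 (0 : ℝ), z + s • u ∈ interior K := by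
  have hc : Continuous fun s : ℝ => z + s • u := by fun_prop
  exact hc.continuousAt.preimage_mem_nhds (isOpen_interior.mem_nhds (by simpa using hz))

lemma exists_pos_line {z u : V3} (hz : z ∈ interior K) :
    ∃ s : ℝ, 0 < s ∧ z + s • u ∈ interior K ∧ z + (-s) • u ∈ interior K := by
  obtain ⟨ε, hε, hb⟩ := Metric.eventually_nhds_iff.1 (eventually_line (u := u) hz)
  refine ⟨ε / 2, by linarith, hb ?_, hb ?_⟩ <;>
  · simp [abs_of_pos hε]; linarith

/-- `m ± σ u` are the end points of the chord of `K` through `-e` in direction `u`. -/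
structure Chord (K : Set V3) (e u m : V3) (τ σ : ℝ) : Prop where
  u_ne : u ≠ 0
  line : m = -e + τ • u
  pos : 0 < σ
  left : m + σ • u ∈ K
  right : m - σ • u ∈ K
  bdd : ∀ s : ℝ, m + s • u ∈ K → |s| ≤ σ
  meets : ∃ t : ℝ, -e + t • u ∈ interior K

lemma exists_chord (hK : IsCompact K) {u : V3} (hu : u ≠ 0) {t : ℝ}
    (ht : -e + t • u ∈ interior K) : ∃ m τ σ, Chord K e u m τ σ := by
  set A : Set ℝ := {s : ℝ | -e + s • u ∈ K} with hA
  have hcl : IsClosed A := hK.isClosed.preimage (by fun_prop)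
  obtain ⟨C, hC⟩ := exists_dot_bound hK u
  have hsub : A ⊆ Icc (-((C + |u ⬝ᵥ e|) / u ⬝ᵥ u)) ((C + |u ⬝ᵥ e|) / u ⬝ᵥ u) := by
    intro s hs
    have h1 := hC _ hs
    simp only [dotProduct_add, dotProduct_neg, dotProduct_smul, smul_eq_mul] at h1
    have h2 := dot_self_pos hu
    show _ ∧ _
    rw [← abs_le, le_div_iff₀ h2]
    calc |s| * u ⬝ᵥ u = |s * u ⬝ᵥ u| := by rw [abs_mul, abs_of_pos h2]
      _ = |(-(u ⬝ᵥ e) + s * u ⬝ᵥ u) + u ⬝ᵥ e| := by congr 1; ring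
      _ ≤ _ := (abs_add_le _ _).trans (by linarith)
  have hc : IsCompact A := isCompact_Icc.of_isClosed_subset hcl hsub
  have htA : t ∈ A := interior_subset (s := K) ht
  obtain ⟨s₂, hs₂, hmax⟩ := hc.exists_isMaxOn (f := fun s : ℝ => s) ⟨t, htA⟩ (by fun_prop)
  obtain ⟨s₁, hs₁, hmin⟩ := hc.exists_isMinOn (f := fun s : ℝ => s) ⟨t, htA⟩ (by fun_prop)
  obtain ⟨δ, hδ, h1, h2⟩ := exists_pos_line (u := u) ht
  have h3 : t + δ ≤ s₂ := hmax (show t + δ ∈ A by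
    have := interior_subset h1; show -e + (t + δ) • u ∈ K; convert this using 1; module)
  have h4 : s₁ ≤ t + -δ := hmin (show t + -δ ∈ A by
    have := interior_subset h2; show -e + (t + -δ) • u ∈ K; convert this using 1; module)
  refine ⟨-e + ((s₁ + s₂) / 2) • u, (s₁ + s₂) / 2, (s₂ - s₁) / 2, hu, rfl, by linarith, ?_, ?_, ?_,
    t, ht⟩
  · have : -e + s₂ • u ∈ K := hs₂
    convert this using 1; module
  · have : -e + s₁ • u ∈ K := hs₁
    convert this using 1; module
  · intro s hs
    have h5 : (s₁ + s₂) / 2 + s ∈ A := by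
      show -e + ((s₁ + s₂) / 2 + s) • u ∈ K
      convert hs using 1; module
    have h6 : (s₁ + s₂) / 2 + s ≤ s₂ := hmax h5
    have h7 : s₁ ≤ (s₁ + s₂) / 2 + s := hmin h5
    rw [abs_le]; constructor <;> linarith

/-- Midpoints of the translates of the segment `[-w, w]` inside `K`. -/
def mids (K : Set V3) (w : V3) : Set V3 := {z | z + w ∈ K ∧ z - w ∈ K}

lemma mids_convex (hK : Convex ℝ K) (w : V3) : Convex ℝ (mids K w) := by
  have : mids K w = (fun z => z + w) ⁻¹' K ∩ (fun z => z + -w) ⁻¹' K := by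
    ext z; simp [mids, sub_eq_add_neg]
  rw [this]
  exact (hK.translate_preimage_left w).inter (hK.translate_preimage_left (-w))

lemma FC.shift (F : FC K e v) : IsCompact {x | x - e ∈ K} ∧ Convex ℝ {x | x - e ∈ K} ∧
    SectSym {x | x - e ∈ K} 0 := by
  set K' : Set V3 := {x | x - e ∈ K} with hK'
  have hK'c : IsCompact K' := by
    have : K' = (fun x => x + e) '' K := by
      ext x; simp [hK', sub_eq_add_neg]
    rw [this]; exact F.cpt.image (by fun_prop)
  have hK'v : Convex ℝ K' := by
    have := F.conv.translate_preimage_left (-e)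
    simpa [hK', sub_eq_add_neg, preimage] using this
  refine ⟨hK'c, hK'v, ?_⟩
  · intro g hg
    refine ⟨e - v g, fun x hx hgx => ?_⟩
    rw [dotProduct_zero] at hgx ⊢
    have hx' : x - e ∈ K := hx
    have h1 := F.symm _ (F.refl g hg _ hx' (by rw [dotProduct_sub, hgx]; ring))
    refine ⟨?_, ?_⟩
    · show (2 : ℝ) • (e - v g) - x - e ∈ K
      convert h1 using 1; module
    · simp only [dotProduct_sub, dotProduct_smul, smul_eq_mul, F.dot g hg, hgx]; ring

/-- Two homothetic fat faces in symmetric position. -/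
lemma FC.no_fat_faces (F : FC K e v) {f a η₁ η₂ : V3} {M κ : ℝ} (hM : M ≠ 0) (hκ0 : κ ≠ 0)
    (hκ1 : κ ≠ 1) (hκ : κ ^ 2 ≤ 1) (hf : ∀ y ∈ K, (f ⬝ᵥ y - M) * (f ⬝ᵥ y + M) ≤ 0)
    (ha : f ⬝ᵥ a = M) (ha' : f ⬝ᵥ (κ • (a + e) - e) = -M) (h₁ : f ⬝ᵥ η₁ = 0) (h₂ : f ⬝ᵥ η₂ = 0)
    (hind : η₁ ⨯₃ η₂ ≠ 0) (haK : a ∈ K) (ha₁ : a + η₁ ∈ K) (ha₂ : a + η₂ ∈ K)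
    (hbK : κ • (a + e) - e ∈ K) (hb₁ : κ • (a + e + η₁) - e ∈ K)
    (hb₂ : κ • (a + e + η₂) - e ∈ K) : False := by
  obtain ⟨hK'c, hK'v, hs⟩ := F.shift
  set K' : Set V3 := {x | x - e ∈ K} with hK'
  set α := f ⬝ᵥ (a + e) with hα
  have e1 : α = M + f ⬝ᵥ e := by rw [hα, dotProduct_add, ha]
  have e2 : κ * α = -M + f ⬝ᵥ e := by
    have := ha'
    rw [dotProduct_sub, dotProduct_smul, smul_eq_mul] at this
    linarith
  have hα0 : α ≠ 0 := by
    intro h; rw [h] at e1 e2; apply hM; linarith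
  have hf' : ∀ x ∈ K', (f ⬝ᵥ x - α) * (f ⬝ᵥ x - κ * α) ≤ 0 := by
    intro x hx
    have h1 := hf _ hx
    rw [dotProduct_sub] at h1
    rw [e2, e1]; convert h1 using 1; ring
  set E : Fin 3 → V3 := ![a + e, a + e + η₁, a + e + η₂] with hE
  have hEK : ∀ i, E i ∈ K' := by
    intro i
    fin_cases i
    · show a + e - e ∈ K; simpa using haK
    · show a + e + η₁ - e ∈ K; convert ha₁ using 1; abel
    · show a + e + η₂ - e ∈ K; convert ha₂ using 1; abel
  have hEf : ∀ i, f ⬝ᵥ E i = α := by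
    intro i; fin_cases i
    · rfl
    · show f ⬝ᵥ (a + e + η₁) = α; rw [dotProduct_add, h₁, add_zero]
    · show f ⬝ᵥ (a + e + η₂) = α; rw [dotProduct_add, h₂, add_zero]
  have hκE : ∀ i, κ • E i ∈ K' := by
    intro i; fin_cases i
    · exact hbK
    · exact hb₁
    · exact hb₂
  have hlift := lift_face hK'c hK'v hs hα0 hκ0 hf' hEK hEf hκE (by
    show (a + e + η₁ - (a + e)) ⨯₃ (a + e + η₂ - (a + e)) ≠ 0
    simpa using hind)
  set A := K' ∩ {x | f ⬝ᵥ x = α} with hA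
  have hAc : IsCompact A := hK'c.inter_right (isClosed_eq (by fun_prop) (by fun_prop))
  have hφ : ∀ x ∈ A, κ⁻¹ • ((2 : ℝ) • e - x) ∈ A := by
    rintro x ⟨hx, hfx⟩
    simp only [mem_ofPred_eq] at hfx
    have h1 := F.symm _ hx
    have h2 : (2 : ℝ) • e - x ∈ K' := by
      show (2 : ℝ) • e - x - e ∈ K
      convert h1 using 1; module
    have h3 : f ⬝ᵥ ((2 : ℝ) • e - x) = κ * α := by
      rw [dotProduct_sub, dotProduct_smul, smul_eq_mul, hfx]; linarith
    refine ⟨hlift _ h2 h3, ?_⟩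
    show f ⬝ᵥ (κ⁻¹ • ((2 : ℝ) • e - x)) = α
    rw [dotProduct_smul, h3, smul_eq_mul]; field_simp
  have h0A : a + e ∈ A := ⟨hEK 0, hEf 0⟩
  rcases hκ.lt_or_eq with h | h
  · have := no_expand hAc _ hφ (ρ := -κ⁻¹) (by
      rw [neg_sq, inv_pow]
      exact (one_lt_inv₀ (by positivity)).2 h) (fun y _ y' _ => by module) h0A
      (show a + e + η₁ ∈ A from ⟨hEK 1, hEf 1⟩)
    exact left_ne_of_cross hind (by simpa using this)
  · have hκm : κ = -1 := by
      have h : (κ - 1) * (κ + 1) = 0 := by linear_combination h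
      rcases mul_eq_zero.1 h with h | h
      · exact absurd (by linarith) hκ1
      · linarith
    have := no_translate hAc ⟨_, h0A⟩ (d := (-2 : ℝ) • e) (fun y hy => by
      convert hφ y hy using 1; rw [hκm]; ext i; simp; ring)
    exact F.ne (by simpa using this)

/-- A fat face opposite to `-e` when `-e` lies in a supporting plane. -/
lemma FC.no_fat_face (F : FC K e v) {f a η₁ η₂ : V3} {M : ℝ} (hM : M ≠ 0)
    (hf : ∀ y ∈ K, (f ⬝ᵥ y - M) * (f ⬝ᵥ y + M) ≤ 0)
    (ha : f ⬝ᵥ a = M) (he : f ⬝ᵥ e = M) (h₁ : f ⬝ᵥ η₁ = 0) (h₂ : f ⬝ᵥ η₂ = 0)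
    (hind : η₁ ⨯₃ η₂ ≠ 0) (haK : a ∈ K) (ha₁ : a + η₁ ∈ K) (ha₂ : a + η₂ ∈ K)
    (heK : -e ∈ K) : False := by
  obtain ⟨hK'c, hK'v, hs⟩ := F.shift
  set K' : Set V3 := {x | x - e ∈ K} with hK'
  refine FalseCentre.no_fat_face hK'c hK'v hs (f := f) (M := 2 * M)
    (e := ![a + e, a + e + η₁, a + e + η₂]) (by show 0 - e ∈ K; simpa using heK) (by simpa using hM)
    (fun x hx => ?_) (fun i => ?_) (fun i => ?_) ?_
  · have h1 := hf _ hx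
    rw [dotProduct_sub, he] at h1
    convert h1 using 1; ring
  · fin_cases i
    · show a + e - e ∈ K; simpa using haK
    · show a + e + η₁ - e ∈ K; convert ha₁ using 1; abel
    · show a + e + η₂ - e ∈ K; convert ha₂ using 1; abel
  · fin_cases i
    · show f ⬝ᵥ (a + e) = _; rw [dotProduct_add, ha, he]; ring
    · show f ⬝ᵥ (a + e + η₁) = _; rw [dotProduct_add, dotProduct_add, h₁, ha, he]; ring
    · show f ⬝ᵥ (a + e + η₂) = _; rw [dotProduct_add, dotProduct_add, h₂, ha, he]; ring
  · show (a + e + η₁ - (a + e)) ⨯₃ (a + e + η₂ - (a + e)) ≠ 0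
    simpa using hind

end

section

variable {K : Set V3} {e : V3} {v : V3 → V3}

lemma exists_orth_pair {f : V3} (hf : f ≠ 0) : ∃ η₁ η₂ : V3, f ⬝ᵥ η₁ = 0 ∧ f ⬝ᵥ η₂ = 0 ∧
    η₁ ⨯₃ η₂ ≠ 0 := by
  obtain ⟨k, hk, hkf⟩ := exists_orth hf
  refine ⟨k, k ⨯₃ f, by rw [dotProduct_comm]; exact hkf, dot_cross_self _ _, ?_⟩
  intro h
  have h1 := cross_smul_sub k f k
  rw [← cross_anticomm, h, neg_zero, dotProduct_comm f k, hkf, zero_smul, sub_zero] at h1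
  rcases smul_eq_zero.1 h1.symm with h2 | h2
  · exact (dot_self_pos hk).ne' h2
  · exact hf h2

namespace Chord

variable {u m : V3} {τ σ : ℝ}

lemma mem (C : Chord K e u m τ σ) : m ∈ mids K (σ • u) := ⟨C.left, C.right⟩

lemma mids_symm (F : FC K e v) {w z : V3} (hz : z ∈ mids K w) : -z ∈ mids K w := by
  refine ⟨?_, ?_⟩
  · convert F.symm _ hz.2 using 1; abel
  · convert F.symm _ hz.1 using 1; abel

lemma mids_refl (F : FC K e v) {g z u : V3} {σ : ℝ} (hg : g ≠ 0) (hgu : g ⬝ᵥ u = 0)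
    (hz : z ∈ mids K (σ • u)) (hgz : g ⬝ᵥ z = -(g ⬝ᵥ e)) :
    z + (2 : ℝ) • v g ∈ mids K (σ • u) := by
  refine ⟨?_, ?_⟩
  · convert F.refl g hg _ hz.1 (by simp [dotProduct_add, hgu, hgz]) using 1; abel
  · convert F.refl g hg _ hz.2 (by simp [dotProduct_sub, hgu, hgz]) using 1; abel

lemma only (C : Chord K e u m τ σ) {s : ℝ} (h : m + s • u ∈ mids K (σ • u)) : s = 0 := by
  have h1 := C.bdd (s + σ) (by convert h.1 using 1; module)
  have h2 := C.bdd (s - σ) (by convert h.2 using 1; module)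
  rw [abs_le] at h1 h2
  linarith

lemma dot_m (C : Chord K e u m τ σ) {g : V3} (hg : g ⬝ᵥ u = 0) : g ⬝ᵥ m = -(g ⬝ᵥ e) := by
  rw [C.line]; simp [dotProduct_add, hg]

lemma good (C : Chord K e u m τ σ) {g : V3} (hg : g ⬝ᵥ u = 0) : Good K e g := by
  obtain ⟨t, ht⟩ := C.meets
  exact Good.of_line ht hg

lemma not_flat (F : FC K e v) (C : Chord K e u m τ σ) (hpar : ∀ s : ℝ, e ≠ s • u) {k : V3}
    (hk : k ≠ 0) (hku : k ⬝ᵥ u = 0) (h : ∀ z ∈ mids K (σ • u), k ⬝ᵥ z = 0) : False := by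
  have h1 := pencil_sym F.conv F.cpt.isClosed F.int C.u_ne hk hku (p := -e) (m := m) (by
    intro g hg hgu hgk y hy hgy
    have hz := mids_symm F (mids_refl F hg hgu C.mem (C.dot_m hgu))
    have h2 : k ⬝ᵥ (-(m + (2 : ℝ) • v g) - m) = 0 := by
      rw [dotProduct_sub, h _ hz, h _ C.mem]; ring
    have h3 : g ⬝ᵥ (-(m + (2 : ℝ) • v g) - m) = 0 := by
      simp only [dotProduct_sub, dotProduct_neg, dotProduct_add, dotProduct_smul, smul_eq_mul,
        F.dot g hg, C.dot_m hgu]; ring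
    obtain ⟨a, ha⟩ := exists_smul_cross hgk h3 h2
    obtain ⟨b, hb⟩ := exists_smul_cross hgk hgu hku
    have hb0 : b ≠ 0 := by rintro rfl; exact C.u_ne (by simpa using hb)
    have h4 : -(m + (2 : ℝ) • v g) = m + (a * b⁻¹) • u := by
      rw [hb, smul_smul, mul_assoc, inv_mul_cancel₀ hb0, mul_one, ← ha]; abel
    have h5 := hz
    rw [h4] at h5
    rw [C.only h5, zero_smul, add_zero] at h4
    have h6 := F.symm _ (F.refl g hg y hy (by simpa using hgy))
    convert h6 using 1
    have : (2 : ℝ) • m = -((2 : ℝ) • v g) := by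
      calc (2 : ℝ) • m = m + m := two_smul _ _
        _ = -((2 : ℝ) • v g) := by nth_rewrite 1 [← h4]; abel
    rw [this]; abel)
  have h2 := no_translate F.cpt (F.int.mono interior_subset) (d := (2 : ℝ) • m) (fun y hy => by
    convert h1 _ (F.symm _ hy) using 1; abel)
  have h3 : m = 0 := by simpa using h2
  have h4 := C.line
  rw [h3] at h4
  exact hpar τ (by rw [eq_comm, neg_add_eq_zero] at h4; exact h4)

lemma support (F : FC K e v) (C : Chord K e u m τ σ) (hpar : ∀ s : ℝ, e ≠ s • u) :
    ∃ k : V3, k ≠ 0 ∧ k ⬝ᵥ u = 0 ∧ k ⬝ᵥ m < 0 ∧ ∀ z ∈ mids K (σ • u), k ⬝ᵥ m ≤ k ⬝ᵥ z := by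
  set D := mids K (σ • u) with hD
  have hDc : Convex ℝ D := mids_convex F.conv _
  set D' : Set V3 := {z | ∃ s : ℝ, z + s • u ∈ D} with hD'
  have hDD' : D ⊆ D' := fun z hz => ⟨0, by simpa using hz⟩
  have hD'c : Convex ℝ D' := by
    rintro x ⟨s, hs⟩ y ⟨t, ht⟩ a b ha hb hab
    refine ⟨a * s + b * t, ?_⟩
    convert hDc hs ht ha hb hab using 1; module
  have hmD : m ∈ D := C.mem
  have hneg : -m ∈ D := mids_symm F C.mem
  by_cases hmi : m ∈ interior D'
  · exfalso
    -- a chord through `m` longer than allowed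
    have hmax : ∀ t : ℝ, 1 < t → t • (σ • u) ∉ K := by
      intro t ht htK
      obtain ⟨ε, hε, h1, -⟩ := exists_pos_line (u := m) hmi
      obtain ⟨s, hs⟩ := interior_subset h1
      have htK' := F.symm _ htK
      have hε1 : (0 : ℝ) < 1 + ε := by linarith
      have hw : (1 + ε)⁻¹ + (1 + ε)⁻¹ * ε = 1 := by field_simp
      have h2 := F.conv hs.1 htK (a := (1 + ε)⁻¹) (b := (1 + ε)⁻¹ * ε) (by positivity)
        (by positivity) hw
      have h3 := F.conv hs.2 htK' (a := (1 + ε)⁻¹) (b := (1 + ε)⁻¹ * ε) (by positivity)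
        (by positivity) hw
      have h4 := C.bdd ((1 + ε)⁻¹ * (s + σ + ε * t * σ)) (by
        convert h2 using 1; ext i; simp; field_simp; ring)
      have h5 := C.bdd ((1 + ε)⁻¹ * (s - σ - ε * t * σ)) (by
        convert h3 using 1; ext i; simp; field_simp; ring)
      rw [abs_le] at h4 h5
      have h6 : (1 + ε)⁻¹ * (σ + ε * t * σ) ≤ σ := by nlinarith
      rw [inv_mul_le_iff₀ hε1] at h6
      have := C.pos
      have h7 : ε * σ < ε * σ * t := lt_mul_of_one_lt_right (by positivity) ht
      nlinarith
    have hwK : σ • u ∈ K := by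
      have := F.conv C.left (F.symm _ C.right) (a := 1 / 2) (b := 1 / 2) (by norm_num) (by norm_num)
        (by norm_num)
      convert this using 1; module
    have hwi : σ • u ∉ interior K := by
      intro h
      obtain ⟨ε, hε, h1, -⟩ := exists_pos_line (u := σ • u) h
      exact hmax (1 + ε) (by linarith) (by convert interior_subset h1 using 1; module)
    obtain ⟨f', hf'0, hf'⟩ := exists_supporting F.conv F.int hwi
    obtain ⟨f, hf0, hf⟩ : ∃ f : V3, f ≠ 0 ∧ ∀ y ∈ K, f ⬝ᵥ y ≤ f ⬝ᵥ (σ • u) :=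
      ⟨-f', neg_ne_zero.2 hf'0, fun y hy => by simpa using hf' y hy⟩
    set M := f ⬝ᵥ (σ • u) with hM
    have hf2 : ∀ y ∈ K, -M ≤ f ⬝ᵥ y := by
      intro y hy; have := hf _ (F.symm y hy); rw [dotProduct_neg] at this; linarith
    have hM0 : M ≠ 0 := by
      intro h
      exact hf0 (eq_zero_of_const F.int (r := 0) fun y hy => le_antisymm
        (by rw [← h]; exact hf y hy) (by have := hf2 y hy; linarith))
    have hfu : f ⬝ᵥ u ≠ 0 := by
      intro h; apply hM0; rw [hM, dotProduct_smul, h, smul_zero]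
    have hfD : ∀ z ∈ D, f ⬝ᵥ z = 0 := by
      intro z hz
      have h1 := hf _ hz.1
      have h2 := hf2 _ hz.2
      rw [dotProduct_add, ← hM] at h1
      rw [dotProduct_sub, ← hM] at h2
      linarith
    have hfb : ∀ y ∈ K, (f ⬝ᵥ y - M) * (f ⬝ᵥ y + M) ≤ 0 := fun y hy =>
      mul_nonpos_of_nonpos_of_nonneg (by linarith [hf y hy]) (by linarith [hf2 y hy])
    have hfb' : ∀ y ∈ K, (f ⬝ᵥ y - -M) * (f ⬝ᵥ y + -M) ≤ 0 := fun y hy => by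
      have := hfb y hy; nlinarith
    have hD'D : ∀ η : V3, f ⬝ᵥ η = 0 → m + η ∈ D' → m + η ∈ D := by
      rintro η hη ⟨s, hs⟩
      have h1 := hfD _ hs
      rw [dotProduct_add, dotProduct_add, hη, hfD m hmD, dotProduct_smul, smul_eq_mul] at h1
      have h2 : s = 0 := by
        rcases mul_eq_zero.1 (show s * f ⬝ᵥ u = 0 by linarith) with h | h
        · exact h
        · exact absurd h hfu
      simpa [h2] using hs
    obtain ⟨η₁, η₂, h₁, h₂, hind⟩ := exists_orth_pair hf0
    have hfat : ∀ κ : ℝ, ∃ t : ℝ, 0 < t ∧ m + t • η₁ ∈ D ∧ m + t • η₂ ∈ D ∧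
        m + κ • t • η₁ ∈ D ∧ m + κ • t • η₂ ∈ D := by
      intro κ
      have hev : ∀ η : V3, ∀ᶠ t in 𝓝[>] (0 : ℝ), m + t • η ∈ interior D' := fun η =>
        nhdsWithin_le_nhds (eventually_line hmi)
      obtain ⟨t, ⟨⟨⟨a1, a2⟩, a3⟩, a4⟩, ht⟩ := ((((hev η₁).and (hev η₂)).and (hev (κ • η₁))).and
        (hev (κ • η₂))).and self_mem_nhdsWithin |>.exists
      refine ⟨t, ht, hD'D _ (by simp [h₁]) (interior_subset a1),
        hD'D _ (by simp [h₂]) (interior_subset a2), ?_, ?_⟩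
      · rw [smul_comm]; exact hD'D _ (by simp [h₁]) (interior_subset a3)
      · rw [smul_comm]; exact hD'D _ (by simp [h₂]) (interior_subset a4)
    have hind' : ∀ t : ℝ, 0 < t → (t • η₁) ⨯₃ (t • η₂) ≠ 0 := by
      intro t ht
      simp only [map_smul, LinearMap.smul_apply]
      exact smul_ne_zero ht.ne' (smul_ne_zero ht.ne' hind)
    have hfm := hfD m hmD
    have ea : m + σ • u + e = (τ + σ) • u := by rw [C.line]; module
    have ea' : m - σ • u + e = (τ - σ) • u := by rw [C.line]; module
    have hfa : f ⬝ᵥ (m + σ • u) = M := by rw [dotProduct_add, hfm, ← hM]; ring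
    have hfa' : f ⬝ᵥ (m - σ • u) = -M := by rw [dotProduct_sub, hfm, ← hM]; ring
    by_cases hA : τ + σ = 0
    · obtain ⟨t, ht, b1, b2, -, -⟩ := hfat 1
      rw [hA, zero_smul] at ea
      have ea2 : m + σ • u = -e := eq_neg_of_add_eq_zero_left ea
      refine F.no_fat_face (a := m - σ • u) (neg_ne_zero.2 hM0) hfb' hfa' ?_ (η₁ := t • η₁)
        (η₂ := t • η₂) (by simp [h₁]) (by simp [h₂]) (hind' t ht) C.right ?_ ?_
        (by rw [← ea2]; exact C.left)
      · rw [ea2, dotProduct_neg] at hfa; linarith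
      · convert b1.2 using 1; abel
      · convert b2.2 using 1; abel
    by_cases hA' : τ - σ = 0
    · obtain ⟨t, ht, b1, b2, -, -⟩ := hfat 1
      rw [hA', zero_smul] at ea'
      have ea2 : m - σ • u = -e := eq_neg_of_add_eq_zero_left ea'
      refine F.no_fat_face (a := m + σ • u) hM0 hfb hfa ?_ (η₁ := t • η₁)
        (η₂ := t • η₂) (by simp [h₁]) (by simp [h₂]) (hind' t ht) C.left ?_ ?_
        (by rw [← ea2]; exact C.right)
      · rw [ea2, dotProduct_neg] at hfa'; linarith
      · convert b1.1 using 1; abel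
      · convert b2.1 using 1; abel
    have hσ := C.pos
    rcases le_total ((τ - σ) ^ 2) ((τ + σ) ^ 2) with hle | hle
    · set κ := (τ - σ) / (τ + σ) with hκ
      obtain ⟨t, ht, b1, b2, b3, b4⟩ := hfat κ
      have hb : κ • (m + σ • u + e) - e = m - σ • u := by
        rw [ea, smul_smul, hκ, div_mul_cancel₀ _ hA, ← ea']; abel
      have hbη : ∀ η : V3, κ • (m + σ • u + e + η) - e = m + κ • η - σ • u := by
        intro η; rw [smul_add, add_sub_right_comm, hb]; abel
      refine F.no_fat_faces (a := m + σ • u) (κ := κ) hM0 (div_ne_zero hA' hA) ?_ ?_ hfb hfa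
        (by rw [hb]; exact hfa') (η₁ := t • η₁) (η₂ := t • η₂) (by simp [h₁]) (by simp [h₂])
        (hind' t ht) C.left ?_ ?_ (by rw [hb]; exact C.right) ?_ ?_
      · rw [hκ, Ne, div_eq_one_iff_eq hA]; intro h; linarith
      · rw [hκ, div_pow]; exact div_le_one_of_le₀ hle (by positivity)
      · convert b1.1 using 1; abel
      · convert b2.1 using 1; abel
      · rw [hbη]; exact b3.2
      · rw [hbη]; exact b4.2
    · set κ := (τ + σ) / (τ - σ) with hκ
      obtain ⟨t, ht, b1, b2, b3, b4⟩ := hfat κ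
      have hb : κ • (m - σ • u + e) - e = m + σ • u := by
        rw [ea', smul_smul, hκ, div_mul_cancel₀ _ hA', ← ea]; abel
      have hbη : ∀ η : V3, κ • (m - σ • u + e + η) - e = m + κ • η + σ • u := by
        intro η; rw [smul_add, add_sub_right_comm, hb]; abel
      refine F.no_fat_faces (a := m - σ • u) (κ := κ) (neg_ne_zero.2 hM0) (div_ne_zero hA hA') ?_ ?_
        hfb' hfa' (by rw [hb, neg_neg]; exact hfa) (η₁ := t • η₁) (η₂ := t • η₂) (by simp [h₁])
        (by simp [h₂]) (hind' t ht) C.right ?_ ?_ (by rw [hb]; exact C.left) ?_ ?_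
      · rw [hκ, Ne, div_eq_one_iff_eq hA']; intro h; linarith
      · rw [hκ, div_pow]; exact div_le_one_of_le₀ hle (by positivity)
      · convert b1.2 using 1; abel
      · convert b2.2 using 1; abel
      · rw [hbη]; exact b3.1
      · rw [hbη]; exact b4.1
  · by_cases hne : (interior D').Nonempty
    · obtain ⟨k, hk, hkD⟩ := exists_supporting hD'c hne hmi
      have hku : k ⬝ᵥ u = 0 := by
        have h1 : ∀ s : ℝ, 0 ≤ s * k ⬝ᵥ u := by
          intro s
          have := hkD (m + s • u) ⟨-s, by simpa using hmD⟩
          rw [dotProduct_add, dotProduct_smul, smul_eq_mul] at this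
          linarith
        have h2 := h1 1
        have h3 := h1 (-1)
        linarith
      refine ⟨k, hk, hku, ?_, fun z hz => hkD z (hDD' hz)⟩
      have h1 := hkD _ (hDD' hneg)
      rw [dotProduct_neg] at h1
      refine lt_of_le_of_ne (by linarith) fun h0 => hk (eq_zero_of_const hne (r := 0) ?_)
      rintro y ⟨s, hs⟩
      have h2 := hkD _ (hDD' hs)
      have h3 := hkD _ (hDD' (mids_symm F hs))
      rw [dotProduct_neg] at h3
      rw [dotProduct_add, dotProduct_smul, hku, smul_zero] at h2 h3
      linarith
    · exfalso
      have h0D : (0 : V3) ∈ D := by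
        have := hDc hmD hneg (a := 1 / 2) (b := 1 / 2) (by norm_num) (by norm_num) (by norm_num)
        convert this using 1; module
      rw [hD'c.interior_nonempty_iff_affineSpan_eq_top] at hne
      have h0D' : (0 : V3) ∈ D' := hDD' h0D
      have hsp : Submodule.span ℝ D' ≠ ⊤ := by
        intro h
        apply hne
        rw [AffineSubspace.affineSpan_eq_top_iff_vectorSpan_eq_top_of_nonempty ℝ V3 V3 ⟨0, h0D'⟩,
          eq_top_iff, ← h, Submodule.span_le]
        intro z hz
        simpa using vsub_mem_vectorSpan ℝ hz h0D'
      obtain ⟨φ, hφ0, hφ⟩ := Submodule.exists_le_ker_of_lt_top _ (lt_top_iff_ne_top.2 hsp)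
      obtain ⟨k, hk, hkφ⟩ := dual_repr_ne (f := LinearMap.toContinuousLinearMap φ) (by
        simpa using hφ0)
      have hker : ∀ z ∈ D', k ⬝ᵥ z = 0 := by
        intro z hz
        have := hφ (Submodule.subset_span hz)
        rw [← hkφ]; simpa using this
      refine not_flat F C hpar hk ?_ fun z hz => hker z (hDD' hz)
      exact hker u ⟨-1, by simpa using h0D⟩

end Chord

end

section

variable {K : Set V3} {e : V3} {v : V3 → V3}

namespace Chord

variable {u m : V3} {τ σ : ℝ}

lemma neg_mids_refl (F : FC K e v) {g z u : V3} {σ : ℝ} (hg : g ≠ 0) (hgu : g ⬝ᵥ u = 0)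
    (hz : z ∈ mids K (σ • u)) (hgz : g ⬝ᵥ z = -(g ⬝ᵥ e)) :
    -z - (2 : ℝ) • v g ∈ mids K (σ • u) := by
  convert mids_symm F (mids_refl F hg hgu hz hgz) using 1; abel

lemma smul_mem (F : FC K e v) {w z : V3} (hz : z ∈ mids K w) {t : ℝ} (h0 : 0 ≤ t) (h1 : t ≤ 1) :
    t • z ∈ mids K w := by
  have := mids_convex F.conv w hz (mids_symm F hz) (a := (1 + t) / 2) (b := (1 - t) / 2)
    (by linarith) (by linarith) (by ring)
  convert this using 1; module

lemma dot_m_neg (F : FC K e v) (C : Chord K e u m τ σ) (hpar : ∀ s : ℝ, e ≠ s • u) {b : V3}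
    (hb0 : b ≠ 0) (hbu : b ⬝ᵥ u = 0) (hb : ∀ z ∈ mids K (σ • u), b ⬝ᵥ m ≤ b ⬝ᵥ z) :
    b ⬝ᵥ m < 0 := by
  have h1 := hb _ (mids_symm F C.mem)
  rw [dotProduct_neg] at h1
  refine lt_of_le_of_ne (by linarith) fun h => not_flat F C hpar hb0 hbu fun z hz => ?_
  have h2 := hb _ hz
  have h3 := hb _ (mids_symm F hz)
  rw [dotProduct_neg] at h3
  linarith

lemma exposed (F : FC K e v) (C : Chord K e u m τ σ) (hpar : ∀ s : ℝ, e ≠ s • u) {b z : V3}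
    (hb0 : b ≠ 0) (hbu : b ⬝ᵥ u = 0) (hb : ∀ z ∈ mids K (σ • u), b ⬝ᵥ m ≤ b ⬝ᵥ z)
    (hz : z ∈ mids K (σ • u)) (hbz : b ⬝ᵥ z = b ⬝ᵥ m) : z = m := by
  by_contra hzm
  have hq : u ⨯₃ (z - m) ≠ 0 := by
    intro h
    obtain ⟨s, hs⟩ := exists_smul_of_cross h C.u_ne
    have hs' : m + s • u = z := by rw [← hs]; abel
    have := C.only (hs' ▸ hz)
    apply hzm; rw [← hs', this]; simp
  set q := u ⨯₃ (z - m) with hqd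
  set a := u ⨯₃ q with ha
  have hau : a ⬝ᵥ u = 0 := cross_dot_self _ _
  have had : a ⬝ᵥ z - a ⬝ᵥ m = -(q ⬝ᵥ q) := by
    rw [← dotProduct_sub, ha]
    have : ∀ d : V3, (u ⨯₃ q) ⬝ᵥ d = -(q ⬝ᵥ (u ⨯₃ d)) := by
      intro d; simp [cross_apply, dotProduct, Fin.sum_univ_three]; ring
    rw [this, ← hqd]
  have hqq := dot_self_pos hq
  have hbm := C.dot_m_neg F hpar hb0 hbu hb
  have hgu : ∀ ε : ℝ, (b + ε • a) ⬝ᵥ u = 0 := by intro ε; simp [add_dotProduct, hbu, hau]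
  have hg0 : Tendsto (fun ε : ℝ => b + ε • a) (𝓝 0) (𝓝 b) := by
    have : ContinuousAt (fun ε : ℝ => b + ε • a) 0 := by fun_prop
    simpa [ContinuousAt] using this
  have hgne : ∀ᶠ ε : ℝ in 𝓝 0, b + ε • a ≠ 0 := hg0.eventually (isOpen_ne.mem_nhds hb0)
  have hv : Tendsto (fun ε : ℝ => v (b + ε • a)) (𝓝 0) (𝓝 (v b)) :=
    (F.continuousAt hb0 (C.good hbu)).tendsto.comp hg0
  have hdot : ∀ ε : ℝ, (b + ε • a) ⬝ᵥ m = -((b + ε • a) ⬝ᵥ e) := fun ε => C.dot_m (hgu ε)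
  have key : ∀ ε : ℝ, b + ε • a ≠ 0 → ∀ y ∈ mids K (σ • u),
      (b + ε • a) ⬝ᵥ y = (b + ε • a) ⬝ᵥ m →
      ε * (a ⬝ᵥ (-y - (2 : ℝ) • v (b + ε • a))) ≤ ε * (a ⬝ᵥ m) := by
    intro ε h0 y hy hym
    have h1 := hb _ (neg_mids_refl F h0 (hgu ε) hy (by rw [hym, hdot]))
    have h2 : (b + ε • a) ⬝ᵥ (-y - (2 : ℝ) • v (b + ε • a)) = (b + ε • a) ⬝ᵥ m := by
      rw [dotProduct_sub, dotProduct_neg, dotProduct_smul, F.dot _ h0, hym, hdot, smul_eq_mul]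
      ring
    rw [add_dotProduct, add_dotProduct, smul_dotProduct, smul_dotProduct, smul_eq_mul,
      smul_eq_mul] at h2
    linarith
  have hlim1 : a ⬝ᵥ m ≤ a ⬝ᵥ (-m - (2 : ℝ) • v b) := by
    have ht : Tendsto (fun ε : ℝ => a ⬝ᵥ (-m - (2 : ℝ) • v (b + ε • a))) (𝓝[<] 0)
        (𝓝 (a ⬝ᵥ (-m - (2 : ℝ) • v b))) := by
      have hc : Continuous fun w : V3 => a ⬝ᵥ (-m - (2 : ℝ) • w) := by fun_prop
      exact ((hc.tendsto _).comp hv).mono_left nhdsWithin_le_nhds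
    refine ge_of_tendsto ht ?_
    filter_upwards [hgne.filter_mono nhdsWithin_le_nhds, self_mem_nhdsWithin] with ε h1 h2
    have := key ε h1 m C.mem rfl
    exact (mul_le_mul_left_of_neg h2).1 this
  have hlim2 : a ⬝ᵥ (-z - (2 : ℝ) • v b) ≤ a ⬝ᵥ m := by
    have hden : Tendsto (fun ε : ℝ => b ⬝ᵥ m + ε * a ⬝ᵥ z) (𝓝 0) (𝓝 (b ⬝ᵥ m)) := by
      have : ContinuousAt (fun ε : ℝ => b ⬝ᵥ m + ε * a ⬝ᵥ z) 0 := by fun_prop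
      simpa [ContinuousAt] using this
    have hδ : Tendsto (fun ε : ℝ => ε * (-(q ⬝ᵥ q)) / (b ⬝ᵥ m + ε * a ⬝ᵥ z)) (𝓝 0) (𝓝 0) := by
      have h1 : Tendsto (fun ε : ℝ => ε * (-(q ⬝ᵥ q))) (𝓝 0) (𝓝 0) := by
        have : ContinuousAt (fun ε : ℝ => ε * (-(q ⬝ᵥ q))) 0 := by fun_prop
        simpa [ContinuousAt] using this
      have := h1.div hden hbm.ne
      rw [zero_div] at this
      exact this
    have ht : Tendsto (fun ε : ℝ => a ⬝ᵥ
        (-((1 - ε * (-(q ⬝ᵥ q)) / (b ⬝ᵥ m + ε * a ⬝ᵥ z)) • z) - (2 : ℝ) • v (b + ε • a))) (𝓝[>] 0)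
        (𝓝 (a ⬝ᵥ (-z - (2 : ℝ) • v b))) := by
      have hc : Continuous fun w : ℝ × V3 => a ⬝ᵥ (-((1 - w.1) • z) - (2 : ℝ) • w.2) := by fun_prop
      have := ((hc.tendsto (0, v b)).comp (hδ.prodMk_nhds hv)).mono_left
        (nhdsWithin_le_nhds (s := Ioi 0))
      simp only [sub_zero, one_smul] at this
      exact this
    refine le_of_tendsto ht ?_
    filter_upwards [hgne.filter_mono nhdsWithin_le_nhds, self_mem_nhdsWithin,
      (hden.eventually (gt_mem_nhds hbm)).filter_mono nhdsWithin_le_nhds,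
      (hδ.eventually (gt_mem_nhds one_pos)).filter_mono nhdsWithin_le_nhds] with ε h1 h2 h3 h4
    have h2' : 0 < ε := h2
    have h5 : 0 ≤ ε * (-(q ⬝ᵥ q)) / (b ⬝ᵥ m + ε * a ⬝ᵥ z) :=
      div_nonneg_of_nonpos (by nlinarith) h3.le
    have := key ε h1 _ (smul_mem F hz (t := 1 - ε * (-(q ⬝ᵥ q)) / (b ⬝ᵥ m + ε * a ⬝ᵥ z))
      (by linarith) (by linarith)) (by
        rw [dotProduct_smul, add_dotProduct, add_dotProduct, smul_dotProduct, smul_dotProduct, hbz,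
          smul_eq_mul, smul_eq_mul, smul_eq_mul]
        have := h3.ne
        rw [sub_mul, div_mul_cancel₀ _ this, ← had]; ring)
    exact (mul_le_mul_iff_right₀ h2').1 this
  rw [dotProduct_sub, dotProduct_neg] at hlim1 hlim2
  linarith

lemma extreme (F : FC K e v) (C : Chord K e u m τ σ) (hpar : ∀ s : ℝ, e ≠ s • u) {z₁ z₂ : V3}
    {l s : ℝ} (hl : 0 < l) (hl1 : l < 1) (h₁ : z₁ ∈ mids K (σ • u)) (h₂ : z₂ ∈ mids K (σ • u))
    (h : m = l • z₁ + (1 - l) • z₂ + s • u) : z₁ = m := by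
  obtain ⟨k, hk, hku, -, hkD⟩ := C.support F hpar
  refine C.exposed F hpar hk hku hkD h₁ ?_
  have e1 := congrArg (k ⬝ᵥ ·) h
  simp only [dotProduct_add, dotProduct_smul, smul_eq_mul, hku] at e1
  have e2 := hkD _ h₁
  have e3 := hkD _ h₂
  nlinarith

lemma conj_aux (F : FC K e v) (C : Chord K e u m τ σ) {a b : V3} (hau : a ⬝ᵥ u = 0)
    (hbu : b ⬝ᵥ u = 0) (hab : a ⨯₃ b ≠ 0) (hae : a ⬝ᵥ e = 1) (hbe : b ⬝ᵥ e = 1)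
    (hva : b ⬝ᵥ v a = 0) : a ⬝ᵥ v b = 0 ∧ v a + v b = -m := by
  have hpar : ∀ s : ℝ, e ≠ s • u := by
    intro s hs; rw [hs, dotProduct_smul, hau] at hae; simp at hae
  have ha := left_ne_of_cross hab
  have hb := right_ne_of_cross hab
  have huu : ∀ z : V3, a ⬝ᵥ z = 0 → b ⬝ᵥ z = 0 → ∃ t : ℝ, z = t • u := by
    intro z h1 h2
    obtain ⟨t, ht⟩ := exists_smul_cross hab h1 h2
    obtain ⟨t', ht'⟩ := exists_smul_cross hab hau hbu
    have : t' ≠ 0 := by rintro rfl; exact C.u_ne (by simpa using ht')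
    exact ⟨t / t', by rw [ht, ht', smul_smul, div_mul_cancel₀ _ this]⟩
  have hac : ∀ {z₁ z₂ : V3} {l : ℝ}, 0 < l → l < 1 → z₁ ∈ mids K (σ • u) → z₂ ∈ mids K (σ • u) →
      l * (a ⬝ᵥ z₁) + (1 - l) * (a ⬝ᵥ z₂) = -1 → l * (b ⬝ᵥ z₁) + (1 - l) * (b ⬝ᵥ z₂) = -1 →
      z₁ = m := by
    intro z₁ z₂ l hl hl1 h1 h2 ea eb
    have hma := C.dot_m hau
    have hmb := C.dot_m hbu
    obtain ⟨s, hs⟩ := huu (m - (l • z₁ + (1 - l) • z₂))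
      (by simp only [dotProduct_sub, dotProduct_add, dotProduct_smul, smul_eq_mul]; linarith)
      (by simp only [dotProduct_sub, dotProduct_add, dotProduct_smul, smul_eq_mul]; linarith)
    exact C.extreme F hpar hl hl1 h1 h2 (s := s) (by rw [← hs]; abel)
  have hma : a ⬝ᵥ m = -1 := by rw [C.dot_m hau, hae]
  have hmb : b ⬝ᵥ m = -1 := by rw [C.dot_m hbu, hbe]
  have hvaa : a ⬝ᵥ v a = 1 := by rw [F.dot a ha, hae]
  have hvbb : b ⬝ᵥ v b = 1 := by rw [F.dot b hb, hbe]
  set r := -m - (2 : ℝ) • v a with hr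
  have hrD : r ∈ mids K (σ • u) := neg_mids_refl F ha hau C.mem (C.dot_m hau)
  have hra : a ⬝ᵥ r = -1 := by
    rw [hr, dotProduct_sub, dotProduct_neg, dotProduct_smul, hma, hvaa]; norm_num
  have hrb : b ⬝ᵥ r = 1 := by
    rw [hr, dotProduct_sub, dotProduct_neg, dotProduct_smul, hmb, hva]; norm_num
  set x := a ⬝ᵥ v b with hx
  set p := -m - (2 : ℝ) • v b with hp
  have hpD : p ∈ mids K (σ • u) := neg_mids_refl F hb hbu C.mem (C.dot_m hbu)
  have hpa : a ⬝ᵥ p = 1 - 2 * x := by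
    rw [hp, dotProduct_sub, dotProduct_neg, dotProduct_smul, hma, ← hx, smul_eq_mul]; norm_num
  have hpb : b ⬝ᵥ p = -1 := by
    rw [hp, dotProduct_sub, dotProduct_neg, dotProduct_smul, hmb, hvbb, smul_eq_mul]; norm_num
  have hx0 : x = 0 := by
    rcases lt_trichotomy x 0 with hx0 | hx0 | hx0
    · exfalso
      have hd : ∃ d ∈ mids K (σ • u), 1 < b ⬝ᵥ d := by
        by_contra! hcon
        have := C.exposed F hpar hb hbu (fun z hz => ?_) (mids_symm F hrD)
          (by rw [dotProduct_neg, hrb, hmb])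
        · have h2 : a ⬝ᵥ (-r) = a ⬝ᵥ m := by rw [this]
          rw [dotProduct_neg, hra, hma] at h2; norm_num at h2
        · have := hcon _ (mids_symm F hz)
          rw [dotProduct_neg] at this; rw [hmb]; linarith
      obtain ⟨d, hdD, hbd⟩ := hd
      set α := a ⬝ᵥ d with hα
      have hA : Tendsto (fun t : ℝ => (-1 - t * α) / (1 - t)) (𝓝 0) (𝓝 (-1)) := by
        have h : ContinuousAt (fun t : ℝ => (-1 - t * α) / (1 - t)) 0 :=
          ContinuousAt.div (by fun_prop) (by fun_prop) (by norm_num)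
        simpa [ContinuousAt] using h
      obtain ⟨t, ht0, ht1, h1, h2⟩ : ∃ t : ℝ, 0 < t ∧ t < 1 ∧ 2 * x - 1 < (-1 - t * α) / (1 - t) ∧
          (-1 - t * α) / (1 - t) < 1 := by
        have e1 : ∀ᶠ t : ℝ in 𝓝[>] 0, 2 * x - 1 < (-1 - t * α) / (1 - t) ∧
          (-1 - t * α) / (1 - t) < 1 := ((hA.eventually (lt_mem_nhds (by linarith))).and
            (hA.eventually (gt_mem_nhds (by norm_num)))).filter_mono nhdsWithin_le_nhds
        have e2 : ∀ᶠ t : ℝ in 𝓝[>] 0, t < 1 :=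
          (gt_mem_nhds one_pos).filter_mono nhdsWithin_le_nhds
        obtain ⟨t, ⟨h1, h2⟩, h3, h4⟩ := (e1.and (e2.and self_mem_nhdsWithin)).exists
        exact ⟨t, h4, h3, h1, h2⟩
      set A := (-1 - t * α) / (1 - t) with hAdef
      have hA1 : (1 - t) * A = -1 - t * α := by
        rw [hAdef, mul_div_cancel₀ _ (by linarith)]
      set μ := (A - 2 * x + 1) / (2 - 2 * x) with hμ
      have hden : 0 < 2 - 2 * x := by linarith
      have hμe : μ * (2 - 2 * x) = A - 2 * x + 1 := div_mul_cancel₀ _ hden.ne'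
      have hμ0 : 0 ≤ μ := div_nonneg (by linarith) hden.le
      have hμ1 : μ ≤ 1 := by rw [hμ, div_le_one hden]; linarith
      have hDc := mids_convex F.conv (σ • u)
      have hz0 := hDc (hDc (mids_symm F C.mem) (mids_symm F hpD) hμ0 (sub_nonneg.2 hμ1) (by ring))
        hdD (sub_nonneg.2 ht1.le) ht0.le (by ring)
      set z₀ := (1 - t) • (μ • -m + (1 - μ) • -p) + t • d with hz₀
      have hz0a : a ⬝ᵥ z₀ = -1 := by
        rw [hz₀]
        simp only [dotProduct_add, dotProduct_smul, dotProduct_neg, hma, hpa, smul_eq_mul, ← hα]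
        linear_combination hA1 + (1 - t) * hμe
      have hz0b : b ⬝ᵥ z₀ = 1 + t * (b ⬝ᵥ d - 1) := by
        rw [hz₀]
        simp only [dotProduct_add, dotProduct_smul, dotProduct_neg, hmb, hpb, smul_eq_mul]
        ring
      have hz1 := neg_mids_refl F ha hau hz0 (by rw [hz0a, hae])
      set ε := t * (b ⬝ᵥ d - 1) with hε
      have hε0 : 0 < ε := mul_pos ht0 (by linarith)
      have hz1a : a ⬝ᵥ (-z₀ - (2 : ℝ) • v a) = -1 := by
        rw [dotProduct_sub, dotProduct_neg, dotProduct_smul, hz0a, hvaa, smul_eq_mul]; norm_num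
      have hz1b : b ⬝ᵥ (-z₀ - (2 : ℝ) • v a) = -(1 + ε) := by
        rw [dotProduct_sub, dotProduct_neg, dotProduct_smul, hz0b, hva]; simp
      have := hac (l := 2 / (2 + ε)) (by positivity) (by rw [div_lt_one (by positivity)]; linarith)
        hz1 hrD (by rw [hz1a, hra]; ring) (by rw [hz1b, hrb]; field_simp; ring)
      rw [this, hmb] at hz1b
      linarith
    · exact hx0
    · exfalso
      have hq : -(-r) - (2 : ℝ) • v b ∈ mids K (σ • u) := neg_mids_refl F hb hbu (mids_symm F hrD)
        (by rw [dotProduct_neg, hrb, hbe])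
      have hqa : a ⬝ᵥ (-(-r) - (2 : ℝ) • v b) = -1 - 2 * x := by
        rw [neg_neg, dotProduct_sub, dotProduct_smul, hra, ← hx, smul_eq_mul]
      have hqb : b ⬝ᵥ (-(-r) - (2 : ℝ) • v b) = -1 := by
        rw [neg_neg, dotProduct_sub, dotProduct_smul, hrb, hvbb, smul_eq_mul]; norm_num
      have := hac (l := 1 / (1 + x)) (by positivity) (by rw [div_lt_one (by positivity)]; linarith)
        hq (mids_symm F hrD) (by rw [hqa, dotProduct_neg, hra]; field_simp; ring)
        (by rw [hqb, dotProduct_neg, hrb]; ring)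
      rw [this, hma] at hqa
      linarith
  refine ⟨hx0, ?_⟩
  obtain ⟨s, hs⟩ := huu (-p - r)
    (by rw [dotProduct_sub, dotProduct_neg, hpa, hra, hx0]; norm_num)
    (by rw [dotProduct_sub, dotProduct_neg, hpb, hrb]; norm_num)
  have h1 := neg_mids_refl F ha hau (mids_symm F hpD) (by
    rw [dotProduct_neg, hpa, hae, hx0]; norm_num)
  have h2 : -(-p) - (2 : ℝ) • v a = m + (-s) • u := by
    have : -p = r + s • u := by rw [← hs]; abel
    rw [this, hr]; module
  rw [h2] at h1
  have h3 := C.only h1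
  have h4 : s = 0 := by linarith
  rw [h4, zero_smul, hp, hr] at hs
  have h5 : (2 : ℝ) • (v a + v b + m) = 0 := by rw [← hs]; module
  exact eq_neg_of_add_eq_zero_left ((smul_eq_zero.1 h5).resolve_left two_ne_zero)

lemma conj (F : FC K e v) (C : Chord K e u m τ σ) {a b : V3} (hau : a ⬝ᵥ u = 0)
    (hbu : b ⬝ᵥ u = 0) (hab : a ⨯₃ b ≠ 0) (hae : a ⬝ᵥ e ≠ 0) (hbe : b ⬝ᵥ e ≠ 0)
    (hva : b ⬝ᵥ v a = 0) : a ⬝ᵥ v b = 0 ∧ v a + v b = -m := by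
  have ha := left_ne_of_cross hab
  have hb := right_ne_of_cross hab
  have e1 := F.smul_eq ha (C.good hau) (inv_ne_zero hae)
  have e2 := F.smul_eq hb (C.good hbu) (inv_ne_zero hbe)
  have := C.conj_aux F (a := (a ⬝ᵥ e)⁻¹ • a) (b := (b ⬝ᵥ e)⁻¹ • b) (by simp [hau]) (by simp [hbu])
    (by simpa [hae, hbe] using hab) (by simp [hae]) (by simp [hbe]) (by rw [e1]; simp [hva])
  rw [e1, e2] at this
  refine ⟨?_, this.2⟩
  simpa [hae] using this.1

end Chord

/-- The conjugacy relation for the centres of sections is symmetric. -/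
lemma FC.conj (F : FC K e v) {a b : V3} {t : ℝ} (ht : -e + t • (a ⨯₃ b) ∈ interior K)
    (hab : a ⨯₃ b ≠ 0) (hae : a ⬝ᵥ e ≠ 0) (hbe : b ⬝ᵥ e ≠ 0) (hva : b ⬝ᵥ v a = 0) :
    a ⬝ᵥ v b = 0 := by
  obtain ⟨m, τ, σ, C⟩ := exists_chord F.cpt hab ht
  exact (C.conj F (dot_self_cross _ _) (dot_cross_self _ _) hab hae hbe hva).1

end

section

variable {K : Set V3} {e : V3} {v : V3 → V3}

/-- Two planes through `-e` meeting in a line that meets the interior of `K`. -/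
def Pair (K : Set V3) (e a b : V3) : Prop :=
  a ⨯₃ b ≠ 0 ∧ a ⬝ᵥ e ≠ 0 ∧ b ⬝ᵥ e ≠ 0 ∧ ∃ t : ℝ, -e + t • (a ⨯₃ b) ∈ interior K

lemma Pair.symm {a b : V3} (h : Pair K e a b) : Pair K e b a := by
  obtain ⟨h1, h2, h3, t, ht⟩ := h
  refine ⟨cross_swap_ne h1, h3, h2, -t, ?_⟩
  rwa [← cross_anticomm, smul_neg, neg_smul, neg_neg]

lemma Pair.conj {a b : V3} (h : Pair K e a b) (F : FC K e v) (hva : b ⬝ᵥ v a = 0) :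
    a ⬝ᵥ v b = 0 := by
  obtain ⟨h1, h2, h3, t, ht⟩ := h
  exact F.conj ht h1 h2 h3 hva

lemma Pair.good_left {a b : V3} (h : Pair K e a b) : Good K e a := by
  obtain ⟨h1, h2, h3, t, ht⟩ := h
  exact Good.of_line ht (dot_self_cross _ _)

lemma Pair.ne_left {a b : V3} (h : Pair K e a b) : a ≠ 0 := left_ne_of_cross h.1

lemma isOpen_pair : IsOpen {q : V3 × V3 | Pair K e q.1 q.2} := by
  have : {q : V3 × V3 | Pair K e q.1 q.2} = ⋃ t : ℝ, ({q : V3 × V3 | q.1 ⨯₃ q.2 ≠ 0} ∩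
      ({q : V3 × V3 | q.1 ⬝ᵥ e ≠ 0} ∩ ({q : V3 × V3 | q.2 ⬝ᵥ e ≠ 0} ∩
      (fun q : V3 × V3 => -e + t • (q.1 ⨯₃ q.2)) ⁻¹' interior K))) := by
    ext q; simp [Pair, exists_and_left]
  rw [this]
  refine isOpen_iUnion fun t => ?_
  refine (isOpen_ne_fun (by fun_prop) (by fun_prop)).inter
    ((isOpen_ne_fun (by fun_prop) (by fun_prop)).inter
    ((isOpen_ne_fun (by fun_prop) (by fun_prop)).inter (isOpen_interior.preimage (by fun_prop))))

lemma triple_rot (a b c : V3) : (a ⨯₃ b) ⬝ᵥ c = (b ⨯₃ c) ⬝ᵥ a := by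
  simp [cross_apply, dotProduct, Fin.sum_univ_three]; ring

lemma pair_of_dir (F : FC K e v) {b d : V3} (hbe : b ⬝ᵥ e ≠ 0) (hd : d ⬝ᵥ b = 0)
    (hde : d ⨯₃ (e - v b) ≠ 0) {t : ℝ} (ht : -e + t • d ∈ interior K) :
    Pair K e b (d ⨯₃ v b) := by
  have hb : b ≠ 0 := by rintro rfl; simp at hbe
  have hbv : v b ⬝ᵥ b ≠ 0 := by rw [dotProduct_comm, F.dot b hb]; exact hbe
  have h1 : (d ⨯₃ v b) ⨯₃ b = -(v b ⬝ᵥ b) • d := by rw [cross_smul_sub, hd]; simp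
  have hd0 := left_ne_of_cross hde
  refine Pair.symm ⟨?_, ?_, hbe, -(t / (v b ⬝ᵥ b)), ?_⟩
  · rw [h1]; exact smul_ne_zero (neg_ne_zero.2 hbv) hd0
  · intro h
    obtain ⟨c, hc⟩ := exists_smul_of_cross (a := b) (b := d ⨯₃ (e - v b)) (by
      rw [← cross_anticomm, cross_smul_sub, hd, sub_dotProduct, dotProduct_comm e,
        dotProduct_comm (v b) b, F.dot b hb]; simp) hb
    have h2 : (d ⨯₃ (e - v b)) ⬝ᵥ v b = 0 := by
      have : (d ⨯₃ (e - v b)) ⬝ᵥ v b = -((d ⨯₃ v b) ⬝ᵥ e) := by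
        simp [cross_apply, dotProduct, Fin.sum_univ_three]; ring
      rw [this, h, neg_zero]
    rw [hc, smul_dotProduct, smul_eq_mul, dotProduct_comm b] at h2
    rcases mul_eq_zero.1 h2 with h3 | h3
    · rw [h3, zero_smul] at hc; exact hde hc
    · exact hbv h3
  · rw [h1, smul_smul]
    have : -(t / (v b ⬝ᵥ b)) * -(v b ⬝ᵥ b) = t := by field_simp
    rwa [this]

lemma line_dense (hconv : Convex ℝ K) (hcl : IsClosed K) {q k : V3} (hq : q ∈ interior K)
    {α c : ℝ} (h : ∀ s : ℝ, s ≠ 0 → q + s • k ∈ interior K → q + (α * s + c) • k ∈ K) :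
    ∀ s : ℝ, q + s • k ∈ K → q + (α * s + c) • k ∈ K := by
  have hP : IsClosed {s : ℝ | q + (α * s + c) • k ∈ K} := hcl.preimage (by fun_prop)
  have hB : IsOpen {s : ℝ | q + s • k ∈ interior K} := isOpen_interior.preimage (by fun_prop)
  have h1 : {s : ℝ | q + s • k ∈ interior K} ⊆ {s : ℝ | q + (α * s + c) • k ∈ K} := by
    refine ((dense_compl_singleton (0 : ℝ)).open_subset_closure_inter hB).trans
      (closure_minimal ?_ hP)
    rintro s ⟨h1, h2⟩
    exact h s h2 h1
  intro s hs
  have ht : Tendsto (fun t : ℝ => t * s) (𝓝[<] 1) (𝓝 s) := by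
    have : ContinuousAt (fun t : ℝ => t * s) 1 := by fun_prop
    have h2 : Tendsto (fun t : ℝ => t * s) (𝓝 1) (𝓝 s) := by simpa [ContinuousAt] using this
    exact h2.mono_left nhdsWithin_le_nhds
  have hev : ∀ᶠ t : ℝ in 𝓝[<] 1, 0 < t := (lt_mem_nhds one_pos).filter_mono nhdsWithin_le_nhds
  refine hP.mem_of_tendsto ht ?_
  filter_upwards [hev, self_mem_nhdsWithin] with t h2 h3
  have h3' : t < 1 := h3
  refine h1 ?_
  have := hconv.combo_interior_self_mem_interior hq hs (sub_pos.2 h3') h2.le (by ring)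
  show q + (t * s) • k ∈ interior K
  convert this using 1; module

lemma line_compact (hK : IsCompact K) {k : V3} (hk : k ≠ 0) (q : V3) :
    IsCompact {s : ℝ | q + s • k ∈ K} := by
  obtain ⟨C, hC⟩ := exists_dot_bound hK k
  have hkk := dot_self_pos hk
  refine Metric.isCompact_of_isClosed_isBounded (hK.isClosed.preimage (by fun_prop))
    ((Metric.isBounded_Icc (-((C + |k ⬝ᵥ q|) / k ⬝ᵥ k)) ((C + |k ⬝ᵥ q|) / k ⬝ᵥ k)).subset ?_)
  intro s hs
  have h1 := hC _ hs
  rw [dotProduct_add, dotProduct_smul, smul_eq_mul] at h1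
  have h3 : |s| * k ⬝ᵥ k = |s * k ⬝ᵥ k| := by rw [abs_mul, abs_of_pos hkk]
  rw [mem_Icc, ← abs_le, le_div_iff₀ hkk, h3]
  have h2 := abs_sub_abs_le_abs_sub (s * k ⬝ᵥ k) (-(k ⬝ᵥ q))
  rw [abs_neg, sub_neg_eq_add, add_comm (s * _)] at h2
  linarith

lemma line_false_translate (hK : IsCompact K) (hconv : Convex ℝ K) {q k : V3}
    (hq : q ∈ interior K) (hk : k ≠ 0) {c : ℝ} (hc : c ≠ 0)
    (h : ∀ s : ℝ, s ≠ 0 → q + s • k ∈ interior K → q + (s + c) • k ∈ K) : False := by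
  have h1 := line_dense (α := 1) hconv hK.isClosed hq (by simpa using h)
  obtain ⟨s, hs, hmax⟩ := (line_compact hK hk q).exists_isMaxOn (f := fun s => c * s)
    ⟨0, by simpa using interior_subset hq⟩ (by fun_prop)
  have h2 : c * (1 * s + c) ≤ c * s := hmax (h1 s hs)
  have : 0 < c * c := mul_self_pos.2 hc
  linarith

lemma line_false_expand (hK : IsCompact K) (hconv : Convex ℝ K) {q k : V3}
    (hq : q ∈ interior K) (hk : k ≠ 0) {α : ℝ} (hα : 1 < α ^ 2)
    (h : ∀ s : ℝ, s ≠ 0 → q + s • k ∈ interior K → q + (α * s) • k ∈ K) : False := by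
  have h1 := line_dense (c := 0) hconv hK.isClosed hq (by simpa using h)
  obtain ⟨s, hs, hmax⟩ := (line_compact hK hk q).exists_isMaxOn (f := fun s => s ^ 2)
    ⟨0, by simpa using interior_subset hq⟩ (by fun_prop)
  obtain ⟨r, hr, hr1, -⟩ := exists_pos_line (u := k) hq
  have h2 : (α * s + 0) ^ 2 ≤ s ^ 2 := hmax (h1 s hs)
  have h3 : r ^ 2 ≤ s ^ 2 := hmax (show q + r • k ∈ K from interior_subset hr1)
  have : 0 < r ^ 2 := by positivity
  nlinarith

/-- The centres of the sections conjugate to a given one are not collinear. -/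
lemma FC.indep (F : FC K e v) {b d₁ d₂ : V3} (hgood : Good K e b) (hbe : b ⬝ᵥ e ≠ 0)
    (hv : v b ≠ e) (h₁ : d₁ ⬝ᵥ b = 0) (h₂ : d₂ ⬝ᵥ b = 0) (h₁₂ : d₁ ⨯₃ d₂ ≠ 0)
    (hε₁ : d₁ ⨯₃ (e - v b) ≠ 0) (hε₂ : d₂ ⨯₃ (e - v b) ≠ 0) {t₁ t₂ : ℝ}
    (ht₁ : -e + t₁ • d₁ ∈ interior K) (ht₂ : -e + t₂ • d₂ ∈ interior K) :
    v (d₁ ⨯₃ v b) ⨯₃ v (d₂ ⨯₃ v b) ≠ 0 := by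
  intro hn
  have hb : b ≠ 0 := by rintro rfl; simp at hbe
  set w := v b with hw
  have hbw : b ⬝ᵥ w = b ⬝ᵥ e := F.dot b hb
  have hbw0 : b ⬝ᵥ w ≠ 0 := by rw [hbw]; exact hbe
  have hP₁ := pair_of_dir F hbe h₁ hε₁ ht₁
  have hP₂ := pair_of_dir F hbe h₂ hε₂ ht₂
  rw [← hw] at hP₁ hP₂
  have haw : ∀ d : V3, (d ⨯₃ w) ⬝ᵥ w = 0 := fun d => cross_dot_right _ _
  set k := v (d₁ ⨯₃ w) with hk
  have hk0 : k ≠ 0 := by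
    intro h
    have := F.dot _ hP₁.symm.ne_left
    rw [← hk, h] at this
    exact hP₁.2.2.1 (by simpa using this.symm)
  have hbk : b ⬝ᵥ k = 0 := hP₁.conj F (haw _)
  obtain ⟨s₂, hs₂⟩ := exists_smul_of_cross hn hk0
  have hkw : k ⨯₃ w ≠ 0 := by
    intro h
    obtain ⟨t, ht⟩ := exists_smul_of_cross h hk0
    rw [ht, dotProduct_smul, hbk] at hbw0; simp at hbw0
  set β := k ⨯₃ w with hβ
  have hβk : β ⬝ᵥ k = 0 := cross_dot_self _ _
  have hβw : β ⬝ᵥ w = 0 := cross_dot_right _ _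
  have hbβ : b ⨯₃ β ≠ 0 := by
    intro h
    obtain ⟨t, ht⟩ := exists_smul_of_cross h hb
    rw [ht, smul_dotProduct, smul_eq_mul] at hβw
    rcases mul_eq_zero.1 hβw with h | h
    · rw [h, zero_smul] at ht; exact hkw ht
    · exact hbw0 h
  have hbs : Tendsto (fun s : ℝ => b + s • β) (𝓝 0) (𝓝 b) := by
    have : ContinuousAt (fun s : ℝ => b + s • β) 0 := by fun_prop
    simpa [ContinuousAt] using this
  have hpair : ∀ {a : V3}, Pair K e b a → ∀ᶠ s : ℝ in 𝓝 0, Pair K e (b + s • β) a := by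
    intro a ha
    have : Tendsto (fun s : ℝ => (b + s • β, a)) (𝓝 0) (𝓝 (b, a)) :=
      hbs.prodMk_nhds tendsto_const_nhds
    exact this.eventually (isOpen_pair.mem_nhds ha)
  have hbsk : ∀ s t : ℝ, (b + s • β) ⬝ᵥ (t • k) = 0 := by
    intro s t; simp [add_dotProduct, hbk, hβk]
  have haa : (d₁ ⨯₃ w) ⨯₃ (d₂ ⨯₃ w) = (d₁ ⬝ᵥ (d₂ ⨯₃ w)) • w := by
    rw [cross_smul_sub, dot_cross_self]; simp
  have haa0 : (d₁ ⨯₃ w) ⨯₃ (d₂ ⨯₃ w) ≠ 0 := by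
    rw [haa]
    refine smul_ne_zero (fun h => ?_) (by rintro h; rw [h] at hbw0; simp at hbw0)
    obtain ⟨t, ht⟩ := exists_smul_cross h₁₂ h₁ h₂
    rw [ht, smul_dotProduct, triple_rot, triple_rot, ← triple_rot, dotProduct_comm, h] at hbw0
    simp at hbw0
  have hvs : ∀ᶠ s : ℝ in 𝓝 0, ∃ t : ℝ, v (b + s • β) = t • w := by
    filter_upwards [hpair hP₁, hpair hP₂] with s hs1 hs2
    have e1 := hs1.symm.conj F (by rw [← hk]; simpa using hbsk s 1)
    have e2 := hs2.symm.conj F (by rw [hs₂]; exact hbsk s _)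
    obtain ⟨t, ht⟩ := exists_smul_cross haa0 e1 e2
    rw [haa, smul_smul] at ht
    exact ⟨_, ht⟩
  have hdir : ∀ {d : V3} {t : ℝ}, d ⬝ᵥ b = 0 → d ⨯₃ (e - w) ≠ 0 → -e + t • d ∈ interior K →
      ∃ ν : ℝ, v (d ⨯₃ w) = ν • k := by
    intro d t hd hde ht
    have hP := pair_of_dir F hbe hd hde ht
    rw [← hw] at hP
    have hev : ∀ᶠ s : ℝ in 𝓝[≠] 0, (∃ t : ℝ, v (b + s • β) = t • w) ∧
      Pair K e (b + s • β) (d ⨯₃ w) := (hvs.and (hpair hP)).filter_mono nhdsWithin_le_nhds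
    obtain ⟨s, ⟨⟨t', ht'⟩, hPs⟩, hs⟩ := (hev.and self_mem_nhdsWithin).exists
    have e1 := hPs.conj F (by rw [ht', dotProduct_smul, haw, smul_zero])
    have e2 : b ⬝ᵥ v (d ⨯₃ w) = 0 := hP.conj F (haw _)
    rw [add_dotProduct, e2, zero_add, smul_dotProduct, smul_eq_mul] at e1
    have e3 := (mul_eq_zero.1 e1).resolve_left hs
    obtain ⟨x, hx⟩ := exists_smul_cross hbβ e2 e3
    obtain ⟨y, hy⟩ := exists_smul_cross hbβ hbk hβk
    have hy0 : y ≠ 0 := by rintro rfl; exact hk0 (by simpa using hy)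
    exact ⟨x / y, by rw [hx, hy, smul_smul, div_mul_cancel₀ _ hy0]⟩
  have hstep : ∀ y ∈ interior K, b ⬝ᵥ y = -(b ⬝ᵥ e) → (y + e) ⨯₃ (e - w) ≠ 0 →
      ∃ ν τ : ℝ, y + (2 * ν) • k ∈ K ∧ (e - w) - ν • k = τ • (y + e) := by
    intro y hy hby hye
    have hd : (y + e) ⬝ᵥ b = 0 := by rw [dotProduct_comm, dotProduct_add, hby]; ring
    have ht : -e + (1 : ℝ) • (y + e) ∈ interior K := by convert hy using 1; module
    obtain ⟨ν, hν⟩ := hdir hd hye ht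
    obtain ⟨m, τ, σ, C⟩ := exists_chord F.cpt (left_ne_of_cross hye) ht
    have hP := pair_of_dir F hbe hd hye ht
    rw [← hw] at hP
    have h1 := (C.conj F (by rw [dotProduct_comm]; exact hd) (cross_dot_self _ _) hP.1 hP.2.1
      hP.2.2.1 (haw _)).2
    rw [hν, ← hw] at h1
    have hm : m = -w - ν • k := by rw [← neg_neg m, ← h1]; abel
    refine ⟨ν, τ, ?_, ?_⟩
    · have h2 : y = m + (1 - τ) • (y + e) := by rw [C.line]; module
      have h3 := C.bdd (1 - τ) (by rw [← h2]; exact interior_subset hy)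
      rw [abs_le] at h3
      have h4 : m - (1 - τ) • (y + e) ∈ K := by
        have hσ := C.pos
        have := F.conv C.left C.right (a := (σ - (1 - τ)) / (2 * σ)) (b := (σ + (1 - τ)) / (2 * σ))
          (div_nonneg (by linarith) (by linarith)) (div_nonneg (by linarith) (by linarith))
          (by field_simp; ring)
        convert this using 1
        ext i
        simp only [Pi.sub_apply, Pi.add_apply, Pi.smul_apply, smul_eq_mul]
        field_simp; ring
      have hbd : b ⬝ᵥ (y + e) = 0 := by rw [dotProduct_comm]; exact hd
      have h5 := F.symm _ (F.refl b hb _ h4 (by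
        rw [dotProduct_sub, dotProduct_smul, C.dot_m hbd, hbd]; simp))
      rw [← hw] at h5
      convert h5 using 1
      have h6 : (1 - τ) • (y + e) = y - m := by
        rw [eq_sub_iff_add_eq, add_comm]; exact h2.symm
      rw [h6, hm]; module
    · have := C.line
      rw [hm] at this
      have h2 : τ • (y + e) = -w - ν • k + e := by rw [this]; abel
      rw [h2]; abel
  have hbε : b ⬝ᵥ (e - w) = 0 := by rw [dotProduct_sub, hbw]; ring
  have hε0 : e - w ≠ 0 := sub_ne_zero.2 (Ne.symm hv)
  have hwint : -w ∈ interior K := F.v_int hb hgood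
  by_cases hkε : k ⨯₃ (e - w) = 0
  · obtain ⟨c, hc⟩ := exists_smul_of_cross hkε hk0
    have hc0 : c ≠ 0 := by rintro rfl; exact hε0 (by simpa using hc)
    obtain ⟨x, hx, hxK, -⟩ := exists_pos_line (u := d₁) hwint
    refine line_false_translate F.cpt F.conv hxK hk0 (c := 2 * c) (by simpa using hc0) ?_
    intro s _ hs
    have e1 : (-w + x • d₁ + s • k + e) = (e - w) + x • d₁ + s • k := by abel
    have hne : (-w + x • d₁ + s • k + e) ⨯₃ (e - w) ≠ 0 := by
      rw [e1]
      simp only [map_add, map_smul, LinearMap.add_apply, LinearMap.smul_apply]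
      rw [cross_self, hkε, smul_zero, add_zero, zero_add]
      exact smul_ne_zero hx.ne' hε₁
    have hb1 : b ⬝ᵥ d₁ = 0 := by rw [dotProduct_comm]; exact h₁
    obtain ⟨ν, τ, h3, h4⟩ := hstep _ hs (by
      simp [dotProduct_add, hbw, hb1, hbk]) hne
    have hτ : τ = 0 := by
      have h5 : (e - w - ν • k) ⨯₃ (e - w) = 0 := by
        rw [map_sub crossProduct (e - w) (ν • k), LinearMap.sub_apply, map_smul,
          LinearMap.smul_apply, hkε, cross_self, smul_zero, sub_zero]
      rw [h4, map_smul, LinearMap.smul_apply] at h5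
      exact (smul_eq_zero.1 h5).resolve_right hne
    rw [hτ, zero_smul, hc, ← sub_smul] at h4
    have h5 : c = ν := by
      have := (smul_eq_zero.1 h4).resolve_right hk0; linarith
    rw [← h5] at h3
    convert h3 using 1; module
  · obtain ⟨δ, hδ, hδ1, hδK⟩ : ∃ δ : ℝ, 0 < δ ∧ δ < 1 ∧ -w + (-δ) • (e - w) ∈ interior K := by
      obtain ⟨δ, h1, -, h3⟩ := exists_pos_line (u := e - w) hwint
      refine ⟨min δ (1 / 2), by positivity, by
        have := min_le_right δ (1 / 2); linarith, ?_⟩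
      have hl : 0 ≤ min δ (1 / 2) / δ := by positivity
      have hl1 : min δ (1 / 2) / δ ≤ 1 := div_le_one_of_le₀ (min_le_left _ _) h1.le
      have := F.conv.interior hwint h3 (sub_nonneg.2 hl1) hl (by ring)
      convert this using 1
      rw [smul_add, ← add_assoc, ← add_smul, sub_add_cancel, one_smul, smul_smul]
      congr 2; field_simp
    have hη : 0 < 1 - δ := by linarith
    refine line_false_expand F.cpt F.conv hδK hk0 (α := 1 - 2 / (1 - δ)) ?_ ?_
    · have : 2 < 2 / (1 - δ) := by rw [lt_div_iff₀ hη]; linarith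
      nlinarith
    intro s hs0 hs
    have e1 : (-w + (-δ) • (e - w) + s • k + e) = (1 - δ) • (e - w) + s • k := by module
    have hne : (-w + (-δ) • (e - w) + s • k + e) ⨯₃ (e - w) ≠ 0 := by
      rw [e1]
      simp only [map_add, map_smul, LinearMap.add_apply, LinearMap.smul_apply]
      rw [cross_self, smul_zero, zero_add]
      exact smul_ne_zero hs0 hkε
    obtain ⟨ν, τ, h3, h4⟩ := hstep _ hs (by
      rw [dotProduct_add, dotProduct_add, dotProduct_smul, dotProduct_smul, hbε, hbk,
          dotProduct_neg,
        hbw]; simp) hne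
    rw [e1] at h4
    have h5 : (1 - τ * (1 - δ)) • (e - w) = (ν + τ * s) • k := by
      have : (1 - τ * (1 - δ)) • (e - w) - (ν + τ * s) • k =
        ((e - w) - ν • k) - τ • ((1 - δ) • (e - w) + s • k) := by module
      rw [← sub_eq_zero, this, h4, sub_self]
    have h6 : (ν + τ * s) • (k ⨯₃ (e - w)) = 0 := by
      have := congrArg (fun z => z ⨯₃ (e - w)) h5
      simp only [map_smul, LinearMap.smul_apply] at this
      rw [cross_self, smul_zero] at this
      exact this.symm
    have h7 := (smul_eq_zero.1 h6).resolve_right hkε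
    rw [h7, zero_smul] at h5
    have h8 := (smul_eq_zero.1 h5).resolve_right hε0
    have h9 : τ = 1 / (1 - δ) := by rw [eq_div_iff hη.ne']; linarith
    have h10 : (1 - 2 / (1 - δ)) * s = s + 2 * ν := by
      have : ν = -(τ * s) := by linarith
      rw [this, h9]; ring
    rw [h10]
    convert h3 using 1; module

end

section

lemma additive_linear {D : ℝ → ℝ} (hpos : ∀ h, 0 ≤ h → 0 ≤ D h)
    (hadd : ∀ h k, 0 ≤ h → 0 ≤ k → D (h + k) = D h + D k) : ∀ h, 0 ≤ h → D h = h * D 1 := by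
  have hmono : ∀ h k, 0 ≤ h → h ≤ k → D h ≤ D k := by
    intro h k hh hk
    have := hadd h (k - h) hh (by linarith)
    rw [add_sub_cancel] at this
    linarith [hpos (k - h) (by linarith)]
  have hnat : ∀ (n : ℕ) h, 0 ≤ h → D (n * h) = n * D h := by
    intro n h hh
    induction n with
    | zero =>
      have := hadd 0 0 le_rfl le_rfl
      simp at this ⊢; exact this
    | succ n ih =>
      have := hadd (n * h) h (by positivity) hh
      push_cast
      rw [add_mul, one_mul, this, ih]; ring
  intro h hh
  have key : ∀ N : ℕ, 0 < N → |D h - h * D 1| * N ≤ D 1 := by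
    intro N hN
    have hN' : (0 : ℝ) < N := by exact_mod_cast hN
    have h1 := hnat N h hh
    have h2 := Nat.floor_le (a := N * h) (by positivity)
    have h3 := (Nat.lt_floor_add_one (N * h)).le
    have e1 := hmono _ _ (by positivity) h2
    have e2 := hmono _ _ (by positivity) h3
    have e3 := hnat ⌊N * h⌋₊ 1 zero_le_one
    have e4 := hnat (⌊N * h⌋₊ + 1) 1 zero_le_one
    push_cast at e4
    rw [mul_one] at e3 e4
    have h0 := hpos 1 zero_le_one
    have e5 : |D h - h * D 1| * N = |(D h - h * D 1) * N| := by rw [abs_mul, abs_of_pos hN']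
    rw [e5, abs_le]
    constructor <;> nlinarith
  by_contra hne
  have h4 : 0 < |D h - h * D 1| := abs_pos.2 (sub_ne_zero.2 hne)
  obtain ⟨N, hN⟩ := exists_nat_gt (D 1 / |D h - h * D 1|)
  have h0 := hpos 1 zero_le_one
  have hN0 : 0 < N := by
    have : (0 : ℝ) < N := lt_of_le_of_lt (by positivity) hN
    exact_mod_cast this
  rw [div_lt_iff₀ h4] at hN
  linarith [key N hN0]

lemma affine_of_scaling {F : ℝ → ℝ} {R A B : ℝ} (hR : 0 < R) (hF : StrictMonoOn F (Ioi R))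
    (C D : ℝ → ℝ) (h : ∀ t, 0 ≤ t → ∀ y, R < y → F (y + t) = C t * F y + D t)
    (h2 : ∀ y, R < y → F (2 * y) = A * F y + B) :
    ∃ α β : ℝ, 0 < α ∧ ∀ y, R < y → F y = α * y + β := by
  have hlt : ∀ y y', R < y → y < y' → F y < F y' := fun y y' hy hyy' =>
    hF hy (lt_trans hy hyy') hyy'
  have hΔ := hlt (R + 1) (R + 2) (by linarith) (by linarith)
  have hC : ∀ t, 0 ≤ t → 0 < C t := by
    intro t ht
    have e1 := h t ht (R + 1) (by linarith)
    have e2 := h t ht (R + 2) (by linarith)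
    have e3 := hlt (R + 1 + t) (R + 2 + t) (by linarith) (by linarith)
    by_contra hc
    nlinarith
  have hA : 0 < A := by
    have e1 := h2 (R + 1) (by linarith)
    have e2 := h2 (R + 2) (by linarith)
    have e3 := hlt (2 * (R + 1)) (2 * (R + 2)) (by linarith) (by linarith)
    by_contra hc
    nlinarith
  have hC1 : ∀ t, 0 ≤ t → C t = 1 := by
    intro t ht
    have e1 := h t ht (R + 1) (by linarith)
    have e2 := h t ht (R + 2) (by linarith)
    have f1 := h2 (R + 1 + t) (by linarith)
    have f2 := h2 (R + 2 + t) (by linarith)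
    have g1 := h (2 * t) (by linarith) (2 * (R + 1)) (by linarith)
    have g2 := h (2 * t) (by linarith) (2 * (R + 2)) (by linarith)
    have k1 := h2 (R + 1) (by linarith)
    have k2 := h2 (R + 2) (by linarith)
    have l1 := h t ht (R + 1 + t) (by linarith)
    have l2 := h t ht (R + 2 + t) (by linarith)
    have m1 := h (2 * t) (by linarith) (R + 1) (by linarith)
    have m2 := h (2 * t) (by linarith) (R + 2) (by linarith)
    have n1 : R + 1 + t + t = R + 1 + 2 * t := by ring
    have n2 : R + 2 + t + t = R + 2 + 2 * t := by ring
    have n3 : 2 * (R + 1 + t) = 2 * (R + 1) + 2 * t := by ring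
    have n4 : 2 * (R + 2 + t) = 2 * (R + 2) + 2 * t := by ring
    rw [n1] at l1; rw [n2] at l2; rw [n3] at f1; rw [n4] at f2
    have hd : F (R + 2) - F (R + 1) ≠ 0 := by linarith
    have p1 : C (2 * t) = C t := by
      have : A * (F (R + 2) - F (R + 1)) * (C (2 * t) - C t) = 0 := by
        rw [e1] at f1; rw [e2] at f2; rw [k1] at g1; rw [k2] at g2
        linear_combination f2 - f1 - g2 + g1
      have := (mul_eq_zero.1 this).resolve_left (mul_ne_zero hA.ne' hd)
      linarith
    have p2 : C (2 * t) = C t * C t := by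
      have : (F (R + 2) - F (R + 1)) * (C (2 * t) - C t * C t) = 0 := by
        rw [e1] at l1; rw [e2] at l2
        linear_combination l2 - l1 - m2 + m1
      have := (mul_eq_zero.1 this).resolve_left hd
      linarith
    have p3 : C t * (C t - 1) = 0 := by linarith
    have := (mul_eq_zero.1 p3).resolve_left (hC t ht).ne'
    linarith
  have hD : ∀ t, 0 ≤ t → ∀ y, R < y → F (y + t) = F y + D t := by
    intro t ht y hy; rw [h t ht y hy, hC1 t ht, one_mul]
  have hDpos : ∀ t, 0 < t → 0 < D t := by
    intro t ht
    have e1 := hD t ht.le (R + 1) (by linarith)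
    have e2 := hlt (R + 1) (R + 1 + t) (by linarith) (by linarith)
    linarith
  have hD0 : D 0 = 0 := by
    have e1 := hD 0 le_rfl (R + 1) (by linarith)
    rw [add_zero] at e1; linarith
  have hlin := additive_linear (D := D) (fun t ht => by
      rcases ht.eq_or_lt with rfl | ht
      · exact hD0.ge
      · exact (hDpos t ht).le) (fun t k ht hk => by
      have e1 := hD t ht (R + 1) (by linarith)
      have e2 := hD k hk (R + 1 + t) (by linarith)
      have e3 := hD (t + k) (by linarith) (R + 1) (by linarith)
      rw [← add_assoc] at e3
      linarith)
  refine ⟨D 1, F (R + 1) - D 1 * (R + 1), hDpos 1 one_pos, fun y hy => ?_⟩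
  rcases le_total y (R + 1) with hy1 | hy1
  · have e1 := hD (R + 1 - y) (by linarith) y hy
    rw [hlin _ (by linarith)] at e1
    rw [show y + (R + 1 - y) = R + 1 by ring] at e1
    linarith
  · have e1 := hD (y - (R + 1)) (by linarith) (R + 1) (by linarith)
    rw [hlin _ (by linarith)] at e1
    rw [show R + 1 + (y - (R + 1)) = y by ring] at e1
    linarith

lemma fe_half {x₁ x₂ : ℝ → ℝ → ℝ} {F₁ F₂ : ℝ → ℝ} {R : ℝ} (hR : 0 < R)
    (hF₁ : StrictMonoOn F₁ (Ioi R)) (hF₂ : StrictMonoOn F₂ (Ioi R))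
    (h : ∀ s₁ s₂ T₁ T₂ : ℝ, |s₁| * R < 1 → |s₂| * R < 1 → R < T₁ → R < T₂ →
      s₁ * T₁ - s₂ * T₂ = 1 → x₁ s₁ s₂ * F₁ T₁ - x₂ s₁ s₂ * F₂ T₂ = 1) :
    ∃ A₁ A₂ p q r : ℝ, 0 < A₁ ∧ 0 < A₂ ∧ 0 < r ∧ ∀ s₁ s₂, |s₁| < r → |s₂| < r → (0 < s₁ ∨ s₂ < 0) →
      x₁ s₁ s₂ * A₁ * (1 + p * s₁ + q * s₂) = s₁ ∧ x₂ s₁ s₂ * A₂ * (1 + p * s₁ + q * s₂) = s₂ := by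
  have hlt₁ : ∀ y y', R < y → y < y' → F₁ y < F₁ y' := fun y y' hy hyy' =>
    hF₁ hy (lt_trans hy hyy') hyy'
  have hlt₂ : ∀ y y', R < y → y < y' → F₂ y < F₂ y' := fun y y' hy hyy' =>
    hF₂ hy (lt_trans hy hyy') hyy'
  have hdiag : ∀ γ, R < γ → ∃ c d : ℝ, c ≠ 0 ∧ ∀ y, R < y → F₂ y = c * F₁ (y + γ) + d := by
    intro γ hγ
    have hγ0 : 0 < γ := hR.trans hγ
    have h1 : ∀ y, R < y → x₁ γ⁻¹ γ⁻¹ * F₁ (y + γ) - x₂ γ⁻¹ γ⁻¹ * F₂ y = 1 := by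
      intro y hy
      have h0 : |γ⁻¹| * R < 1 := by
        rw [abs_of_pos (by positivity), inv_mul_lt_iff₀ hγ0]; linarith
      exact h _ _ _ _ h0 h0 (by linarith) hy (by field_simp; ring)
    set a := x₁ γ⁻¹ γ⁻¹
    set b := x₂ γ⁻¹ γ⁻¹
    have e1 := h1 (R + 1) (by linarith)
    have e2 := h1 (R + 2) (by linarith)
    have l1 := hlt₁ (R + 1 + γ) (R + 2 + γ) (by linarith) (by linarith)
    have l2 := hlt₂ (R + 1) (R + 2) (by linarith) (by linarith)
    have e3 : a * (F₁ (R + 2 + γ) - F₁ (R + 1 + γ)) = b * (F₂ (R + 2) - F₂ (R + 1)) := by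
      linear_combination e2 - e1
    have hb : b ≠ 0 := by
      intro hb
      rw [hb, zero_mul] at e3
      have ha := (mul_eq_zero.1 e3).resolve_right (by linarith)
      rw [ha, hb] at e1; norm_num at e1
    have ha : a ≠ 0 := by
      intro ha
      rw [ha, zero_mul] at e3
      exact hb ((mul_eq_zero.1 e3.symm).resolve_right (by linarith))
    refine ⟨a / b, -1 / b, div_ne_zero ha hb, fun y hy => ?_⟩
    have := h1 y hy
    field_simp
    linarith
  choose! c d hc hd using hdiag
  have hγ : R < 2 * R := by linarith
  obtain ⟨A, B, hAB⟩ : ∃ A B : ℝ, ∀ y, R < y → F₂ (2 * y) = A * F₂ y + B := by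
    set g := 2 * R with hg
    have hg0 : 0 < g := by positivity
    have h1 : ∀ y, R < y →
        x₁ g⁻¹ (2 * g)⁻¹ * F₁ (y + g) - x₂ g⁻¹ (2 * g)⁻¹ * F₂ (2 * y) = 1 := by
      intro y hy
      refine h _ _ _ _ ?_ ?_ (by linarith) (by linarith) (by field_simp; ring)
      · rw [abs_of_pos (by positivity), inv_mul_lt_iff₀ hg0]; linarith
      · rw [abs_of_pos (by positivity), inv_mul_lt_iff₀ (by positivity)]; linarith
    set a := x₁ g⁻¹ (2 * g)⁻¹
    set b := x₂ g⁻¹ (2 * g)⁻¹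
    have hb : b ≠ 0 := by
      intro hb
      have e1 := h1 (R + 1) (by linarith)
      have e2 := h1 (R + 2) (by linarith)
      have l1 := hlt₁ (R + 1 + g) (R + 2 + g) (by linarith) (by linarith)
      rw [hb] at e1 e2
      have : a * (F₁ (R + 2 + g) - F₁ (R + 1 + g)) = 0 := by linarith
      have ha := (mul_eq_zero.1 this).resolve_right (by linarith)
      rw [ha] at e1; norm_num at e1
    refine ⟨a / (b * c g), -(a * d g / (b * c g)) - 1 / b, fun y hy => ?_⟩
    have e1 := h1 y hy
    have e2 := hd g hγ y hy
    have e3 := hc g hγ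
    rw [e2]
    field_simp
    linear_combination -c g * e1
  obtain ⟨α₂, β₂, hα₂, hF₂'⟩ := affine_of_scaling hR hF₂ (fun t => c (2 * R) / c (2 * R + t))
    (fun t => d (2 * R) - c (2 * R) / c (2 * R + t) * d (2 * R + t)) (by
      intro t ht y hy
      have e1 := hd (2 * R) hγ (y + t) (by linarith)
      have e2 := hd (2 * R + t) (by linarith) y hy
      have e3 := hc (2 * R + t) (by linarith)
      rw [show y + t + 2 * R = y + (2 * R + t) by ring] at e1
      rw [e1, e2]; field_simp; ring) hAB
  obtain ⟨α₁, β₁, hα₁, hF₁'⟩ : ∃ α β : ℝ, 0 < α ∧ ∀ y, 3 * R < y → F₁ y = α * y + β := by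
    have e3 := hc (2 * R) hγ
    have key : ∀ y, 3 * R < y → F₁ y = α₂ / c (2 * R) * y +
        (β₂ - α₂ * (2 * R) - d (2 * R)) / c (2 * R) := by
      intro y hy
      have e1 := hd (2 * R) hγ (y - 2 * R) (by linarith)
      rw [hF₂' _ (by linarith), sub_add_cancel] at e1
      field_simp
      linarith
    refine ⟨_, _, ?_, key⟩
    have e1 := key (3 * R + 1) (by linarith)
    have e2 := key (3 * R + 2) (by linarith)
    have e4 := hlt₁ (3 * R + 1) (3 * R + 2) (by linarith) (by linarith)
    linarith
  have fin : ∀ s₁ s₂ T₁ T₂ T₁' T₂' : ℝ, |s₁| * R < 1 → |s₂| * R < 1 → 3 * R < T₁ → 3 * R < T₂ →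
      3 * R < T₁' → 3 * R < T₂' → s₁ * T₁ - s₂ * T₂ = 1 → s₁ * T₁' - s₂ * T₂' = 1 →
      (T₁ ≠ T₁' ∨ T₂ ≠ T₂') →
      x₁ s₁ s₂ * α₁ * (1 + β₁ / α₁ * s₁ + -(β₂ / α₂) * s₂) = s₁ ∧
      x₂ s₁ s₂ * α₂ * (1 + β₁ / α₁ * s₁ + -(β₂ / α₂) * s₂) = s₂ := by
    intro s₁ s₂ T₁ T₂ T₁' T₂' h1 h2 k1 k2 k3 k4 e e' hne
    have f := h s₁ s₂ T₁ T₂ h1 h2 (by linarith) (by linarith) e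
    have f' := h s₁ s₂ T₁' T₂' h1 h2 (by linarith) (by linarith) e'
    rw [hF₁' _ k1, hF₂' _ (by linarith)] at f
    rw [hF₁' _ k3, hF₂' _ (by linarith)] at f'
    set a := x₁ s₁ s₂
    set b := x₂ s₁ s₂
    have hcr : a * α₁ * s₂ = b * α₂ * s₁ := by
      have g1 : s₁ * (T₁ - T₁') = s₂ * (T₂ - T₂') := by linarith
      have g2 : a * α₁ * (T₁ - T₁') = b * α₂ * (T₂ - T₂') := by linarith
      rcases hne with hne | hne
      · refine mul_left_cancel₀ (sub_ne_zero.2 hne) ?_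
        linear_combination s₂ * g2 - b * α₂ * g1
      · refine mul_left_cancel₀ (sub_ne_zero.2 hne) ?_
        linear_combination s₁ * g2 - a * α₁ * g1
    constructor
    · field_simp
      linear_combination s₁ * α₂ * f - β₂ * hcr - a * α₁ * α₂ * e - T₂ * α₂ * hcr
    · field_simp
      linear_combination s₂ * α₁ * f - β₁ * hcr - b * α₁ * α₂ * e - T₁ * α₁ * hcr
  refine ⟨α₁, α₂, β₁ / α₁, -(β₂ / α₂), 1 / (20 * R), hα₁, hα₂, by positivity, ?_⟩
  intro s₁ s₂ h1 h2 hs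
  rw [lt_div_iff₀ (by positivity)] at h1 h2
  have h1' : |s₁| * R < 1 / 20 := by linarith
  have h2' : |s₂| * R < 1 / 20 := by linarith
  have b1 := abs_lt.1 (show |s₁ * R| < 1 / 20 by rwa [abs_mul, abs_of_pos hR])
  have b2 := abs_lt.1 (show |s₂ * R| < 1 / 20 by rwa [abs_mul, abs_of_pos hR])
  rcases hs with hs | hs
  · refine fin s₁ s₂ ((1 + s₂ * (4 * R)) / s₁) (4 * R) ((1 + s₂ * (5 * R)) / s₁) (5 * R)
      (by linarith) (by linarith) ?_ (by linarith) ?_ (by linarith) ?_ ?_ (Or.inr (by linarith))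
    · rw [lt_div_iff₀ hs]; linarith
    · rw [lt_div_iff₀ hs]; linarith
    · field_simp; ring
    · field_simp; ring
  · have hs' : 0 < -s₂ := by linarith
    have hs0 : s₂ ≠ 0 := hs.ne
    refine fin s₁ s₂ (4 * R) ((1 - s₁ * (4 * R)) / -s₂) (5 * R) ((1 - s₁ * (5 * R)) / -s₂)
      (by linarith) (by linarith) (by linarith) ?_ (by linarith) ?_ ?_ ?_ (Or.inl (by linarith))
    · rw [lt_div_iff₀ hs']; linarith
    · rw [lt_div_iff₀ hs']; linarith
    · field_simp; ring
    · field_simp; ring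

lemma fe {x₁ x₂ : ℝ → ℝ → ℝ} {ψ₁ ψ₂ : ℝ → ℝ} {r : ℝ} (hr : 0 < r)
    (hψ₁ : StrictMonoOn ψ₁ (Ioo (-r) r)) (hψ₂ : StrictMonoOn ψ₂ (Ioo (-r) r))
    (h₁ : ψ₁ 0 = 0) (h₂ : ψ₂ 0 = 0) (hx₁ : x₁ 0 0 = 0) (hx₂ : x₂ 0 0 = 0)
    (h : ∀ s₁ s₂ t₁ t₂ : ℝ, |s₁| < r → |s₂| < r → |t₁| < r → |t₂| < r → t₁ * t₂ < 0 →
      s₁ / t₁ + s₂ / t₂ = 1 → x₁ s₁ s₂ / ψ₁ t₁ + x₂ s₁ s₂ / ψ₂ t₂ = 1) :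
    ∃ A₁ A₂ p q r : ℝ, 0 < A₁ ∧ 0 < A₂ ∧ 0 < r ∧ ∀ s₁ s₂, |s₁| < r → |s₂| < r →
      x₁ s₁ s₂ * A₁ * (1 + p * s₁ + q * s₂) = s₁ ∧ x₂ s₁ s₂ * A₂ * (1 + p * s₁ + q * s₂) = s₂ := by
  have hR : 0 < r⁻¹ := inv_pos.2 hr
  have h0 : (0 : ℝ) ∈ Ioo (-r) r := ⟨by linarith, hr⟩
  have hinv : ∀ T, r⁻¹ < T → 0 < T⁻¹ ∧ T⁻¹ < r := by
    intro T hT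
    have hT0 := hR.trans hT
    exact ⟨inv_pos.2 hT0, (inv_lt_comm₀ hr hT0).1 hT⟩
  have hposF : ∀ {ψ : ℝ → ℝ}, StrictMonoOn ψ (Ioo (-r) r) → ψ 0 = 0 →
      StrictMonoOn (fun T => (ψ T⁻¹)⁻¹) (Ioi r⁻¹) := by
    intro ψ hψ hψ0 T hT T' hT' hlt
    obtain ⟨a1, a2⟩ := hinv T hT
    obtain ⟨b1, b2⟩ := hinv T' hT'
    have c1 : T'⁻¹ < T⁻¹ := (inv_lt_inv₀ (hR.trans hT') (hR.trans hT)).2 hlt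
    have d1 := hψ h0 ⟨by linarith, b2⟩ b1
    have d2 := hψ ⟨by linarith, b2⟩ ⟨by linarith, a2⟩ c1
    rw [hψ0] at d1
    exact (inv_lt_inv₀ (d1.trans d2) d1).2 d2
  have hnegF : ∀ {ψ : ℝ → ℝ}, StrictMonoOn ψ (Ioo (-r) r) → ψ 0 = 0 →
      StrictMonoOn (fun T => -(ψ (-T⁻¹))⁻¹) (Ioi r⁻¹) := by
    intro ψ hψ hψ0
    have := hposF (ψ := fun t => -ψ (-t)) (by
      intro t ht t' ht' hlt
      exact neg_lt_neg (hψ ⟨by linarith [ht'.2], by linarith [ht'.1]⟩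
        ⟨by linarith [ht.2], by linarith [ht.1]⟩ (by linarith))) (by simp [hψ0])
    intro T hT T' hT' hlt
    have h1 := this hT hT' hlt
    simpa [inv_neg] using h1
  have habs : ∀ s : ℝ, |s| * r⁻¹ < 1 → |s| < r := by
    intro s hs
    rwa [mul_inv_lt_iff₀ hr, one_mul] at hs
  have hTa : ∀ T, r⁻¹ < T → |T⁻¹| < r ∧ |-T⁻¹| < r := by
    intro T hT
    obtain ⟨a1, a2⟩ := hinv T hT
    rw [abs_neg, abs_of_pos a1]; exact ⟨a2, a2⟩
  obtain ⟨A₁, A₂, p, q, ρ, hA₁, hA₂, hρ, H⟩ := fe_half (x₁ := x₁) (x₂ := x₂) hR (hposF hψ₁ h₁)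
    (hnegF hψ₂ h₂) (by
      intro s₁ s₂ T₁ T₂ k1 k2 k3 k4 e
      have hm : T₁⁻¹ * -T₂⁻¹ < 0 := by
        have := mul_pos (hinv _ k3).1 (hinv _ k4).1; linarith
      have := h s₁ s₂ T₁⁻¹ (-T₂⁻¹) (habs _ k1) (habs _ k2) (hTa _ k3).1 (hTa _ k4).2 hm (by
        rw [div_neg, div_inv_eq_mul, div_inv_eq_mul, ← sub_eq_add_neg]; exact e)
      rw [div_eq_mul_inv, div_eq_mul_inv] at this
      linarith)
  obtain ⟨A₂', A₁', q', p', ρ', hA₂', hA₁', hρ', H'⟩ := fe_half (x₁ := fun s t => x₂ t s)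
    (x₂ := fun s t => x₁ t s) hR (hposF hψ₂ h₂) (hnegF hψ₁ h₁) (by
      intro s₁ s₂ T₁ T₂ k1 k2 k3 k4 e
      have hm : -T₂⁻¹ * T₁⁻¹ < 0 := by
        have := mul_pos (hinv _ k3).1 (hinv _ k4).1; linarith
      have := h s₂ s₁ (-T₂⁻¹) T₁⁻¹ (habs _ k2) (habs _ k1) (hTa _ k4).2 (hTa _ k3).1 hm (by
        rw [div_neg, div_inv_eq_mul, div_inv_eq_mul]; linarith)
      rw [div_eq_mul_inv, div_eq_mul_inv] at this
      linarith)
  set m := min ρ ρ' with hm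
  have hm0 : 0 < m := lt_min hρ hρ'
  have cmp : ∀ s₁ s₂, 0 < s₁ → s₁ < m → 0 < s₂ → s₂ < m →
      A₁ * (1 + p * s₁ + q * s₂) = A₁' * (1 + p' * s₁ + q' * s₂) ∧
      A₂ * (1 + p * s₁ + q * s₂) = A₂' * (1 + p' * s₁ + q' * s₂) := by
    intro s₁ s₂ k1 k2 k3 k4
    have l1 := lt_of_lt_of_le k2 (min_le_left ρ ρ')
    have l2 := lt_of_lt_of_le k2 (min_le_right ρ ρ')
    have l3 := lt_of_lt_of_le k4 (min_le_left ρ ρ')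
    have l4 := lt_of_lt_of_le k4 (min_le_right ρ ρ')
    rw [← abs_of_pos k1] at l1 l2
    rw [← abs_of_pos k3] at l3 l4
    obtain ⟨e1, e2⟩ := H s₁ s₂ l1 l3 (Or.inl k1)
    obtain ⟨f1, f2⟩ := H' s₂ s₁ l4 l2 (Or.inl k3)
    constructor
    · have hx : x₁ s₁ s₂ ≠ 0 := by rintro hx; rw [hx] at e1; simp at e1; linarith
      refine mul_left_cancel₀ hx ?_
      linear_combination e1 - f2
    · have hx : x₂ s₁ s₂ ≠ 0 := by rintro hx; rw [hx] at e2; simp at e2; linarith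
      refine mul_left_cancel₀ hx ?_
      linear_combination e2 - f1
  have c1 := cmp (m / 3) (m / 3) (by linarith) (by linarith) (by linarith) (by linarith)
  have c2 := cmp (2 * m / 3) (m / 3) (by linarith) (by linarith) (by linarith) (by linarith)
  have c3 := cmp (m / 3) (2 * m / 3) (by linarith) (by linarith) (by linarith) (by linarith)
  have a1 : A₁' = A₁ := by linarith [c1.1, c2.1, c3.1]
  have a2 : A₂' = A₂ := by linarith [c1.2, c2.2, c3.2]
  rw [a1, a2] at c1 c2 c3
  have hp : p' = p := by
    refine mul_left_cancel₀ (mul_ne_zero hA₁.ne' hm0.ne') ?_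
    linarith [c1.1, c2.1]
  have hq : q' = q := by
    refine mul_left_cancel₀ (mul_ne_zero hA₁.ne' hm0.ne') ?_
    linarith [c1.1, c3.1]
  rw [a1, a2, hp, hq] at H'
  refine ⟨A₁, A₂, p, q, m, hA₁, hA₂, hm0, fun s₁ s₂ k1 k2 => ?_⟩
  by_cases hc : 0 < s₁ ∨ s₂ < 0
  · exact H s₁ s₂ (lt_of_lt_of_le k1 (min_le_left _ _)) (lt_of_lt_of_le k2 (min_le_left _ _)) hc
  by_cases hc' : 0 < s₂ ∨ s₁ < 0
  · obtain ⟨e1, e2⟩ := H' s₂ s₁ (lt_of_lt_of_le k2 (min_le_right _ _))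
      (lt_of_lt_of_le k1 (min_le_right _ _)) hc'
    constructor
    · linear_combination e2
    · linear_combination e1
  push Not at hc hc'
  have z1 : s₁ = 0 := le_antisymm hc.1 hc'.2
  have z2 : s₂ = 0 := le_antisymm hc'.1 hc.2
  simp [z1, z2, hx₁, hx₂]

end

section

variable {K : Set V3} {e : V3} {v : V3 → V3}

lemma FC.exists_dirs (F : FC K e v) {b : V3} (hgood : Good K e b) (hbe : b ⬝ᵥ e ≠ 0)
    (hv : v b ≠ e) : ∃ d₁ d₂ : V3, d₁ ⬝ᵥ b = 0 ∧ d₂ ⬝ᵥ b = 0 ∧ d₁ ⨯₃ d₂ ≠ 0 ∧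
      ∀ s ∈ Icc (0 : ℝ) 1, (d₁ + s • (d₂ - d₁)) ⨯₃ (e - v b) ≠ 0 ∧
        -e + (d₁ + s • (d₂ - d₁)) ∈ interior K := by
  have hb : b ≠ 0 := by rintro rfl; simp at hbe
  obtain ⟨ε, hε⟩ : ∃ ε, ε = e - v b := ⟨_, rfl⟩
  have hε0 : ε ≠ 0 := by rw [hε]; exact sub_ne_zero.2 hv.symm
  have hbε : b ⬝ᵥ ε = 0 := by rw [hε, dotProduct_sub, F.dot b hb, sub_self]
  have hεb : ε ⬝ᵥ b = 0 := by rw [dotProduct_comm]; exact hbε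
  obtain ⟨x, hx⟩ : ∃ x, x = b ⨯₃ ε := ⟨_, rfl⟩
  have hxε : x ⨯₃ ε = -(ε ⬝ᵥ ε) • b := by
    rw [hx, cross_smul_sub, hbε]; simp
  have hxε0 : x ⨯₃ ε ≠ 0 := by
    rw [hxε]; exact smul_ne_zero (neg_ne_zero.2 (dot_self_pos hε0).ne') hb
  have hxb : x ⬝ᵥ b = 0 := by rw [hx]; exact cross_dot_self _ _
  obtain ⟨δ, hδ, h⟩ := Metric.eventually_nhds_iff.1
    (eventually_line (u := x) (F.v_int hb hgood))
  obtain ⟨τ, hτ⟩ : ∃ τ, τ = δ / 3 := ⟨_, rfl⟩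
  have hτ0 : 0 < τ := by rw [hτ]; positivity
  have key : ∀ s : ℝ, (ε + τ • x) + s • ((ε + (2 * τ) • x) - (ε + τ • x)) =
      ε + ((1 + s) * τ) • x := fun s => by module
  refine ⟨ε + τ • x, ε + (2 * τ) • x, ?_, ?_, ?_, ?_⟩
  · simp [add_dotProduct, hεb, hxb]
  · simp [add_dotProduct, hεb, hxb]
  · have : (ε + τ • x) ⨯₃ (ε + (2 * τ) • x) = (-τ) • (x ⨯₃ ε) := by
      ext i; fin_cases i <;> simp [cross_apply] <;> ring
    rw [this]
    exact smul_ne_zero (neg_ne_zero.2 hτ0.ne') hxε0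
  · intro s hs
    rw [key, ← hε]
    constructor
    · have : (ε + ((1 + s) * τ) • x) ⨯₃ ε = ((1 + s) * τ) • (x ⨯₃ ε) := by
        ext i; fin_cases i <;> simp [cross_apply]
      rw [this]
      exact smul_ne_zero (mul_pos (by linarith [hs.1]) hτ0).ne' hxε0
    · have h1 : -e + (ε + ((1 + s) * τ) • x) = -v b + ((1 + s) * τ) • x := by
        rw [hε]; abel
      rw [h1]
      apply h
      rw [Real.dist_eq, sub_zero, abs_of_nonneg (mul_nonneg (by linarith [hs.1]) hτ0.le)]
      nlinarith [hs.2, hs.1]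

lemma tendsto_dir (F : FC K e v) {b : V3} (hb : b ≠ 0) (hgood : Good K e b) (d : V3) :
    Tendsto (fun β => d ⨯₃ v β) (𝓝 b) (𝓝 (d ⨯₃ v b)) := by
  have h : Continuous fun z : V3 => d ⨯₃ z := by fun_prop
  exact (h.tendsto _).comp (F.continuousAt hb hgood)

/-- Near a generic plane, the direction of the centre determines the plane. -/
lemma FC.local_inj (F : FC K e v) {b : V3} (hgood : Good K e b) (hbe : b ⬝ᵥ e ≠ 0)
    (hv : v b ≠ e) :
    ∀ᶠ q in 𝓝 ((b, b) : V3 × V3), v q.1 ⨯₃ v q.2 = 0 → q.1 ⨯₃ q.2 = 0 := by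
  have hb : b ≠ 0 := by rintro rfl; simp at hbe
  obtain ⟨d₁, d₂, h1, h2, h12, hs⟩ := F.exists_dirs hgood hbe hv
  have e1 := hs 0 (by simp)
  have e2 := hs 1 (by simp)
  rw [zero_smul, add_zero] at e1
  rw [one_smul, add_sub_cancel] at e2
  have ht1 : -e + (1 : ℝ) • d₁ ∈ interior K := by rw [one_smul]; exact e1.2
  have ht2 : -e + (1 : ℝ) • d₂ ∈ interior K := by rw [one_smul]; exact e2.2
  have hi := F.indep hgood hbe hv h1 h2 h12 e1.1 e2.1 ht1 ht2
  have P1 := pair_of_dir F hbe h1 e1.1 ht1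
  have P2 := pair_of_dir F hbe h2 e2.1 ht2
  have f1 : Tendsto (fun q : V3 × V3 => q.1) (𝓝 (b, b)) (𝓝 b) := continuous_fst.tendsto _
  have f2 : Tendsto (fun q : V3 × V3 => q.2) (𝓝 (b, b)) (𝓝 b) := continuous_snd.tendsto _
  have hP : ∀ {d : V3} {p : V3 × V3 → V3}, Pair K e b (d ⨯₃ v b) →
      Tendsto p (𝓝 (b, b)) (𝓝 b) → ∀ᶠ q in 𝓝 ((b, b) : V3 × V3), Pair K e (p q) (d ⨯₃ v q.1) := by
    intro d p hp hpt
    have := hpt.prodMk_nhds ((tendsto_dir F hb hgood d).comp f1)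
    exact this.eventually (isOpen_pair.mem_nhds hp)
  have hc : ∀ {d : V3}, Pair K e b (d ⨯₃ v b) →
      Tendsto (fun q : V3 × V3 => v (d ⨯₃ v q.1)) (𝓝 (b, b)) (𝓝 (v (d ⨯₃ v b))) := by
    intro d hp
    exact (F.continuousAt hp.symm.ne_left hp.symm.good_left).tendsto.comp
      ((tendsto_dir F hb hgood d).comp f1)
  have hcr : Continuous fun z : V3 × V3 => z.1 ⨯₃ z.2 := by fun_prop
  have hi' := ((hcr.tendsto _).comp ((hc P1).prodMk_nhds (hc P2))).eventually_ne hi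
  filter_upwards [hP P1 f1, hP P1 f2, hP P2 f1, hP P2 f2, hi'] with q q1 q2 q3 q4 q5 hq
  have hv0 : v q.1 ≠ 0 := by
    intro h
    have := F.dot _ q1.ne_left
    rw [h] at this
    exact q1.2.1 (by simpa using this.symm)
  obtain ⟨t, ht⟩ := exists_smul_of_cross hq hv0
  have z : ∀ d : V3, (d ⨯₃ v q.1) ⬝ᵥ v q.1 = 0 := fun d => cross_dot_right _ _
  have z' : ∀ d : V3, (d ⨯₃ v q.1) ⬝ᵥ v q.2 = 0 := fun d => by
    rw [ht, dotProduct_smul, z, smul_zero]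
  have c1 := q1.conj F (z _)
  have c2 := q2.conj F (z' _)
  have c3 := q3.conj F (z _)
  have c4 := q4.conj F (z' _)
  rw [dotProduct_comm] at c1 c2 c3 c4
  obtain ⟨t₁, h₁⟩ := exists_smul_cross q5 c1 c3
  obtain ⟨t₂, h₂⟩ := exists_smul_cross q5 c2 c4
  rw [h₁, h₂]
  simp

end

section

variable {K : Set V3} {e : V3} {v : V3 → V3}

lemma coord_decomp {a b c : V3} (h : (a ⨯₃ b) ⬝ᵥ c ≠ 0) (y : V3) :
    y = ((b ⨯₃ c) ⬝ᵥ y / (a ⨯₃ b) ⬝ᵥ c) • a + ((c ⨯₃ a) ⬝ᵥ y / (a ⨯₃ b) ⬝ᵥ c) • b +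
      ((a ⨯₃ b) ⬝ᵥ y / (a ⨯₃ b) ⬝ᵥ c) • c := by
  have key : ((a ⨯₃ b) ⬝ᵥ c) • y = ((b ⨯₃ c) ⬝ᵥ y) • a + ((c ⨯₃ a) ⬝ᵥ y) • b +
      ((a ⨯₃ b) ⬝ᵥ y) • c := by
    ext i
    fin_cases i <;> simp [cross_apply, dotProduct, Fin.sum_univ_three] <;> ring
  rw [← (smul_right_injective V3 h).eq_iff]
  simp only [smul_add, smul_smul, mul_div_cancel₀ _ h]
  exact key

lemma cross_eq_zero_of_plane {a b c z z' : V3} (h : (c ⨯₃ b) ⬝ᵥ a ≠ 0) (hz : a ⬝ᵥ z = 0)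
    (hz' : a ⬝ᵥ z' = 0) (h' : (c ⬝ᵥ z) * (b ⬝ᵥ z') = (c ⬝ᵥ z') * (b ⬝ᵥ z)) : z ⨯₃ z' = 0 := by
  by_contra hne
  have hz2 : z ⬝ᵥ a = 0 := by rw [dotProduct_comm]; exact hz
  have hz3 : z' ⬝ᵥ a = 0 := by rw [dotProduct_comm]; exact hz'
  obtain ⟨t, ht⟩ := exists_smul_cross hne hz2 hz3
  rw [ht, dotProduct_smul, smul_eq_mul] at h
  have : (c ⨯₃ b) ⬝ᵥ (z ⨯₃ z') = (c ⬝ᵥ z) * (b ⬝ᵥ z') - (c ⬝ᵥ z') * (b ⬝ᵥ z) := by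
    simp [cross_apply, dotProduct, Fin.sum_univ_three]; ring
  rw [this, h', sub_self, mul_zero] at h
  exact h rfl

lemma FC.v_ne_zero (F : FC K e v) {g : V3} (hg : g ⬝ᵥ e ≠ 0) : v g ≠ 0 := by
  intro h
  have := F.dot g (by rintro rfl; simp at hg)
  rw [h, dotProduct_zero] at this
  exact hg this.symm

lemma FC.exists_arc (F : FC K e v) {a b c : V3} (hgood : Good K e b) (hbe : b ⬝ᵥ e ≠ 0)
    (hv : v b ≠ e) (hP : Pair K e b a) (hav : a ⬝ᵥ v b = 0) (hc : (c ⨯₃ b) ⬝ᵥ a ≠ 0) :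
    ∃ g : V3, g ≠ 0 ∧ g ⬝ᵥ v b = 0 ∧ g ⬝ᵥ v a = 0 ∧ ∃ r > 0,
      StrictMonoOn (fun t : ℝ => c ⬝ᵥ v (b + t • g) / b ⬝ᵥ v (b + t • g)) (Ioo (-r) r) := by
  have hb : b ≠ 0 := by rintro rfl; simp at hbe
  have hbn : b ⬝ᵥ v a = 0 := hP.conj F hav
  have hbw : b ⬝ᵥ v b ≠ 0 := by rw [F.dot b hb]; exact hbe
  have hn0 := F.v_ne_zero hP.2.2.1
  obtain ⟨g, hg⟩ : ∃ g, g = v a ⨯₃ v b := ⟨_, rfl⟩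
  have hgw : g ⬝ᵥ v b = 0 := by rw [hg]; exact cross_dot_right _ _
  have hgn : g ⬝ᵥ v a = 0 := by rw [hg]; exact cross_dot_self _ _
  have hg0 : g ≠ 0 := by
    intro h
    rw [hg] at h
    obtain ⟨t, ht⟩ := exists_smul_of_cross h hn0
    rw [ht, dotProduct_smul, hbn] at hbw; simp at hbw
  have hbg : b ⨯₃ g ≠ 0 := by
    intro h
    obtain ⟨t, ht⟩ := exists_smul_of_cross h hb
    have ht0 : t ≠ 0 := by rintro rfl; rw [zero_smul] at ht; exact hg0 ht
    rw [ht, smul_dotProduct, smul_eq_mul] at hgw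
    exact (mul_ne_zero ht0 hbw) hgw
  have hβ : Tendsto (fun t : ℝ => b + t • g) (𝓝 0) (𝓝 b) := by
    have : ContinuousAt (fun s : ℝ => b + s • g) 0 := by fun_prop
    simpa [ContinuousAt] using this
  have hbv : ∀ᶠ β in 𝓝 b, b ⬝ᵥ v β ≠ 0 := by
    have h : Continuous fun z : V3 => b ⬝ᵥ z := by fun_prop
    exact ((h.tendsto _).comp (F.continuousAt hb hgood).tendsto).eventually_ne hbw
  have hPe : ∀ᶠ β in 𝓝 b, Pair K e β a := by
    have : Tendsto (fun β : V3 => (β, a)) (𝓝 b) (𝓝 (b, a)) := by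
      exact tendsto_id.prodMk_nhds tendsto_const_nhds
    exact this.eventually (isOpen_pair.mem_nhds hP)
  have hli := F.local_inj hgood hbe hv
  rw [nhds_prod_eq] at hli
  obtain ⟨p, hp, hp'⟩ := (eventually_prod_self_iff
    (r := fun x y => v x ⨯₃ v y = 0 → x ⨯₃ y = 0)).1 hli
  obtain ⟨r, hr, h⟩ := Metric.eventually_nhds_iff.1 (hβ.eventually ((hbv.and hPe).and hp))
  have hmem : ∀ t ∈ Ioo (-r) r, dist t 0 < r := fun t ht => by
    rw [Real.dist_eq, sub_zero, abs_lt]; exact ht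
  have hcont : ContinuousOn (fun t : ℝ => c ⬝ᵥ v (b + t • g) / b ⬝ᵥ v (b + t • g))
      (Ioo (-r) r) := by
    intro t ht
    obtain ⟨⟨h1, h2⟩, h3⟩ := h (hmem t ht)
    have c1 : ContinuousAt (fun t : ℝ => v (b + t • g)) t := by
      have : ContinuousAt (fun t : ℝ => b + t • g) t := by fun_prop
      exact ContinuousAt.comp (f := fun t : ℝ => b + t • g)
        (F.continuousAt h2.ne_left h2.good_left) this
    have c2 : ∀ d : V3, ContinuousAt (fun t : ℝ => d ⬝ᵥ v (b + t • g)) t := by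
      intro d
      have h : Continuous fun z : V3 => d ⬝ᵥ z := by fun_prop
      exact ContinuousAt.comp (g := fun z : V3 => d ⬝ᵥ z) h.continuousAt c1
    exact ((c2 c).div (c2 b) h1).continuousWithinAt
  have hinj : InjOn (fun t : ℝ => c ⬝ᵥ v (b + t • g) / b ⬝ᵥ v (b + t • g)) (Ioo (-r) r) := by
    intro t ht t' ht' htt
    obtain ⟨⟨h1, h2⟩, h3⟩ := h (hmem t ht)
    obtain ⟨⟨h1', h2'⟩, h3'⟩ := h (hmem t' ht')
    have hbv0 : ∀ s : ℝ, (b + s • g) ⬝ᵥ v a = 0 := fun s => by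
      simp [add_dotProduct, hbn, hgn]
    have q1 := h2.symm.conj F (hbv0 t)
    have q2 := h2'.symm.conj F (hbv0 t')
    have q3 := cross_eq_zero_of_plane hc q1 q2 ((div_eq_div_iff h1 h1').1 htt)
    have q4 := hp' _ h3 _ h3' q3
    have q5 : (b + t • g) ⨯₃ (b + t' • g) = (t' - t) • (b ⨯₃ g) := by
      ext i; fin_cases i <;> simp [cross_apply] <;> ring
    rw [q5] at q4
    rcases smul_eq_zero.1 q4 with h | h
    · linarith
    · exact absurd h hbg
  rcases hcont.strictMonoOn_of_injOn_Ioo (by linarith) hinj with hm | hm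
  · exact ⟨g, hg0, hgw, hgn, r, hr, hm⟩
  · refine ⟨-g, neg_ne_zero.2 hg0, by simp [hgw], by simp [hgn], r, hr, ?_⟩
    intro t ht t' ht' htt
    have := hm (a := -t') (b := -t) ⟨by linarith [ht'.2], by linarith [ht'.1]⟩
      ⟨by linarith [ht.2], by linarith [ht.1]⟩ (by linarith)
    simpa using this

lemma FC.patch (F : FC K e v) {b : V3} (hgood : Good K e b) (hbe : b ⬝ᵥ e ≠ 0) (hv : v b ≠ e) :
    ∃ B : V3 →ₗ[ℝ] V3, Function.Injective B ∧ ∀ᶠ g in 𝓝 b, v g ⨯₃ B g = 0 := by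
  have hb : b ≠ 0 := by rintro rfl; simp at hbe
  obtain ⟨d₁, d₂, h1, h2, h12, hs⟩ := F.exists_dirs hgood hbe hv
  obtain ⟨w, hw⟩ : ∃ w, w = v b := ⟨_, rfl⟩
  have hbw : b ⬝ᵥ w ≠ 0 := by rw [hw, F.dot b hb]; exact hbe
  have hw0 : w ≠ 0 := by rintro h; rw [h] at hbw; simp at hbw
  obtain ⟨δ, hδ⟩ : ∃ δ, δ = (d₁ ⨯₃ d₂) ⬝ᵥ w := ⟨_, rfl⟩
  obtain ⟨κ, hκ⟩ := exists_smul_cross h12 h1 h2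
  have hδ0 : δ ≠ 0 := by
    intro h
    rw [hκ, smul_dotProduct, ← hδ, h] at hbw; simp at hbw
  obtain ⟨a₁, ha₁⟩ : ∃ a₁, a₁ = d₁ ⨯₃ w := ⟨_, rfl⟩
  obtain ⟨a₂, ha₂⟩ : ∃ a₂, a₂ = d₂ ⨯₃ w := ⟨_, rfl⟩
  obtain ⟨m, hm⟩ : ∃ m, m = d₁ ⨯₃ d₂ := ⟨_, rfl⟩
  have hmw : m ⬝ᵥ w = δ := by rw [hm, hδ]
  have hmd₁ : m ⬝ᵥ d₁ = 0 := by rw [hm]; exact cross_dot_self _ _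
  have hmd₂ : m ⬝ᵥ d₂ = 0 := by rw [hm]; exact cross_dot_right _ _
  have ha₁w : a₁ ⬝ᵥ w = 0 := by rw [ha₁]; exact cross_dot_right _ _
  have ha₂w : a₂ ⬝ᵥ w = 0 := by rw [ha₂]; exact cross_dot_right _ _
  have ha₁d₁ : a₁ ⬝ᵥ d₁ = 0 := by rw [ha₁]; exact cross_dot_self _ _
  have ha₂d₂ : a₂ ⬝ᵥ d₂ = 0 := by rw [ha₂]; exact cross_dot_self _ _
  have ha₂d₁ : a₂ ⬝ᵥ d₁ = δ := by
    rw [ha₂, hδ]; simp [cross_apply, dotProduct, Fin.sum_univ_three]; ring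
  have ha₁d₂ : a₁ ⬝ᵥ d₂ = -δ := by
    rw [ha₁, hδ]; simp [cross_apply, dotProduct, Fin.sum_univ_three]; ring
  have ha₁₂ : a₁ ⨯₃ a₂ = δ • w := by
    rw [ha₁, ha₂, hδ]; ext i
    fin_cases i <;> simp [cross_apply, dotProduct, Fin.sum_univ_three] <;> ring
  -- coordinates of the centre in the frame `w`, `d₁`, `d₂`
  obtain ⟨c₁, hc₁⟩ : ∃ c₁, c₁ = (b ⬝ᵥ w / δ) • a₂ := ⟨_, rfl⟩
  obtain ⟨c₂, hc₂⟩ : ∃ c₂, c₂ = (-(b ⬝ᵥ w / δ)) • a₁ := ⟨_, rfl⟩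
  have hbwδ : b ⬝ᵥ w / δ ≠ 0 := div_ne_zero hbw hδ0
  have hz : ∀ z : V3, b ⬝ᵥ z ≠ 0 → z = (b ⬝ᵥ z / b ⬝ᵥ w) •
      (w + (c₁ ⬝ᵥ z / b ⬝ᵥ z) • d₁ + (c₂ ⬝ᵥ z / b ⬝ᵥ z) • d₂) := by
    intro z hbz
    have hd := coord_decomp (a := d₁) (b := d₂) (c := w) (by rw [← hδ]; exact hδ0) z
    have e1 : (d₁ ⨯₃ d₂) ⬝ᵥ z / δ = b ⬝ᵥ z / b ⬝ᵥ w := by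
      have hκ0 : κ ≠ 0 := by rintro rfl; rw [zero_smul] at hκ; exact hb hκ
      have e2 : b ⬝ᵥ z = κ * (d₁ ⨯₃ d₂) ⬝ᵥ z := by conv_lhs => rw [hκ, smul_dotProduct, smul_eq_mul]
      have e3 : b ⬝ᵥ w = κ * δ := by conv_lhs => rw [hκ, smul_dotProduct, smul_eq_mul, ← hδ]
      rw [e2, e3]; field_simp
    have e2 : (d₂ ⨯₃ w) ⬝ᵥ z / δ = b ⬝ᵥ z / b ⬝ᵥ w * (c₁ ⬝ᵥ z / b ⬝ᵥ z) := by
      rw [hc₁, ← ha₂, smul_dotProduct, smul_eq_mul]; field_simp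
    have e3 : (w ⨯₃ d₁) ⬝ᵥ z / δ = b ⬝ᵥ z / b ⬝ᵥ w * (c₂ ⬝ᵥ z / b ⬝ᵥ z) := by
      rw [hc₂, ← cross_anticomm, ← ha₁, smul_dotProduct, neg_dotProduct, smul_eq_mul]; field_simp
    rw [← hδ, e1, e2, e3] at hd
    conv_lhs => rw [hd]
    module
  have e1 := hs 0 (by simp)
  have e2 := hs 1 (by simp)
  rw [zero_smul, add_zero] at e1
  rw [one_smul, add_sub_cancel] at e2
  have hPs : ∀ s ∈ Icc (0 : ℝ) 1, Pair K e b ((1 - s) • a₁ + s • a₂) := by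
    intro s hs'
    have h3 := hs s hs'
    have := pair_of_dir F hbe (d := d₁ + s • (d₂ - d₁)) (by simp [add_dotProduct, h1, h2])
      h3.1 (t := 1) (by rw [one_smul]; exact h3.2)
    have e : (d₁ + s • (d₂ - d₁)) ⨯₃ v b = (1 - s) • a₁ + s • a₂ := by
      rw [ha₁, ha₂, ← hw]; ext i; fin_cases i <;> simp [cross_apply] <;> ring
    rwa [e] at this
  have hP₁ : Pair K e b a₁ := by have := hPs 0 (by simp); simpa using this
  have hP₂ : Pair K e b a₂ := by have := hPs 1 (by simp); simpa using this
  obtain ⟨g₁, hg₁, hg₁w, hg₁n, r₁, hr₁, hm₁⟩ := F.exists_arc (c := c₁) hgood hbe hv hP₁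
    (by rw [← hw]; exact ha₁w) (by
      have : (c₁ ⨯₃ b) ⬝ᵥ a₁ = (b ⬝ᵥ w / δ) * ((a₁ ⨯₃ a₂) ⬝ᵥ b) := by
        rw [hc₁]; simp [cross_apply, dotProduct, Fin.sum_univ_three]; ring
      rw [this, ha₁₂, smul_dotProduct, dotProduct_comm w]
      exact mul_ne_zero hbwδ (mul_ne_zero hδ0 hbw))
  obtain ⟨g₂, hg₂, hg₂w, hg₂n, r₂, hr₂, hm₂⟩ := F.exists_arc (c := c₂) hgood hbe hv hP₂
    (by rw [← hw]; exact ha₂w) (by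
      have : (c₂ ⨯₃ b) ⬝ᵥ a₂ = (b ⬝ᵥ w / δ) * ((a₁ ⨯₃ a₂) ⬝ᵥ b) := by
        rw [hc₂]; simp [cross_apply, dotProduct, Fin.sum_univ_three]; ring
      rw [this, ha₁₂, smul_dotProduct, dotProduct_comm w]
      exact mul_ne_zero hbwδ (mul_ne_zero hδ0 hbw))
  rw [← hw] at hg₁w hg₂w
  have hbn₁ : b ⬝ᵥ v a₁ = 0 := hP₁.conj F (by rw [← hw]; exact ha₁w)
  have hbn₂ : b ⬝ᵥ v a₂ = 0 := hP₂.conj F (by rw [← hw]; exact ha₂w)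
  -- the frame `g₁`, `g₂`, `b`
  have hD : (g₁ ⨯₃ g₂) ⬝ᵥ b ≠ 0 := by
    have hg₁₂ : g₁ ⨯₃ g₂ ≠ 0 := by
      intro h
      obtain ⟨t, ht⟩ := exists_smul_of_cross h hg₁
      have ht0 : t ≠ 0 := by rintro rfl; rw [zero_smul] at ht; exact hg₂ ht
      rw [ht, smul_dotProduct, smul_eq_mul] at hg₂n
      have h3 : g₁ ⬝ᵥ v a₂ = 0 := (mul_eq_zero.1 hg₂n).resolve_left ht0
      have hi := F.indep hgood hbe hv h1 h2 h12 e1.1 e2.1 (t₁ := 1) (t₂ := 1)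
        (by rw [one_smul]; exact e1.2) (by rw [one_smul]; exact e2.2)
      rw [← hw, ← ha₁, ← ha₂] at hi
      rw [dotProduct_comm] at hg₁n h3 hbn₁ hbn₂
      obtain ⟨s, hs⟩ := exists_smul_cross hi hg₁n h3
      obtain ⟨s', hs'⟩ := exists_smul_cross hi hbn₁ hbn₂
      have hs0 : s ≠ 0 := by rintro rfl; rw [zero_smul] at hs; exact hg₁ hs
      rw [hs, smul_dotProduct, smul_eq_mul] at hg₁w
      rw [hs', smul_dotProduct, (mul_eq_zero.1 hg₁w).resolve_left hs0] at hbw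
      simp at hbw
    intro h
    obtain ⟨t, ht⟩ := exists_smul_cross hg₁₂ hg₁w hg₂w
    rw [ht, dotProduct_smul, dotProduct_comm, h] at hbw
    simp at hbw
  -- uniform neighbourhoods
  have hlin : ∀ d : V3, Continuous fun z : V3 => d ⬝ᵥ z := fun d => by fun_prop
  have hbv : ∀ᶠ β in 𝓝 b, b ⬝ᵥ v β ≠ 0 :=
    (((hlin b).tendsto _).comp (F.continuousAt hb hgood).tendsto).eventually_ne (by
      rw [← hw]; exact hbw)
  have hPe : ∀ {a : V3}, Pair K e b a → ∀ᶠ β in 𝓝 b, Pair K e β a := by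
    intro a hP
    have : Tendsto (fun β : V3 => (β, a)) (𝓝 b) (𝓝 (b, a)) := by
      exact tendsto_id.prodMk_nhds tendsto_const_nhds
    exact this.eventually (isOpen_pair.mem_nhds hP)
  have hun : ∀ᶠ q in 𝓝 ((b, (0 : ℝ)) : V3 × ℝ), ∀ s ∈ Icc (0 : ℝ) 1,
      Pair K e q.1 ((1 - s) • a₁ + s • a₂ + q.2 • m) := by
    refine isCompact_Icc.eventually_forall_of_forall_eventually fun s hs' => ?_
    have hc : Continuous fun z : (V3 × ℝ) × ℝ =>
        ((z.1.1, (1 - z.2) • a₁ + z.2 • a₂ + z.1.2 • m) : V3 × V3) := by fun_prop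
    refine (hc.tendsto ((b, (0 : ℝ)), s)).eventually (isOpen_pair.mem_nhds ?_)
    have := hPs s hs'
    show Pair K e b ((1 - s) • a₁ + s • a₂ + (0 : ℝ) • m)
    rwa [zero_smul, add_zero]
  rw [nhds_prod_eq] at hun
  obtain ⟨pa, hpa, pb, hpb, hpab⟩ := eventually_prod_iff.1 hun
  obtain ⟨ρ, hρ, hpb⟩ := Metric.eventually_nhds_iff.1 hpb
  have hx : ∀ c : V3, c ⬝ᵥ w = 0 → ∀ᶠ β in 𝓝 b, |c ⬝ᵥ v β / b ⬝ᵥ v β| < ρ := by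
    intro c hc
    have t1 := ((hlin c).tendsto _).comp (F.continuousAt hb hgood).tendsto
    have t2 := ((hlin b).tendsto _).comp (F.continuousAt hb hgood).tendsto
    have t3 := (t1.div t2 (by rw [← hw]; exact hbw)).abs
    rw [← hw, hc, zero_div, abs_zero] at t3
    exact t3.eventually (gt_mem_nhds hρ)
  have hc₁w : c₁ ⬝ᵥ w = 0 := by rw [hc₁, smul_dotProduct, ha₂w, smul_zero]
  have hc₂w : c₂ ⬝ᵥ w = 0 := by rw [hc₂, smul_dotProduct, ha₁w, smul_zero]
  obtain ⟨β, hβ⟩ : ∃ β : ℝ → ℝ → V3, β = fun s₁ s₂ => b + s₁ • g₁ + s₂ • g₂ := ⟨_, rfl⟩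
  have hβt : Tendsto (fun s : ℝ × ℝ => β s.1 s.2) (𝓝 (0, 0)) (𝓝 b) := by
    have : Continuous fun s : ℝ × ℝ => β s.1 s.2 := by rw [hβ]; fun_prop
    have h := this.tendsto (0, 0)
    rw [hβ] at h ⊢
    simpa using h
  obtain ⟨r₀, hr₀, h⟩ := Metric.eventually_nhds_iff.1 (hβt.eventually
    ((hbv.and ((hPe hP₁).and (hPe hP₂))).and (hpa.and ((hx c₁ hc₁w).and (hx c₂ hc₂w)))))
  obtain ⟨r, hr⟩ : ∃ r, r = min r₀ (min r₁ r₂) := ⟨_, rfl⟩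
  have hr0 : 0 < r := by rw [hr]; exact lt_min hr₀ (lt_min hr₁ hr₂)
  have hrr₀ : r ≤ r₀ := by rw [hr]; exact min_le_left _ _
  have hrr₁ : r ≤ r₁ := by rw [hr]; exact (min_le_right _ _).trans (min_le_left _ _)
  have hrr₂ : r ≤ r₂ := by rw [hr]; exact (min_le_right _ _).trans (min_le_right _ _)
  have hN : ∀ s₁ s₂ : ℝ, |s₁| < r → |s₂| < r →
      (b ⬝ᵥ v (β s₁ s₂) ≠ 0 ∧ Pair K e (β s₁ s₂) a₁ ∧ Pair K e (β s₁ s₂) a₂) ∧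
      pa (β s₁ s₂) ∧ |c₁ ⬝ᵥ v (β s₁ s₂) / b ⬝ᵥ v (β s₁ s₂)| < ρ ∧
      |c₂ ⬝ᵥ v (β s₁ s₂) / b ⬝ᵥ v (β s₁ s₂)| < ρ := by
    intro s₁ s₂ h₁ h₂
    refine h (y := (s₁, s₂)) ?_
    rw [Prod.dist_eq, Real.dist_eq, Real.dist_eq]
    simpa using ⟨h₁.trans_le hrr₀, h₂.trans_le hrr₀⟩
  obtain ⟨x₁, hx₁⟩ : ∃ x₁ : ℝ → ℝ → ℝ, x₁ = fun s₁ s₂ =>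
    c₁ ⬝ᵥ v (β s₁ s₂) / b ⬝ᵥ v (β s₁ s₂) := ⟨_, rfl⟩
  obtain ⟨x₂, hx₂⟩ : ∃ x₂ : ℝ → ℝ → ℝ, x₂ = fun s₁ s₂ =>
    c₂ ⬝ᵥ v (β s₁ s₂) / b ⬝ᵥ v (β s₁ s₂) := ⟨_, rfl⟩
  have hβ0 : β 0 0 = b := by rw [hβ]; simp
  have hβ1 : ∀ t, β t 0 = b + t • g₁ := fun t => by rw [hβ]; simp
  have hβ2 : ∀ t, β 0 t = b + t • g₂ := fun t => by rw [hβ]; simp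
  have hx10 : x₁ 0 0 = 0 := by rw [hx₁]; simp only; rw [hβ0, ← hw, hc₁w, zero_div]
  have hx20 : x₂ 0 0 = 0 := by rw [hx₂]; simp only; rw [hβ0, ← hw, hc₂w, zero_div]
  have hV : ∀ s₁ s₂ : ℝ, |s₁| < r → |s₂| < r → v (β s₁ s₂) = (b ⬝ᵥ v (β s₁ s₂) / b ⬝ᵥ w) •
      (w + x₁ s₁ s₂ • d₁ + x₂ s₁ s₂ • d₂) := by
    intro s₁ s₂ h₁ h₂
    rw [hx₁, hx₂]
    exact hz _ (hN s₁ s₂ h₁ h₂).1.1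
  have hr0' : |(0 : ℝ)| < r := by simpa using hr0
  have hx2z : ∀ t, |t| < r → x₂ t 0 = 0 := by
    intro t ht
    have hp := (hN t 0 ht hr0').1.2.1
    have : a₁ ⬝ᵥ v (β t 0) = 0 := hp.symm.conj F (by
      rw [hβ1, add_dotProduct, smul_dotProduct, hbn₁, hg₁n]; simp)
    rw [hx₂]; simp only
    rw [hc₂, smul_dotProduct, this]; simp
  have hx1z : ∀ t, |t| < r → x₁ 0 t = 0 := by
    intro t ht
    have hp := (hN 0 t hr0' ht).1.2.2
    have : a₂ ⬝ᵥ v (β 0 t) = 0 := hp.symm.conj F (by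
      rw [hβ2, add_dotProduct, smul_dotProduct, hbn₂, hg₂n]; simp)
    rw [hx₁]; simp only
    rw [hc₁, smul_dotProduct, this]; simp
  have hψ₁ : StrictMonoOn (fun t => x₁ t 0) (Ioo (-r) r) := by
    have : (fun t => x₁ t 0) = fun t : ℝ => c₁ ⬝ᵥ v (b + t • g₁) / b ⬝ᵥ v (b + t • g₁) := by
      rw [hx₁]; simp only [hβ1]
    rw [this]
    exact hm₁.mono (Ioo_subset_Ioo (by linarith) hrr₁)
  have hψ₂ : StrictMonoOn (fun t => x₂ 0 t) (Ioo (-r) r) := by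
    have : (fun t => x₂ 0 t) = fun t : ℝ => c₂ ⬝ᵥ v (b + t • g₂) / b ⬝ᵥ v (b + t • g₂) := by
      rw [hx₂]; simp only [hβ2]
    rw [this]
    exact hm₂.mono (Ioo_subset_Ioo (by linarith) hrr₂)
  have sign : ∀ {ψ : ℝ → ℝ}, StrictMonoOn ψ (Ioo (-r) r) → ψ 0 = 0 → ∀ t, |t| < r →
      (0 < t → 0 < ψ t) ∧ (t < 0 → ψ t < 0) := by
    intro ψ hψ h0 t ht
    have m0 : (0 : ℝ) ∈ Ioo (-r) r := ⟨by linarith, hr0⟩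
    exact ⟨fun h => by have := hψ m0 (abs_lt.1 ht) h; rwa [h0] at this,
      fun h => by have := hψ (abs_lt.1 ht) m0 h; rwa [h0] at this⟩
  have hfe : ∀ s₁ s₂ t₁ t₂, |s₁| < r → |s₂| < r → |t₁| < r → |t₂| < r → t₁ * t₂ < 0 →
      s₁ / t₁ + s₂ / t₂ = 1 → x₁ s₁ s₂ / x₁ t₁ 0 + x₂ s₁ s₂ / x₂ 0 t₂ = 1 := by
    intro s₁ s₂ t₁ t₂ hs₁ hs₂ ht₁ ht₂ htt hst
    have hψψ : x₁ t₁ 0 * x₂ 0 t₂ < 0 := by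
      have q1 := sign hψ₁ hx10 t₁ ht₁
      have q2 := sign hψ₂ hx20 t₂ ht₂
      rcases mul_neg_iff.1 htt with ⟨u1, u2⟩ | ⟨u1, u2⟩
      · exact mul_neg_of_pos_of_neg (q1.1 u1) (q2.2 u2)
      · exact mul_neg_of_neg_of_pos (q1.2 u1) (q2.1 u2)
    have hb1 : |x₁ t₁ 0| < ρ := by rw [hx₁]; exact (hN t₁ 0 ht₁ hr0').2.2.1
    obtain ⟨ψ₁, hp₁⟩ : ∃ y, y = x₁ t₁ 0 := ⟨_, rfl⟩
    obtain ⟨ψ₂, hp₂⟩ : ∃ y, y = x₂ 0 t₂ := ⟨_, rfl⟩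
    have V1 := hV t₁ 0 ht₁ hr0'
    have V2 := hV 0 t₂ hr0' ht₂
    have V3 := hV s₁ s₂ hs₁ hs₂
    rw [hx2z t₁ ht₁] at V1
    rw [hx1z t₂ ht₂] at V2
    rw [← hp₁] at hψψ hb1 V1 ⊢
    rw [← hp₂] at hψψ V2 ⊢
    have hψ10 : ψ₁ ≠ 0 := by rintro rfl; simp at hψψ
    have hψ20 : ψ₂ ≠ 0 := by rintro rfl; simp at hψψ
    obtain ⟨D, hD⟩ : ∃ D, D = ψ₁ - ψ₂ := ⟨_, rfl⟩
    have hσ : D ≠ 0 ∧ 0 ≤ -ψ₂ / D ∧ 0 ≤ ψ₁ / D := by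
      rcases mul_neg_iff.1 hψψ with ⟨u1, u2⟩ | ⟨u1, u2⟩
      · have : 0 < D := by rw [hD]; linarith
        exact ⟨this.ne', div_nonneg (by linarith) this.le, div_nonneg u1.le this.le⟩
      · have : D < 0 := by rw [hD]; linarith
        exact ⟨this.ne, div_nonneg_of_nonpos (by linarith) this.le,
          div_nonneg_of_nonpos u1.le this.le⟩
    obtain ⟨hD0, hσ0, hσ1⟩ := hσ
    have hsum : ψ₁ / D = 1 - -ψ₂ / D := by field_simp; linarith
    have hσle : -ψ₂ / D ≤ 1 := by linarith
    obtain ⟨a, ha⟩ : ∃ a, a = (1 - -ψ₂ / D) • a₁ + (-ψ₂ / D) • a₂ + (ψ₁ * ψ₂ / D) • m := ⟨_, rfl⟩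
    have hμ : pb (ψ₁ * ψ₂ / D) := by
      apply hpb
      have : ψ₁ * ψ₂ / D = -(ψ₁ * (-ψ₂ / D)) := by ring
      rw [Real.dist_eq, sub_zero, this, abs_neg, abs_mul, abs_of_nonneg hσ0]
      nlinarith [abs_nonneg ψ₁]
    have hPa : ∀ s₁ s₂, |s₁| < r → |s₂| < r → Pair K e (β s₁ s₂) a := by
      intro s₁ s₂ h₁ h₂
      rw [ha]
      exact hpab (hN s₁ s₂ h₁ h₂).2.1 hμ _ ⟨hσ0, hσle⟩
    have hdot : ∀ y₁ y₂ : ℝ, a ⬝ᵥ (w + y₁ • d₁ + y₂ • d₂) =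
        δ / D * (ψ₁ * ψ₂ - ψ₂ * y₁ - ψ₁ * y₂) := by
      intro y₁ y₂
      rw [ha, ← hsum]
      simp only [add_dotProduct, smul_dotProduct, dotProduct_add, dotProduct_smul, smul_eq_mul,
        ha₁w, ha₂w, hmw, ha₁d₁, ha₂d₁, hmd₁, ha₁d₂, ha₂d₂, hmd₂]
      ring
    have z1 : a ⬝ᵥ v (β t₁ 0) = 0 := by
      rw [V1, dotProduct_smul, hdot, mul_comm ψ₂, sub_self, mul_zero, sub_zero, mul_zero, smul_zero]
    have z2 : a ⬝ᵥ v (β 0 t₂) = 0 := by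
      rw [V2, dotProduct_smul, hdot, mul_zero, sub_zero, sub_self, mul_zero, smul_zero]
    have y1 : β t₁ 0 ⬝ᵥ v a = 0 := (hPa _ _ ht₁ hr0').conj F z1
    have y2 : β 0 t₂ ⬝ᵥ v a = 0 := (hPa _ _ hr0' ht₂).conj F z2
    have y3 : β s₁ s₂ = (s₁ / t₁) • β t₁ 0 + (s₂ / t₂) • β 0 t₂ := by
      have ht10 : t₁ ≠ 0 := by rintro rfl; simp at htt
      have ht20 : t₂ ≠ 0 := by rintro rfl; simp at htt
      rw [hβ1, hβ2, hβ, smul_add, smul_add, smul_smul, smul_smul, div_mul_cancel₀ _ ht10,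
        div_mul_cancel₀ _ ht20]
      have : b = (s₁ / t₁) • b + (s₂ / t₂) • b := by rw [← add_smul, hst, one_smul]
      show b + s₁ • g₁ + s₂ • g₂ = _
      conv_lhs => rw [this]
      abel
    have y4 : β s₁ s₂ ⬝ᵥ v a = 0 := by
      rw [y3, add_dotProduct, smul_dotProduct, smul_dotProduct, y1, y2]; simp
    have y5 : a ⬝ᵥ v (β s₁ s₂) = 0 := (hPa _ _ hs₁ hs₂).symm.conj F y4
    rw [V3, dotProduct_smul, hdot, smul_eq_mul] at y5
    have y6 := (mul_eq_zero.1 ((mul_eq_zero.1 y5).resolve_left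
      (div_ne_zero (hN s₁ s₂ hs₁ hs₂).1.1 hbw))).resolve_left (div_ne_zero hδ0 hD0)
    field_simp
    linarith
  obtain ⟨A₁, A₂, p, q, r', hA₁, hA₂, hr', hAA⟩ := fe hr0 hψ₁ hψ₂ hx10 hx20 hx10 hx20 hfe
  obtain ⟨k₀, hk₀⟩ : ∃ k₀ : V3 → ℝ, k₀ = fun y => (g₁ ⨯₃ g₂) ⬝ᵥ y / (g₁ ⨯₃ g₂) ⬝ᵥ b := ⟨_, rfl⟩
  obtain ⟨k₁, hk₁⟩ : ∃ k₁ : V3 → ℝ, k₁ = fun y => (g₂ ⨯₃ b) ⬝ᵥ y / (g₁ ⨯₃ g₂) ⬝ᵥ b := ⟨_, rfl⟩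
  obtain ⟨k₂, hk₂⟩ : ∃ k₂ : V3 → ℝ, k₂ = fun y => (b ⨯₃ g₁) ⬝ᵥ y / (g₁ ⨯₃ g₂) ⬝ᵥ b := ⟨_, rfl⟩
  have hk : ∀ y, y = k₁ y • g₁ + k₂ y • g₂ + k₀ y • b := by
    intro y; rw [hk₀, hk₁, hk₂]; exact coord_decomp hD y
  let B : V3 →ₗ[ℝ] V3 :=
    { toFun := fun y => k₀ y • w + k₁ y • (p • w + A₁⁻¹ • d₁) + k₂ y • (q • w + A₂⁻¹ • d₂)
      map_add' := fun y z => by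
        simp only [hk₀, hk₁, hk₂, dotProduct_add, add_div, add_smul]; abel
      map_smul' := fun t y => by
        simp only [hk₀, hk₁, hk₂, dotProduct_smul, smul_eq_mul, mul_div_assoc, mul_smul, smul_add,
          RingHom.id_apply] }
  have hB : ∀ y, B y = (k₀ y + p * k₁ y + q * k₂ y) • w + (k₁ y * A₁⁻¹) • d₁ +
      (k₂ y * A₂⁻¹) • d₂ := by
    intro y
    show k₀ y • w + k₁ y • (p • w + A₁⁻¹ • d₁) + k₂ y • (q • w + A₂⁻¹ • d₂) = _
    module
  refine ⟨B, ?_, ?_⟩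
  · rw [injective_iff_map_eq_zero]
    intro y hy
    rw [hB] at hy
    have f1 := congrArg (fun z => a₁ ⬝ᵥ z) hy
    have f2 := congrArg (fun z => a₂ ⬝ᵥ z) hy
    simp only [dotProduct_add, dotProduct_smul, ha₁w, ha₁d₁, ha₁d₂, ha₂w, ha₂d₁, ha₂d₂,
      dotProduct_zero, smul_eq_mul, mul_zero, add_zero, zero_add] at f1 f2
    have g1 : k₁ y = 0 := by
      have := (mul_eq_zero.1 f2).resolve_right hδ0
      exact (mul_eq_zero.1 this).resolve_right (inv_ne_zero hA₁.ne')
    have g2 : k₂ y = 0 := by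
      have := (mul_eq_zero.1 f1).resolve_right (neg_ne_zero.2 hδ0)
      exact (mul_eq_zero.1 this).resolve_right (inv_ne_zero hA₂.ne')
    rw [g1, g2] at hy
    simp only [mul_zero, zero_mul, add_zero, zero_smul] at hy
    rw [hk y, g1, g2, (smul_eq_zero.1 hy).resolve_right hw0]
    simp
  · have hk0c : Continuous k₀ := by rw [hk₀]; exact (hlin _).div_const _
    have hk1c : Continuous k₁ := by rw [hk₁]; exact (hlin _).div_const _
    have hk2c : Continuous k₂ := by rw [hk₂]; exact (hlin _).div_const _
    have hb0 : k₀ b = 1 := by rw [hk₀]; exact div_self hD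
    have hb1 : k₁ b = 0 := by rw [hk₁]; simp only; rw [cross_dot_right, zero_div]
    have hb2 : k₂ b = 0 := by rw [hk₂]; simp only; rw [cross_dot_self, zero_div]
    have hq : ∀ {k : V3 → ℝ}, Continuous k → k b = 0 → ∀ᶠ g in 𝓝 b, |k g / k₀ g| < min r r' := by
      intro k hkc hkb
      have := ((hkc.tendsto b).div (hk0c.tendsto b) (by rw [hb0]; exact one_ne_zero)).abs
      rw [hkb, zero_div, abs_zero] at this
      exact this.eventually (gt_mem_nhds (lt_min hr0 hr'))
    have hk0 : ∀ᶠ g in 𝓝 b, k₀ g ≠ 0 :=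
      (hk0c.tendsto b).eventually_ne (by rw [hb0]; exact one_ne_zero)
    filter_upwards [hk0, hq hk1c hb1, hq hk2c hb2] with g hg0 hg1 hg2
    obtain ⟨s₁, hs₁⟩ : ∃ s, s = k₁ g / k₀ g := ⟨_, rfl⟩
    obtain ⟨s₂, hs₂⟩ : ∃ s, s = k₂ g / k₀ g := ⟨_, rfl⟩
    rw [← hs₁] at hg1
    rw [← hs₂] at hg2
    have l1 := hg1.trans_le (min_le_left _ _)
    have l2 := hg2.trans_le (min_le_left _ _)
    obtain ⟨m1, m2⟩ := hAA s₁ s₂ (hg1.trans_le (min_le_right _ _)) (hg2.trans_le (min_le_right _ _))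
    have k1 : k₁ g = k₀ g * s₁ := by rw [hs₁]; field_simp
    have k2 : k₂ g = k₀ g * s₂ := by rw [hs₂]; field_simp
    have hgβ : g = k₀ g • β s₁ s₂ := by
      conv_lhs => rw [hk g, k1, k2]
      rw [hβ]
      simp only
      module
    have hPβ := (hN s₁ s₂ l1 l2).1.2.1
    have hvg : v g = v (β s₁ s₂) := by
      conv_lhs => rw [hgβ]
      exact F.smul_eq hPβ.ne_left hPβ.good_left hg0
    have hBg : B g = (k₀ g * (1 + p * s₁ + q * s₂)) • (w + x₁ s₁ s₂ • d₁ + x₂ s₁ s₂ • d₂) := by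
      have i1 : s₁ * A₁⁻¹ = x₁ s₁ s₂ * (1 + p * s₁ + q * s₂) := by
        rw [← div_eq_mul_inv, div_eq_iff hA₁.ne']; linarith
      have i2 : s₂ * A₂⁻¹ = x₂ s₁ s₂ * (1 + p * s₁ + q * s₂) := by
        rw [← div_eq_mul_inv, div_eq_iff hA₂.ne']; linarith
      rw [hB, k1, k2, mul_assoc, mul_assoc (k₀ g) s₂, i1, i2]
      module
    rw [hvg, hV s₁ s₂ l1 l2, hBg, map_smul, map_smul, LinearMap.smul_apply, cross_self]
    simp

end

section

variable {K : Set V3} {e : V3} {v : V3 → V3}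

/-- A locally constant choice on a preconnected set can be made globally. -/
lemma glue {X β : Type*} [TopologicalSpace X] {S : Set X} (hS : IsPreconnected S) (hne : S.Nonempty)
    (R : X → β → Prop) (h1 : ∀ x ∈ S, ∃ B, R x B)
    (h2 : ∀ x ∈ S, ∀ B, R x B → ∀ᶠ y in 𝓝 x, y ∈ S → R y B)
    (h3 : ∀ x ∈ S, ∀ B B', R x B → R x B' → ∀ y ∈ S, R y B → R y B') : ∃ B, ∀ x ∈ S, R x B := by
  obtain ⟨x₀, hx₀⟩ := hne
  obtain ⟨B₀, hB₀⟩ := h1 x₀ hx₀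
  refine ⟨B₀, fun x hx => ?_⟩
  by_contra hxB
  have hU : IsOpen {x | ∀ᶠ y in 𝓝 x, y ∈ S → R y B₀} := isOpen_setOfPred_eventually_nhds
  have hV : IsOpen {x | ∀ᶠ y in 𝓝 x, y ∈ S → ¬ R y B₀} := isOpen_setOfPred_eventually_nhds
  have hneg : ∀ x ∈ S, ¬ R x B₀ → ∀ᶠ y in 𝓝 x, y ∈ S → ¬ R y B₀ := by
    intro x hx hxB
    obtain ⟨B, hB⟩ := h1 x hx
    filter_upwards [h2 x hx B hB] with y hy hyS hyB
    exact hxB (h3 y hyS B B₀ (hy hyS) hyB x hx hB)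
  obtain ⟨y, hyS, hyU, hyV⟩ := hS _ _ hU hV (fun x hx => by
    by_cases h : R x B₀
    · exact Or.inl (h2 x hx B₀ h)
    · exact Or.inr (hneg x hx h)) ⟨x₀, hx₀, h2 x₀ hx₀ B₀ hB₀⟩ ⟨x, hx, hneg x hx hxB⟩
  exact (hyV.self_of_nhds hyS) (hyU.self_of_nhds hyS)

/-- Near `g`, on the side `0 < g' ⬝ᵥ e`, the centres are in direction `B g'`. -/
def Germ (e : V3) (v : V3 → V3) (g : V3) (B : V3 →ₗ[ℝ] V3) : Prop :=
  Function.Injective B ∧ ∀ᶠ g' in 𝓝 g, 0 < g' ⬝ᵥ e → v g' ⨯₃ B g' = 0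

lemma lin_continuous (B : V3 →ₗ[ℝ] V3) : Continuous B := B.continuous_of_finiteDimensional

lemma tendsto_add_smul (x y : V3) : Tendsto (fun s : ℝ => x + s • y) (𝓝 0) (𝓝 x) := by
  have : ContinuousAt (fun s : ℝ => x + s • y) 0 := by fun_prop
  simpa [ContinuousAt] using this

lemma FC.germ_unique (F : FC K e v) {g : V3} (hg : 0 ≤ g ⬝ᵥ e) {B B' : V3 →ₗ[ℝ] V3}
    (h : Germ e v g B) (h' : Germ e v g B') (x : V3) : B x ⨯₃ B' x = 0 := by
  have hee := dot_self_pos F.ne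
  obtain ⟨s, hs, hs0⟩ := (((tendsto_add_smul g e).eventually
    (h.2.and h'.2).eventually_nhds).filter_mono (nhdsWithin_le_nhds (s := Ioi 0))).and
    self_mem_nhdsWithin |>.exists
  obtain ⟨g₁, hg₁⟩ : ∃ g₁, g₁ = g + s • e := ⟨_, rfl⟩
  rw [← hg₁] at hs
  have hg₁e : 0 < g₁ ⬝ᵥ e := by
    rw [hg₁, add_dotProduct, smul_dotProduct, smul_eq_mul]
    have := mul_pos (show 0 < s from hs0) hee
    linarith
  have hc : Continuous fun y : V3 => y ⬝ᵥ e := by fun_prop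
  have hpar : ∀ᶠ y in 𝓝 g₁, B y ⨯₃ B' y = 0 := by
    filter_upwards [hs, (hc.tendsto g₁).eventually (lt_mem_nhds hg₁e)] with y hy hye
    have hv0 := F.v_ne_zero hye.ne'
    obtain ⟨t, ht⟩ := exists_smul_of_cross (hy.1 hye) hv0
    obtain ⟨t', ht'⟩ := exists_smul_of_cross (hy.2 hye) hv0
    rw [ht, ht']; simp
  obtain ⟨δ, hδ, hδp⟩ := Metric.eventually_nhds_iff.1 ((tendsto_add_smul g₁ x).eventually hpar)
  have p0 := hδp (y := 0) (by simpa using hδ)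
  have p1 := hδp (y := δ / 2) (by rw [Real.dist_eq, sub_zero, abs_of_pos (by positivity)]; linarith)
  have p2 := hδp (y := -(δ / 2)) (by
    rw [Real.dist_eq, sub_zero, abs_neg, abs_of_pos (by positivity)]; linarith)
  rw [zero_smul, add_zero] at p0
  simp only [map_add, map_smul, LinearMap.add_apply, LinearMap.smul_apply] at p1 p2
  have key : (2 * (δ / 2) ^ 2) • (B x ⨯₃ B' x) = 0 := by
    have : (2 * (δ / 2) ^ 2) • (B x ⨯₃ B' x) = ((B g₁ ⨯₃ B' g₁ + (δ / 2) • (B x ⨯₃ B' g₁)) +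
        (δ / 2) • (B g₁ ⨯₃ B' x + (δ / 2) • (B x ⨯₃ B' x))) +
        ((B g₁ ⨯₃ B' g₁ + (-(δ / 2)) • (B x ⨯₃ B' g₁)) +
        (-(δ / 2)) • (B g₁ ⨯₃ B' x + (-(δ / 2)) • (B x ⨯₃ B' x))) -
        (2 : ℝ) • (B g₁ ⨯₃ B' g₁) := by module
    rw [this]
    rw [p1, p2, p0]; simp
  exact (smul_eq_zero.1 key).resolve_left (by positivity)

lemma FC.germ_transfer (F : FC K e v) {g : V3} (hg : 0 ≤ g ⬝ᵥ e) {B B' : V3 →ₗ[ℝ] V3}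
    (h : Germ e v g B) (h' : Germ e v g B') {x : V3} (hx : Germ e v x B) : Germ e v x B' := by
  refine ⟨h'.1, ?_⟩
  filter_upwards [hx.2] with y hy hye
  have hy0 : B y ≠ 0 := by
    intro h0
    have : y = 0 := h.1 (by rw [h0, map_zero])
    rw [this] at hye; simp at hye
  obtain ⟨t, ht⟩ := exists_smul_of_cross (F.germ_unique hg h h' y) hy0
  rw [ht, map_smul, hy hye, smul_zero]

lemma Germ.eventually {g : V3} {B : V3 →ₗ[ℝ] V3} (h : Germ e v g B) :
    ∀ᶠ x in 𝓝 g, Germ e v x B :=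
  h.2.eventually_nhds.mono fun _ hx => ⟨h.1, hx⟩

lemma FC.exists_germ_at (F : FC K e v) {n : V3} (hn : n ≠ 0) (hne : n ⬝ᵥ e = 0) :
    ∃ B, Germ e v n B := by
  have hgood := F.good_of_orth hne
  have hv : ∀ᶠ g in 𝓝 n, v g ≠ e := by
    have := F.continuousAt hn hgood
    exact this.tendsto.eventually_ne (by rw [F.v_eq_zero hn hne]; exact F.ne.symm)
  obtain ⟨r, hr, h⟩ := Metric.eventually_nhds_iff_ball.1 ((Good.eventually hn hgood).and hv)
  have hconv : Convex ℝ (Metric.ball n r ∩ {g : V3 | 0 < g ⬝ᵥ e}) := by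
    refine (convex_ball n r).inter ?_
    intro x hx y hy a b ha hb hab
    have hx' : 0 < x ⬝ᵥ e := hx
    have hy' : 0 < y ⬝ᵥ e := hy
    show 0 < (a • x + b • y) ⬝ᵥ e
    rw [add_dotProduct, smul_dotProduct, smul_dotProduct, smul_eq_mul, smul_eq_mul]
    rcases ha.eq_or_lt with rfl | ha
    · have : b = 1 := by linarith
      rw [this]; linarith
    · have := mul_pos ha hx'
      have := mul_nonneg hb hy'.le
      linarith
  have hne' : (Metric.ball n r ∩ {g : V3 | 0 < g ⬝ᵥ e}).Nonempty := by
    obtain ⟨s, hs, hs0⟩ := (((tendsto_add_smul n e).eventually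
      (Metric.ball_mem_nhds n hr)).filter_mono (nhdsWithin_le_nhds (s := Ioi 0))).and
      self_mem_nhdsWithin |>.exists
    refine ⟨_, hs, ?_⟩
    show 0 < (n + s • e) ⬝ᵥ e
    rw [add_dotProduct, smul_dotProduct, hne, zero_add]
    exact mul_pos hs0 (dot_self_pos F.ne)
  obtain ⟨B, hB⟩ := glue hconv.isPreconnected hne' (Germ e v) (by
      rintro x ⟨hx, hx'⟩
      have hxe : 0 < x ⬝ᵥ e := hx'
      obtain ⟨B, hB, hB'⟩ := F.patch (h x hx).1 hxe.ne' (h x hx).2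
      exact ⟨B, hB, hB'.mono fun y hy _ => hy⟩)
    (fun x _ B hB => hB.eventually.mono fun y hy _ => hy)
    (fun x hx B B' hB hB' y _ hy => F.germ_transfer (le_of_lt hx.2) hB hB' hy)
  refine ⟨B, (hB _ hne'.some_mem).1, ?_⟩
  filter_upwards [Metric.ball_mem_nhds n hr] with g hg hge
  exact (hB g ⟨hg, hge⟩).2.self_of_nhds hge

lemma orth_preconnected (he : e ≠ 0) : IsPreconnected {n : V3 | n ≠ 0 ∧ n ⬝ᵥ e = 0} := by
  obtain ⟨η₁, η₂, h1, h2, h12⟩ := exists_orth_pair he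
  have hD : (η₁ ⨯₃ η₂) ⬝ᵥ e ≠ 0 := by
    rw [dotProduct_comm] at h1 h2
    obtain ⟨t, ht⟩ := exists_smul_cross h12 h1 h2
    intro h
    have := dot_self_pos he
    conv at this => rw [ht, smul_dotProduct, ← ht, h]
    simp at this
  have hc : IsPreconnected ({0}ᶜ : Set ℂ) :=
    (isConnected_compl_singleton_of_one_lt_rank (by rw [Complex.rank_real_complex]; norm_num)
      0).isPreconnected
  have him := hc.image (fun z : ℂ => z.re • η₁ + z.im • η₂) (by fun_prop)
  convert him using 1
  ext n
  constructor
  · rintro ⟨hn, hne⟩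
    have hd := coord_decomp hD n
    have h3 : (η₁ ⨯₃ η₂) ⬝ᵥ n = 0 := by
      rw [dotProduct_comm] at h1 h2
      obtain ⟨t, ht⟩ := exists_smul_cross h12 h1 h2
      have ht0 : t ≠ 0 := by rintro rfl; rw [zero_smul] at ht; exact he ht
      rw [ht, dotProduct_smul, smul_eq_mul] at hne
      rw [dotProduct_comm]
      exact (mul_eq_zero.1 hne).resolve_left ht0
    rw [h3, zero_div, zero_smul, add_zero] at hd
    refine ⟨⟨_, _⟩, ?_, hd.symm⟩
    rintro hz
    rw [mem_singleton_iff, Complex.ext_iff] at hz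
    simp only [Complex.zero_re, Complex.zero_im] at hz
    rw [hz.1, hz.2] at hd
    exact hn (by simpa using hd)
  · rintro ⟨z, hz, rfl⟩
    constructor
    · intro h0
      apply hz
      have i1 := congrArg (fun y => (η₁ ⨯₃ y) ⬝ᵥ e) h0
      have i2 := congrArg (fun y => (y ⨯₃ η₂) ⬝ᵥ e) h0
      simp only [map_add, map_smul, cross_self, smul_zero, zero_add, smul_dotProduct,
        LinearMap.add_apply, LinearMap.smul_apply, add_zero, map_zero, zero_dotProduct,
        LinearMap.zero_apply, smul_eq_mul] at i1 i2
      rw [mem_singleton_iff, Complex.ext_iff]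
      exact ⟨(mul_eq_zero.1 i2).resolve_right hD, (mul_eq_zero.1 i1).resolve_right hD⟩
    · rw [dotProduct_comm, dotProduct_add, dotProduct_smul, dotProduct_smul, h1, h2]; simp

lemma FC.exists_germ (F : FC K e v) :
    ∃ B, ∀ n : V3, n ≠ 0 → n ⬝ᵥ e = 0 → Germ e v n B := by
  obtain ⟨k, hk, hke⟩ := exists_orth F.ne
  obtain ⟨B, hB⟩ := glue (orth_preconnected F.ne) ⟨k, hk, hke⟩ (Germ e v)
    (fun x hx => F.exists_germ_at hx.1 hx.2)
    (fun x _ B hB => hB.eventually.mono fun y hy _ => hy)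
    (fun x hx B B' hB hB' y _ hy => F.germ_transfer hx.2.ge hB hB' hy)
  exact ⟨B, fun n hn hne => hB n ⟨hn, hne⟩⟩

end

section

variable {K : Set V3} {e : V3} {v : V3 → V3}

lemma FC.germ_ne (F : FC K e v) {B : V3 →ₗ[ℝ] V3} {n : V3} (hn : n ≠ 0) (hne : n ⬝ᵥ e = 0)
    (hB : Germ e v n B) : n ⬝ᵥ B n ≠ 0 := by
  intro h0
  have hee := dot_self_pos F.ne
  have hBn : B n ≠ 0 := fun h => hn (hB.1 (by rw [h, map_zero]))
  have hBc := lin_continuous B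
  have hg := tendsto_add_smul n e
  obtain ⟨C, hC⟩ : ∃ C : ℝ → ℝ, C = fun s => n ⬝ᵥ B e + e ⬝ᵥ B n + s * e ⬝ᵥ B e := ⟨_, rfl⟩
  have hCt : Continuous C := by rw [hC]; fun_prop
  have hvt : Tendsto (fun s : ℝ => C s • v (n + s • e)) (𝓝 0) (𝓝 0) := by
    have h1 := (F.continuousAt hn (F.good_of_orth hne)).tendsto.comp hg
    rw [F.v_eq_zero hn hne] at h1
    have := (hCt.tendsto 0).smul h1
    rw [smul_zero] at this
    exact this
  have hBt : Tendsto (fun s : ℝ => (e ⬝ᵥ e) • B (n + s • e)) (𝓝 0) (𝓝 ((e ⬝ᵥ e) • B n)) :=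
    ((hBc.tendsto n).comp hg).const_smul _
  have heq : ∀ᶠ s in 𝓝[>] (0 : ℝ), C s • v (n + s • e) = (e ⬝ᵥ e) • B (n + s • e) := by
    filter_upwards [(hg.eventually hB.2).filter_mono nhdsWithin_le_nhds, self_mem_nhdsWithin]
      with s hs hs0
    have hs0 : 0 < s := hs0
    have hge : (n + s • e) ⬝ᵥ e = s * e ⬝ᵥ e := by
      rw [add_dotProduct, hne, zero_add, smul_dotProduct, smul_eq_mul]
    have hge0 : 0 < (n + s • e) ⬝ᵥ e := by rw [hge]; positivity
    obtain ⟨t, ht⟩ := exists_smul_of_cross (hs hge0) (F.v_ne_zero hge0.ne')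
    have h1 : (n + s • e) ⬝ᵥ B (n + s • e) = t * (s * e ⬝ᵥ e) := by
      rw [ht, dotProduct_smul, F.dot _ (by intro h; rw [h] at hge0; simp at hge0), hge, smul_eq_mul]
    have h2 : (n + s • e) ⬝ᵥ B (n + s • e) = s * C s := by
      rw [hC, map_add, map_smul]
      simp only [add_dotProduct, dotProduct_add, smul_dotProduct, dotProduct_smul, smul_eq_mul, h0]
      ring
    have h3 : C s = t * e ⬝ᵥ e := by
      have : s * C s = s * (t * e ⬝ᵥ e) := by rw [← h2, h1]; ring
      exact mul_left_cancel₀ hs0.ne' this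
    rw [h3, ht, smul_smul, mul_comm]
  have := tendsto_nhds_unique ((hvt.mono_left nhdsWithin_le_nhds).congr' heq)
    (hBt.mono_left (nhdsWithin_le_nhds (s := Ioi 0)))
  exact smul_ne_zero hee.ne' hBn this.symm

lemma Germ.dot_zero (F : FC K e v) {B : V3 →ₗ[ℝ] V3} {g b : V3} (hb : b ⬝ᵥ e ≠ 0)
    (h : 0 < b ⬝ᵥ e → v b ⨯₃ B b = 0) (hg : g ⬝ᵥ v b = 0) (hpos : 0 < b ⬝ᵥ e) : g ⬝ᵥ B b = 0 := by
  obtain ⟨t, ht⟩ := exists_smul_of_cross (h hpos) (F.v_ne_zero hb)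
  rw [ht, dotProduct_smul, hg, smul_zero]

lemma FC.germ_symm (F : FC K e v) {B : V3 →ₗ[ℝ] V3}
    (hB : ∀ n : V3, n ≠ 0 → n ⬝ᵥ e = 0 → Germ e v n B) (x y : V3) : x ⬝ᵥ B y = y ⬝ᵥ B x := by
  obtain ⟨n, hn, hne⟩ := exists_orth F.ne
  have hnn := dot_self_pos hn
  have hee := dot_self_pos F.ne
  have hBc := lin_continuous B
  have hnB := F.germ_ne hn hne (hB n hn hne)
  obtain ⟨x₀, hx₀⟩ : ∃ x₀, x₀ = (n ⬝ᵥ n)⁻¹ • (n ⨯₃ e) := ⟨_, rfl⟩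
  have hx₀n : x₀ ⨯₃ n = e := by
    rw [hx₀, map_smul, LinearMap.smul_apply, cross_smul_sub, dotProduct_comm e, hne, zero_smul,
      sub_zero, smul_smul, inv_mul_cancel₀ hnn.ne', one_smul]
  obtain ⟨n', hn'⟩ : ∃ n', n' = e ⨯₃ B n := ⟨_, rfl⟩
  have hn'e : n' ⬝ᵥ e = 0 := by rw [hn']; exact cross_dot_self _ _
  have hn'0 : n' ≠ 0 := by
    intro h
    rw [hn'] at h
    obtain ⟨t, ht⟩ := exists_smul_of_cross h F.ne
    rw [ht, dotProduct_smul, hne] at hnB; simp at hnB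
  -- all the conditions needed near `(x₀, n)`
  have hcb : Continuous fun q : V3 × V3 => (q.1 ⨯₃ q.2) ⨯₃ B q.2 := by fun_prop
  have ht : Tendsto (fun q : V3 × V3 => (q.1 ⨯₃ q.2) ⨯₃ B q.2) (𝓝 (x₀, n)) (𝓝 n') := by
    have := hcb.tendsto (x₀, n)
    simp only [hx₀n, ← hn'] at this
    exact this
  have ht2 : Tendsto (fun q : V3 × V3 => -((q.1 ⨯₃ q.2) ⨯₃ B q.2)) (𝓝 (x₀, n)) (𝓝 (-n')) := ht.neg
  have hci : ∀ᶠ q in 𝓝 ((x₀, n) : V3 × V3), -e + (1 : ℝ) • (q.1 ⨯₃ q.2) ∈ interior K := by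
    have hc : Continuous fun q : V3 × V3 => -e + (1 : ℝ) • (q.1 ⨯₃ q.2) := by fun_prop
    refine (hc.tendsto (x₀, n)).eventually (isOpen_interior.mem_nhds ?_)
    simp only [hx₀n, one_smul, neg_add_cancel]
    exact F.zero_int
  have ht3 : Tendsto (fun q : V3 × V3 => q.2) (𝓝 (x₀, n)) (𝓝 n) := continuous_snd.tendsto _
  have hall : ∀ᶠ q in 𝓝 ((x₀, n) : V3 × V3), 0 < q.2 ⬝ᵥ e → (q.1 ⨯₃ q.2) ⨯₃ (e - v q.2) ≠ 0 →
      q.2 ⬝ᵥ B ((q.1 ⨯₃ q.2) ⨯₃ B q.2) = 0 := by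
    filter_upwards [hci, ht.eventually (hB n' hn'0 hn'e).2,
      ht2.eventually (hB (-n') (neg_ne_zero.2 hn'0) (by rw [neg_dotProduct, hn'e, neg_zero])).2,
      ht3.eventually (hB n hn hne).2] with q q1 q2 q3 q4 hge hde
    have hP := pair_of_dir F hge.ne' (cross_dot_right q.1 q.2) hde q1
    have hg0 : q.2 ≠ 0 := by rintro h; rw [h] at hge; simp at hge
    obtain ⟨μ, hμ⟩ := exists_smul_of_cross (q4 hge) (F.v_ne_zero hge.ne')
    have hμ0 : μ ≠ 0 := by
      rintro rfl
      rw [zero_smul] at hμ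
      exact hg0 ((hB n hn hne).1 (by rw [hμ, map_zero]))
    obtain ⟨b, hb⟩ : ∃ b, b = (q.1 ⨯₃ q.2) ⨯₃ B q.2 := ⟨_, rfl⟩
    have hb' : b = μ • ((q.1 ⨯₃ q.2) ⨯₃ v q.2) := by rw [hb, hμ, map_smul]
    rw [← hb] at q2 q3 ⊢
    have hvb : v b = v ((q.1 ⨯₃ q.2) ⨯₃ v q.2) := by
      rw [hb']; exact F.smul_eq hP.symm.ne_left hP.symm.good_left hμ0
    have hbe : b ⬝ᵥ e ≠ 0 := by
      rw [hb', smul_dotProduct]; exact mul_ne_zero hμ0 hP.2.2.1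
    have hgb : q.2 ⬝ᵥ v b = 0 := by rw [hvb]; exact hP.conj F (cross_dot_right _ _)
    rcases lt_or_gt_of_ne hbe with h | h
    · have hb0 : b ≠ 0 := by rintro h; rw [h] at hbe; simp at hbe
      have hgoodb : Good K e b := by rw [hb']; exact hP.symm.good_left.smul μ
      have hneg : v (-b) = v b := by
        have := F.smul_eq hb0 hgoodb (t := -1) (by norm_num)
        rwa [neg_one_smul] at this
      have hbe' : 0 < (-b) ⬝ᵥ e := by rw [neg_dotProduct]; linarith
      have := Germ.dot_zero F hbe'.ne' q3 (g := q.2) (by rw [hneg]; exact hgb) hbe'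
      rw [map_neg, dotProduct_neg, neg_eq_zero] at this
      exact this
    · exact Germ.dot_zero F hbe q2 hgb h
  -- the exceptional directions are removed by linearity
  rw [nhds_prod_eq] at hall
  obtain ⟨pa, hpa, pb, hpb, hpab⟩ := eventually_prod_iff.1 hall
  have hv : ∀ᶠ g in 𝓝 n, v g ≠ e :=
    (F.continuousAt hn (F.good_of_orth hne)).tendsto.eventually_ne
      (by rw [F.v_eq_zero hn hne]; exact F.ne.symm)
  have hBe : ∀ᶠ g in 𝓝 n, g ⬝ᵥ B g ≠ 0 := by
    have hc : Continuous fun g : V3 => g ⬝ᵥ B g := by fun_prop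
    exact (hc.tendsto n).eventually_ne hnB
  have hsym : ∀ᶠ g in 𝓝 n, 0 < g ⬝ᵥ e → ∀ y, y ⬝ᵥ B g = g ⬝ᵥ B y := by
    filter_upwards [hpb, hv, hBe] with g hg hvg hBg hge y
    have hg0 : g ≠ 0 := by rintro rfl; simp at hge
    obtain ⟨ε, hε⟩ : ∃ ε, ε = e - v g := ⟨_, rfl⟩
    have hε0 : ε ≠ 0 := by rw [hε]; exact sub_ne_zero.2 hvg.symm
    have hgε : g ⬝ᵥ ε = 0 := by rw [hε, dotProduct_sub, F.dot g hg0, sub_self]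
    have hnear : ∀ᶠ x in 𝓝 x₀, (x ⨯₃ g) ⨯₃ ε ≠ 0 → g ⬝ᵥ B ((x ⨯₃ g) ⨯₃ B g) = 0 := by
      filter_upwards [hpa] with x hx
      rw [hε]
      exact hpab hx hg hge
    have hgen : ∀ z, (z ⨯₃ g) ⨯₃ ε ≠ 0 → g ⬝ᵥ B ((z ⨯₃ g) ⨯₃ B g) = 0 := by
      intro z hz
      obtain ⟨δ, hδ, hδp⟩ := Metric.eventually_nhds_iff.1
        ((tendsto_add_smul x₀ z).eventually hnear)
      have hexp : ∀ t : ℝ, ((x₀ + t • z) ⨯₃ g) ⨯₃ ε = (x₀ ⨯₃ g) ⨯₃ ε + t • ((z ⨯₃ g) ⨯₃ ε) := by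
        intro t; simp only [map_add, map_smul, LinearMap.add_apply, LinearMap.smul_apply]
      have hval : ∀ t : ℝ, g ⬝ᵥ B (((x₀ + t • z) ⨯₃ g) ⨯₃ B g) =
          g ⬝ᵥ B ((x₀ ⨯₃ g) ⨯₃ B g) + t * g ⬝ᵥ B ((z ⨯₃ g) ⨯₃ B g) := by
        intro t
        simp only [map_add, map_smul, LinearMap.add_apply, LinearMap.smul_apply, dotProduct_add,
          dotProduct_smul, smul_eq_mul]
      by_cases hbad : ∃ t₀ : ℝ, (x₀ ⨯₃ g) ⨯₃ ε + t₀ • ((z ⨯₃ g) ⨯₃ ε) = 0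
      · obtain ⟨t₀, ht₀⟩ := hbad
        have hok : ∀ t : ℝ, |t| < δ → t ≠ t₀ → g ⬝ᵥ B ((x₀ ⨯₃ g) ⨯₃ B g) +
            t * g ⬝ᵥ B ((z ⨯₃ g) ⨯₃ B g) = 0 := by
          intro t ht htt
          rw [← hval]
          refine hδp (by rwa [Real.dist_eq, sub_zero]) ?_
          rw [hexp]
          intro h
          have : (t - t₀) • ((z ⨯₃ g) ⨯₃ ε) = 0 := by
            rw [sub_smul, sub_eq_zero]
            exact add_left_cancel (h.trans ht₀.symm)
          rcases smul_eq_zero.1 this with h | h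
          · exact htt (by linarith)
          · exact hz h
        by_contra hne0
        obtain ⟨t₁, t₂, a1, a2, a3, a4, a5⟩ : ∃ t₁ t₂ : ℝ, |t₁| < δ ∧ |t₂| < δ ∧ t₁ ≠ t₂ ∧
            t₁ ≠ t₀ ∧ t₂ ≠ t₀ := by
          rcases lt_or_ge 0 t₀ with h | h
          · refine ⟨0, -(δ / 2), by simpa using hδ, ?_, by linarith, by linarith, by linarith⟩
            rw [abs_neg, abs_of_pos (by positivity)]; linarith
          · refine ⟨δ / 3, δ / 2, ?_, ?_, by linarith, by linarith, by linarith⟩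
            · rw [abs_of_pos (by positivity)]; linarith
            · rw [abs_of_pos (by positivity)]; linarith
        have b1 := hok t₁ a1 a4
        have b2 := hok t₂ a2 a5
        have : (t₁ - t₂) * g ⬝ᵥ B ((z ⨯₃ g) ⨯₃ B g) = 0 := by linarith
        exact (mul_ne_zero (sub_ne_zero.2 a3) hne0) this
      · push Not at hbad
        have b1 : g ⬝ᵥ B ((x₀ ⨯₃ g) ⨯₃ B g) + 0 * g ⬝ᵥ B ((z ⨯₃ g) ⨯₃ B g) = 0 := by
          rw [← hval]
          exact hδp (by simpa using hδ) (by rw [hexp]; exact hbad 0)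
        have b2 : g ⬝ᵥ B ((x₀ ⨯₃ g) ⨯₃ B g) + (δ / 2) * g ⬝ᵥ B ((z ⨯₃ g) ⨯₃ B g) = 0 := by
          rw [← hval]
          exact hδp (by rw [Real.dist_eq, sub_zero, abs_of_pos (by positivity)]; linarith)
            (by rw [hexp]; exact hbad _)
        have : (δ / 2) * g ⬝ᵥ B ((z ⨯₃ g) ⨯₃ B g) = 0 := by linarith
        exact (mul_eq_zero.1 this).resolve_left (by positivity)
    obtain ⟨z₀, hz₀⟩ : ∃ z₀ : V3, (z₀ ⨯₃ g) ⨯₃ ε ≠ 0 := by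
      refine ⟨ε, ?_⟩
      rw [cross_smul_sub, hgε, zero_smul, sub_zero]
      exact smul_ne_zero (dot_self_pos hε0).ne' hg0
    have hzero : g ⬝ᵥ B ((y ⨯₃ g) ⨯₃ B g) = 0 := by
      by_cases hy : (y ⨯₃ g) ⨯₃ ε = 0
      · have b1 := hgen z₀ hz₀
        have b2 := hgen (z₀ + y) (by
          simp only [map_add, LinearMap.add_apply]; rw [hy, add_zero]; exact hz₀)
        simp only [map_add, LinearMap.add_apply, dotProduct_add] at b2
        linarith
      · exact hgen y hy
    rw [cross_smul_sub, map_sub, map_smul, map_smul, dotProduct_sub, dotProduct_smul,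
      dotProduct_smul, smul_eq_mul, smul_eq_mul] at hzero
    have : (g ⬝ᵥ B g) * (y ⬝ᵥ B g - g ⬝ᵥ B y) = 0 := by linarith
    have := (mul_eq_zero.1 this).resolve_left hBg
    linarith
  obtain ⟨s, hs, hs0⟩ := (((tendsto_add_smul n e).eventually
    hsym.eventually_nhds).filter_mono (nhdsWithin_le_nhds (s := Ioi 0))).and
    self_mem_nhdsWithin |>.exists
  obtain ⟨g₁, hg₁⟩ : ∃ g₁, g₁ = n + s • e := ⟨_, rfl⟩
  rw [← hg₁] at hs
  have hg₁e : 0 < g₁ ⬝ᵥ e := by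
    rw [hg₁, add_dotProduct, smul_dotProduct, smul_eq_mul, hne, zero_add]
    exact mul_pos hs0 hee
  have hc : Continuous fun y : V3 => y ⬝ᵥ e := by fun_prop
  have hs' : ∀ᶠ g in 𝓝 g₁, ∀ y, y ⬝ᵥ B g = g ⬝ᵥ B y := by
    filter_upwards [hs, (hc.tendsto g₁).eventually (lt_mem_nhds hg₁e)] with g h1 h2
    exact h1 h2
  obtain ⟨δ, hδ, hδp⟩ := Metric.eventually_nhds_iff.1 ((tendsto_add_smul g₁ x).eventually hs')
  have b1 := hδp (y := 0) (by simpa using hδ) y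
  have b2 := hδp (y := δ / 2) (by
    rw [Real.dist_eq, sub_zero, abs_of_pos (by positivity)]; linarith) y
  rw [zero_smul, add_zero] at b1
  rw [map_add, map_smul, dotProduct_add, dotProduct_smul, add_dotProduct, smul_dotProduct, b1,
    smul_eq_mul, smul_eq_mul] at b2
  exact (mul_left_cancel₀ (by positivity : δ / 2 ≠ 0) (add_left_cancel b2)).symm

end

section

variable {K : Set V3} {e : V3} {v : V3 → V3}

lemma FC.exists_definite (F : FC K e v) : ∃ B : V3 →ₗ[ℝ] V3,
    (∀ n : V3, n ≠ 0 → n ⬝ᵥ e = 0 → Germ e v n B ∧ 0 < n ⬝ᵥ B n) ∧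
    ∀ x y, x ⬝ᵥ B y = y ⬝ᵥ B x := by
  obtain ⟨B, hB⟩ := F.exists_germ
  have hs := F.germ_symm hB
  have hne : ∀ n : V3, n ≠ 0 → n ⬝ᵥ e = 0 → n ⬝ᵥ B n ≠ 0 :=
    fun n hn hne => F.germ_ne hn hne (hB n hn hne)
  have hBc := lin_continuous B
  have him := ((orth_preconnected F.ne).image (fun n => n ⬝ᵥ B n) (by fun_prop)).ordConnected
  by_cases hpos : ∀ n : V3, n ≠ 0 → n ⬝ᵥ e = 0 → 0 < n ⬝ᵥ B n
  · exact ⟨B, fun n hn h => ⟨hB n hn h, hpos n hn h⟩, hs⟩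
  · push Not at hpos
    obtain ⟨m, hm, hme, hmB⟩ := hpos
    refine ⟨-B, fun n hn h => ⟨⟨neg_injective.comp (hB n hn h).1, ?_⟩, ?_⟩, fun x y => ?_⟩
    · filter_upwards [(hB n hn h).2] with g hg hge
      rw [LinearMap.neg_apply, map_neg, hg hge, neg_zero]
    · rw [LinearMap.neg_apply, dotProduct_neg]
      by_contra hcon
      obtain ⟨k, hk, hk'⟩ := him.out ⟨m, ⟨hm, hme⟩, rfl⟩ ⟨n, ⟨hn, h⟩, rfl⟩
        (show (0 : ℝ) ∈ _ from ⟨hmB, by simp only; linarith⟩)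
      exact hne k hk.1 hk.2 hk'
    · rw [LinearMap.neg_apply, LinearMap.neg_apply, dotProduct_neg, dotProduct_neg, hs]

/-- In suitable coordinates the centres of the steep sections are those of a quadric. -/
lemma FC.normal_form (F : FC K e v) : ∃ (h₁ h₂ h₃ : V3) (σ π : ℝ), (σ = 1 ∨ σ = -1) ∧ 0 < π ∧
    (h₁ ⨯₃ h₂) ⬝ᵥ h₃ ≠ 0 ∧ ∀ a₁ a₂ : ℝ, (a₁ ≠ 0 ∨ a₂ ≠ 0) →
      ∀ᶠ q in 𝓝 ((a₁, a₂, 0) : ℝ × ℝ × ℝ), 0 < q.2.2 → ∀ y ∈ K,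
        q.1 * h₁ ⬝ᵥ y + q.2.1 * h₂ ⬝ᵥ y + q.2.2 * h₃ ⬝ᵥ y = -(π * q.2.2) →
        ∃ y' ∈ K, ∃ l : ℝ, l = π * q.2.2 / (q.1 ^ 2 + q.2.1 ^ 2 + σ * q.2.2 ^ 2) ∧
          h₁ ⬝ᵥ y' = h₁ ⬝ᵥ y + 2 * l * q.1 ∧ h₂ ⬝ᵥ y' = h₂ ⬝ᵥ y + 2 * l * q.2.1 ∧
          h₃ ⬝ᵥ y' = h₃ ⬝ᵥ y + 2 * l * (σ * q.2.2) := by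
  obtain ⟨B, hB, hs⟩ := F.exists_definite
  obtain ⟨f₁, f₂, hf₁, hf₂, hf₁₂⟩ := exists_orth_pair F.ne
  rw [dotProduct_comm] at hf₁ hf₂
  have hee := dot_self_pos F.ne
  have scale : ∀ f : V3, 0 < f ⬝ᵥ B f → ∃ c : ℝ, 0 < c ∧ (c • f) ⬝ᵥ B (c • f) = 1 := by
    intro f hf
    refine ⟨(√(f ⬝ᵥ B f))⁻¹, inv_pos.2 (Real.sqrt_pos.2 hf), ?_⟩
    rw [map_smul, smul_dotProduct, dotProduct_smul, smul_eq_mul, smul_eq_mul, ← mul_assoc,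
      ← mul_inv, Real.mul_self_sqrt hf.le, inv_mul_cancel₀ hf.ne']
  obtain ⟨c₁, hc₁, h11⟩ := scale f₁ (hB f₁ (left_ne_of_cross hf₁₂) hf₁).2
  obtain ⟨h₁, hh₁⟩ : ∃ h, h = c₁ • f₁ := ⟨_, rfl⟩
  rw [← hh₁] at h11
  have h1e : h₁ ⬝ᵥ e = 0 := by rw [hh₁, smul_dotProduct, hf₁, smul_zero]
  obtain ⟨f, hf⟩ : ∃ f, f = f₂ - (h₁ ⬝ᵥ B f₂) • h₁ := ⟨_, rfl⟩
  have hfe : f ⬝ᵥ e = 0 := by rw [hf, sub_dotProduct, smul_dotProduct, h1e, hf₂]; simp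
  have hh₁f : h₁ ⨯₃ f = c₁ • (f₁ ⨯₃ f₂) := by
    rw [hf, map_sub, map_smul, cross_self, smul_zero, sub_zero, hh₁, map_smul,
      LinearMap.smul_apply]
  have hf0 : f ≠ 0 := by
    apply right_ne_of_cross (a := h₁)
    rw [hh₁f]; exact smul_ne_zero hc₁.ne' hf₁₂
  obtain ⟨c₂, hc₂, h22⟩ := scale f (hB f hf0 hfe).2
  obtain ⟨h₂, hh₂⟩ : ∃ h, h = c₂ • f := ⟨_, rfl⟩
  rw [← hh₂] at h22
  have h2e : h₂ ⬝ᵥ e = 0 := by rw [hh₂, smul_dotProduct, hfe, smul_zero]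
  have h12 : h₁ ⬝ᵥ B h₂ = 0 := by
    rw [hh₂, map_smul, dotProduct_smul, hf, map_sub, map_smul, dotProduct_sub, dotProduct_smul,
      h11]; simp
  have h21 : h₂ ⬝ᵥ B h₁ = 0 := by rw [hs]; exact h12
  have hcr : h₁ ⨯₃ h₂ ≠ 0 := by
    rw [hh₂, map_smul, hh₁f]; exact smul_ne_zero hc₂.ne' (smul_ne_zero hc₁.ne' hf₁₂)
  have hcre : (h₁ ⨯₃ h₂) ⬝ᵥ e ≠ 0 := by
    obtain ⟨t, ht⟩ := exists_smul_cross hcr h1e h2e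
    intro h
    rw [ht, dotProduct_smul] at h
    rcases mul_eq_zero.1 h with h | h
    · rw [h, zero_smul] at ht; exact F.ne ht
    · exact (dot_self_pos hcr).ne' h
  obtain ⟨k, hk⟩ : ∃ k, k = e - (h₁ ⬝ᵥ B e) • h₁ - (h₂ ⬝ᵥ B e) • h₂ := ⟨_, rfl⟩
  have hke : k ⬝ᵥ e = e ⬝ᵥ e := by
    rw [hk, sub_dotProduct, sub_dotProduct, smul_dotProduct, smul_dotProduct, h1e, h2e]; simp
  have h1k : h₁ ⬝ᵥ B k = 0 := by
    rw [hk]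
    simp only [map_sub, map_smul, dotProduct_sub, dotProduct_smul, h11, h12, smul_eq_mul]; ring
  have h2k : h₂ ⬝ᵥ B k = 0 := by
    rw [hk]
    simp only [map_sub, map_smul, dotProduct_sub, dotProduct_smul, h21, h22, smul_eq_mul]; ring
  have hck : (h₁ ⨯₃ h₂) ⬝ᵥ k ≠ 0 := by
    rw [hk, dotProduct_sub, dotProduct_sub, dotProduct_smul, dotProduct_smul, cross_dot_self,
      cross_dot_right]
    simpa using hcre
  have hinj : Function.Injective B := (hB h₁ (left_ne_of_cross hcr) h1e).1.1
  have hkk : k ⬝ᵥ B k ≠ 0 := by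
    intro h0
    have hBk : B k = 0 := by
      have := coord_decomp hck (B k)
      have hd : ∀ y, y ⬝ᵥ B k = 0 := by
        intro y
        rw [coord_decomp hck y]
        simp only [add_dotProduct, smul_dotProduct, h1k, h2k, h0]; simp
      have h3 := hd (B k)
      by_contra hne
      exact (dot_self_pos hne).ne' h3
    have : k = 0 := hinj (by rw [hBk, map_zero])
    rw [this] at hck; simp at hck
  obtain ⟨c₃, hc₃⟩ : ∃ c, c = (√|k ⬝ᵥ B k|)⁻¹ := ⟨_, rfl⟩
  have hc₃0 : 0 < c₃ := by rw [hc₃]; exact inv_pos.2 (Real.sqrt_pos.2 (abs_pos.2 hkk))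
  obtain ⟨h₃, hh₃⟩ : ∃ h, h = c₃ • k := ⟨_, rfl⟩
  obtain ⟨σ, hσ⟩ : ∃ σ, σ = h₃ ⬝ᵥ B h₃ := ⟨_, rfl⟩
  have hσ1 : σ = 1 ∨ σ = -1 := by
    have : σ = k ⬝ᵥ B k / |k ⬝ᵥ B k| := by
      rw [hσ, hh₃, map_smul, smul_dotProduct, dotProduct_smul, smul_eq_mul, smul_eq_mul,
        ← mul_assoc, hc₃, ← mul_inv, Real.mul_self_sqrt (abs_nonneg _), inv_mul_eq_div]
    rw [this]
    rcases lt_or_gt_of_ne hkk with h | h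
    · right; rw [abs_of_neg h, div_neg, div_self hkk]
    · left; rw [abs_of_pos h, div_self hkk]
  have h13 : h₁ ⬝ᵥ B h₃ = 0 := by rw [hh₃, map_smul, dotProduct_smul, h1k, smul_zero]
  have h23 : h₂ ⬝ᵥ B h₃ = 0 := by rw [hh₃, map_smul, dotProduct_smul, h2k, smul_zero]
  have h31 : h₃ ⬝ᵥ B h₁ = 0 := by rw [hs]; exact h13
  have h32 : h₃ ⬝ᵥ B h₂ = 0 := by rw [hs]; exact h23
  obtain ⟨π, hπ⟩ : ∃ π, π = h₃ ⬝ᵥ e := ⟨_, rfl⟩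
  have hπ0 : 0 < π := by
    rw [hπ, hh₃, smul_dotProduct, hke]; exact mul_pos hc₃0 hee
  refine ⟨h₁, h₂, h₃, σ, π, hσ1, hπ0, ?_, ?_⟩
  · rw [hh₃, dotProduct_smul]; exact mul_ne_zero hc₃0.ne' hck
  intro a₁ a₂ ha
  obtain ⟨n, hn⟩ : ∃ n, n = a₁ • h₁ + a₂ • h₂ := ⟨_, rfl⟩
  have hn0 : n ≠ 0 := by
    intro h0
    have i1 := congrArg (fun y => h₁ ⬝ᵥ B y) h0
    have i2 := congrArg (fun y => h₂ ⬝ᵥ B y) h0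
    simp only [hn, map_add, map_smul, dotProduct_add, dotProduct_smul, h11, h12, h21, h22,
      map_zero, dotProduct_zero, smul_eq_mul] at i1 i2
    rcases ha with h | h
    · exact h (by linarith)
    · exact h (by linarith)
  have hne : n ⬝ᵥ e = 0 := by
    rw [hn, add_dotProduct, smul_dotProduct, smul_dotProduct, h1e, h2e]; simp
  have hc : Continuous fun q : ℝ × ℝ × ℝ => q.1 • h₁ + q.2.1 • h₂ + q.2.2 • h₃ := by fun_prop
  have ht : Tendsto (fun q : ℝ × ℝ × ℝ => q.1 • h₁ + q.2.1 • h₂ + q.2.2 • h₃)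
      (𝓝 (a₁, a₂, 0)) (𝓝 n) := by
    have := hc.tendsto (a₁, a₂, 0)
    simp only [zero_smul, add_zero, ← hn] at this
    exact this
  filter_upwards [ht.eventually (hB n hn0 hne).1.2] with q hq hq0 y hy hqy
  obtain ⟨g, hg⟩ : ∃ g, g = q.1 • h₁ + q.2.1 • h₂ + q.2.2 • h₃ := ⟨_, rfl⟩
  rw [← hg] at hq
  have hge : g ⬝ᵥ e = π * q.2.2 := by
    rw [hg]; simp only [add_dotProduct, smul_dotProduct, h1e, h2e, ← hπ, smul_eq_mul]; ring
  have hge0 : 0 < g ⬝ᵥ e := by rw [hge]; positivity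
  have hg0 : g ≠ 0 := by rintro h; rw [h] at hge0; simp at hge0
  obtain ⟨μ, hμ⟩ := exists_smul_of_cross (hq hge0) (F.v_ne_zero hge0.ne')
  have hμ0 : μ ≠ 0 := by
    rintro rfl
    rw [zero_smul] at hμ
    exact hg0 (hinj (by rw [hμ, map_zero]))
  have hvg : v g = μ⁻¹ • B g := by rw [hμ, smul_smul, inv_mul_cancel₀ hμ0, one_smul]
  have hgB : q.1 ^ 2 + q.2.1 ^ 2 + σ * q.2.2 ^ 2 = μ * (π * q.2.2) := by
    have i1 : g ⬝ᵥ B g = μ * (π * q.2.2) := by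
      rw [hμ, dotProduct_smul, F.dot g hg0, hge, smul_eq_mul]
    rw [← i1, hg]
    simp only [map_add, map_smul, dotProduct_add, dotProduct_smul, add_dotProduct, smul_dotProduct,
      h11, h12, h21, h22, h13, h23, h31, h32, ← hσ, smul_eq_mul]
    ring
  refine ⟨y + (2 : ℝ) • v g, F.refl g hg0 y hy ?_, μ⁻¹, ?_, ?_, ?_, ?_⟩
  · rw [hge, ← hqy, hg]; simp only [add_dotProduct, smul_dotProduct, smul_eq_mul]
  · rw [hgB]
    have : π * q.2.2 ≠ 0 := by positivity
    field_simp
  all_goals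
    rw [hvg, dotProduct_add, dotProduct_smul, dotProduct_smul, hg]
    simp only [map_add, map_smul, dotProduct_add, dotProduct_smul,
      h11, h12, h21, h22, h13, h23, h31, h32, ← hσ, smul_eq_mul]
    ring

end

section

/-- The compact symmetric convex set `S` is preserved, on each plane section close to a vertical
one, by the central symmetry attached to the quadratic form `|ζ|² + σ t²`. -/
structure Circ (S : Set (ℂ × ℝ)) (σ c : ℝ) : Prop where
  cpt : IsCompact S
  conv : Convex ℝ S
  symm : ∀ y ∈ S, -y ∈ S
  sgn : σ = 1 ∨ σ = -1
  pos : 0 < c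
  refl : ∀ α : ℂ, α ≠ 0 → ∀ᶠ q : ℂ × ℝ in 𝓝 (α, 0), 0 < q.2 → ∀ y ∈ S,
    q.1.re * y.1.re + q.1.im * y.1.im + q.2 * y.2 = -(c * q.2) →
      ∃ l : ℝ, l = c * q.2 / (Complex.normSq q.1 + σ * q.2 ^ 2) ∧
        (y.1 + (2 * l : ℝ) * q.1, y.2 + 2 * l * (σ * q.2)) ∈ S

namespace Circ

variable {S : Set (ℂ × ℝ)} {σ c : ℝ}

lemma step (C : Circ S σ c) {ζ : ℂ} {z : ℝ} (h : (ζ, z) ∈ S) (hζ : ζ ≠ 0) {U : Set ℂ}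
    (hU : U ∈ 𝓝 (1 : ℂ)) {ε : ℝ} (hε : 0 < ε) :
    ∃ (ω : ℂ) (η : ℝ), ω ∈ U ∧ 0 < ω.im ∧ ω ≠ 0 ∧ 0 < σ * η ∧ σ * η < ε ∧
      (ζ * ω, z + η) ∈ S ∧ (ζ * (ω / (starRingEnd ℂ) ω), z) ∈ S ∧
      Complex.normSq (ζ * ω) + σ * (z + η) ^ 2 = Complex.normSq ζ + σ * z ^ 2 := by
  obtain ⟨r, hr⟩ : ∃ r, r = Complex.normSq ζ := ⟨_, rfl⟩
  have hr0 : 0 < r := by rw [hr]; exact Complex.normSq_pos.2 hζ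
  obtain ⟨x, hx⟩ : ∃ x : ℝ → ℝ, x = fun s => -(s * (c + z)) / r := ⟨_, rfl⟩
  obtain ⟨Q, hQ⟩ : ∃ Q : ℝ → ℝ, Q = fun s => r * (1 + x s ^ 2) + σ * s ^ 2 := ⟨_, rfl⟩
  obtain ⟨l, hl⟩ : ∃ l : ℝ → ℝ, l = fun s => c * s / Q s := ⟨_, rfl⟩
  obtain ⟨ω, hω⟩ : ∃ ω : ℝ → ℂ, ω = fun s => 1 + (2 * l s : ℝ) * ((x s : ℂ) + Complex.I) :=
    ⟨_, rfl⟩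
  have hxc : Continuous x := by rw [hx]; fun_prop
  have hQc : Continuous Q := by rw [hQ]; fun_prop
  have hx0 : x 0 = 0 := by simp [hx]
  have hQ0 : Q 0 = r := by simp [hQ, hx0]
  have hlc : ContinuousAt l 0 := by
    rw [hl]; exact ContinuousAt.div (by fun_prop) hQc.continuousAt (by rw [hQ0]; exact hr0.ne')
  have hl0 : l 0 = 0 := by simp [hl]
  have hωc : ContinuousAt ω 0 := by
    rw [hω]
    refine continuousAt_const.add (ContinuousAt.mul ?_ ?_)
    · exact Complex.continuous_ofReal.continuousAt.comp (f := fun s => 2 * l s)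
        (hlc.const_mul 2)
    · exact (Continuous.add (Complex.continuous_ofReal.comp hxc) continuous_const).continuousAt
  have hω0 : ω 0 = 1 := by simp [hω, hl0]
  have hconj : ContinuousAt (fun s => (starRingEnd ℂ) (ω s)) 0 :=
    Complex.continuous_conj.continuousAt.comp (f := ω) hωc
  have hα1 : ContinuousAt (fun s : ℝ => (ζ * ((x s : ℂ) + Complex.I), s)) 0 :=
    ContinuousAt.prodMk ((Continuous.mul continuous_const
      (Continuous.add (Complex.continuous_ofReal.comp hxc) continuous_const)).continuousAt)
      continuousAt_id
  have hα2 : ContinuousAt (fun s : ℝ =>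
      (ζ * (ω s / (starRingEnd ℂ) (ω s)) * ((x s : ℂ) - Complex.I), s)) 0 := by
    refine ContinuousAt.prodMk (ContinuousAt.mul (continuousAt_const.mul (hωc.div hconj ?_)) ?_)
      continuousAt_id
    · rw [hω0]; simp
    · exact (Continuous.sub (Complex.continuous_ofReal.comp hxc) continuous_const).continuousAt
  have e1 := hα1.tendsto
  have e2 := hα2.tendsto
  simp only [hx0, hω0, map_one, div_one, mul_one, Complex.ofReal_zero, zero_add, zero_sub] at e1 e2
  have ev1 := e1.eventually (C.refl (ζ * Complex.I) (mul_ne_zero hζ Complex.I_ne_zero))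
  have ev2 := e2.eventually (C.refl (ζ * -Complex.I)
    (mul_ne_zero hζ (neg_ne_zero.2 Complex.I_ne_zero)))
  have ev3 : ∀ᶠ s in 𝓝 (0 : ℝ), ω s ∈ U := hωc.tendsto (by rw [hω0]; exact hU)
  have ev4 : ∀ᶠ s in 𝓝 (0 : ℝ), 0 < Q s :=
    hQc.continuousAt.eventually_const_lt (by rw [hQ0]; exact hr0)
  have ev5 : ∀ᶠ s in 𝓝 (0 : ℝ), 2 * l s * s < ε := by
    have i1 : ContinuousAt (fun s => 2 * l s * s) 0 := (hlc.const_mul 2).mul continuousAt_id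
    exact i1.tendsto.eventually_lt_const (by simpa using hε)
  have ev6 : ∀ᶠ s in 𝓝 (0 : ℝ), ω s ≠ 0 := hωc.eventually_ne (by rw [hω0]; exact one_ne_zero)
  have hfreq : ∃ᶠ s in 𝓝 (0 : ℝ), 0 < s :=
    (frequently_gt_nhds (0 : ℝ))
  obtain ⟨s, hs, h1, h2, h3, h4, h5, h6⟩ :=
    (hfreq.and_eventually (ev1.and (ev2.and (ev3.and (ev4.and (ev5.and ev6)))))).exists
  have hls : 0 < l s := by rw [hl]; exact div_pos (mul_pos C.pos hs) h4
  have hlQ : l s * Q s = c * s := by rw [hl]; field_simp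
  have hrx : r * x s = -(s * (c + z)) := by rw [hx]; field_simp
  have hQs : Q s = r * (1 + x s ^ 2) + σ * s ^ 2 := by rw [hQ]
  have hls' : l s = c * s / Q s := by rw [hl]
  have hωs : ω s = 1 + (2 * l s : ℝ) * ((x s : ℂ) + Complex.I) := by rw [hω]
  have hσ2 : σ * σ = 1 := by rcases C.sgn with h | h <;> rw [h] <;> norm_num
  clear ev1 ev2 ev3 ev4 ev5 ev6 e1 e2 hα1 hα2 hconj hω0 hωc hl0 hlc hQ0 hx0 hQc hxc hfreq
  generalize ω s = w at *
  generalize x s = X at *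
  generalize l s = L at *
  generalize Q s = q at *
  have hwre : w.re = 1 + 2 * L * X := by rw [hωs]; simp
  have hwim : w.im = 2 * L := by rw [hωs]; simp
  have hr' : r = ζ.re * ζ.re + ζ.im * ζ.im := by rw [hr, Complex.normSq_apply]
  obtain ⟨l1, hl1, m1⟩ := h1 hs (ζ, z) h (by
    simp only [Complex.mul_re, Complex.mul_im, Complex.add_re, Complex.add_im, Complex.ofReal_re,
      Complex.ofReal_im, Complex.I_re, Complex.I_im]
    linear_combination hrx - X * hr')
  have hl1' : l1 = L := by
    rw [hl1, hls', hQs, Complex.normSq_mul, ← hr]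
    simp only [Complex.normSq_apply, Complex.add_re, Complex.add_im, Complex.ofReal_re,
      Complex.ofReal_im, Complex.I_re, Complex.I_im]
    ring_nf
  have m1' : (ζ * w, z + 2 * L * (σ * s)) ∈ S := by
    convert m1 using 2
    · rw [hl1', hωs]; ring
    · rw [hl1']
  have hcw : (starRingEnd ℂ) w ≠ 0 := by simpa using h6
  have hcw' : (starRingEnd ℂ) w = 1 + (2 * L : ℝ) * ((X : ℂ) - Complex.I) := by
    rw [hωs, map_add, map_mul, map_one, Complex.conj_ofReal, map_add, Complex.conj_ofReal,
      Complex.conj_I, sub_eq_add_neg]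
  obtain ⟨A, hA⟩ : ∃ A, A = ζ * (w / (starRingEnd ℂ) w) * ((X : ℂ) - Complex.I) := ⟨_, rfl⟩
  rw [← hA] at h2
  have hAn : Complex.normSq A = r * (1 + X ^ 2) := by
    rw [hA, Complex.normSq_mul, Complex.normSq_mul, Complex.normSq_div, Complex.normSq_conj,
      div_self (by simpa using h6), ← hr]
    simp only [Complex.normSq_apply, Complex.sub_re, Complex.sub_im, Complex.ofReal_re,
      Complex.ofReal_im, Complex.I_re, Complex.I_im]
    ring
  have hpair : A.re * (ζ * w).re + A.im * (ζ * w).im = r * (X + 2 * L * (1 + X ^ 2)) := by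
    have i1 : (starRingEnd ℂ) A * (ζ * w) =
        (r : ℂ) * ((starRingEnd ℂ) w * ((X : ℂ) + Complex.I)) := by
      rw [hr, ← Complex.normSq_eq_conj_mul_self.symm, hA]
      simp only [map_mul, map_div₀, map_sub, Complex.conj_conj, Complex.conj_ofReal, Complex.conj_I]
      field_simp
      ring
    have i2 := congrArg Complex.re i1
    simp only [Complex.re_ofReal_mul, Complex.mul_re (starRingEnd ℂ w),
      Complex.mul_re (starRingEnd ℂ A), Complex.conj_re,
      Complex.conj_im, Complex.add_re, Complex.add_im, Complex.ofReal_re,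
      Complex.ofReal_im, Complex.I_re, Complex.I_im, hwre, hwim] at i2
    linear_combination i2
  obtain ⟨l2, hl2, m2⟩ := h2 hs _ (C.symm _ m1') (by
    simp only [Prod.fst_neg, Prod.snd_neg, Complex.neg_re, Complex.neg_im]
    linear_combination -hpair - hrx - 2 * hlQ + 2 * L * hQs)
  have hl2' : l2 = L := by rw [hl2, hls', hQs, hAn]
  have m2' : (ζ * (w / (starRingEnd ℂ) w), z) ∈ S := by
    have := C.symm _ m2
    rw [hl2'] at this
    convert this using 1
    simp only [Prod.neg_mk, Prod.mk.injEq]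
    refine ⟨?_, by ring⟩
    have i3 : w / (starRingEnd ℂ) w * (starRingEnd ℂ) w = w := div_mul_cancel₀ _ hcw
    generalize w / (starRingEnd ℂ) w = θ at *
    rw [hA, ← i3, hcw']
    ring
  have hση : σ * (2 * L * (σ * s)) = 2 * L * s := by linear_combination 2 * L * s * hσ2
  refine ⟨w, 2 * L * (σ * s), h3, by rw [hwim]; positivity, h6, by rw [hση]; positivity,
    by rw [hση]; exact h5, m1', m2', ?_⟩
  rw [Complex.normSq_mul, ← hr, Complex.normSq_apply w, hwre, hwim]
  linear_combination 4 * L * hrx + 4 * L * hlQ - 4 * L ^ 2 * hQs +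
    (4 * L * z * s + 4 * L ^ 2 * s ^ 2 * σ) * hσ2

lemma rotate (C : Circ S σ c) {ζ ζ' : ℂ} {z : ℝ} (h : (ζ, z) ∈ S)
    (hn : Complex.normSq ζ' = Complex.normSq ζ) : (ζ', z) ∈ S := by
  by_cases hζ : ζ = 0
  · rw [hζ, map_zero] at hn
    rw [Complex.normSq_eq_zero.1 hn, ← hζ]; exact h
  obtain ⟨A, hA⟩ : ∃ A : Set ℝ, A =
      {φ : ℝ | (ζ * Complex.exp ((φ : ℂ) * Complex.I), z) ∈ S} := ⟨_, rfl⟩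
  have hAc : IsClosed A := by
    rw [hA]; exact C.cpt.isClosed.preimage (by fun_prop)
  have hsub : Icc 0 (2 * Real.pi) ⊆ A := by
    refine (hAc.inter isClosed_Icc).Icc_subset_of_forall_exists_gt (by simpa [hA] using h) ?_
    rintro φ ⟨hφ, -⟩ y hy
    have hy' : φ < y := hy
    have hU : {w : ℂ | w.arg < (y - φ) / 2} ∈ 𝓝 (1 : ℂ) := by
      refine (Complex.continuousAt_arg (by simp)).eventually_lt_const ?_
      simpa using hy'
    rw [hA] at hφ
    obtain ⟨w, η, h1, h2, h3, -, -, -, h4, -⟩ := C.step hφ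
      (mul_ne_zero hζ (Complex.exp_ne_zero _)) hU one_pos
    have hpos : 0 < w.arg := by
      refine lt_of_le_of_ne (Complex.arg_nonneg_iff.2 h2.le) fun h0 => h2.ne' ?_
      exact (Complex.arg_eq_zero_iff.1 h0.symm).2
    have h1' : w.arg < (y - φ) / 2 := h1
    refine ⟨φ + 2 * w.arg, ?_, by linarith, by linarith⟩
    rw [hA]
    show (ζ * Complex.exp ((φ + 2 * w.arg : ℝ) * Complex.I), z) ∈ S
    convert h4 using 2
    have h5 : w / (starRingEnd ℂ) w = Complex.exp ((2 * w.arg : ℝ) * Complex.I) := by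
      have i1 := Complex.norm_mul_exp_arg_mul_I w
      have i2 : (starRingEnd ℂ) w = ‖w‖ * Complex.exp (-(w.arg * Complex.I)) := by
        calc (starRingEnd ℂ) w = (starRingEnd ℂ) (‖w‖ * Complex.exp (w.arg * Complex.I)) := by
              rw [i1]
          _ = _ := by
            rw [map_mul, Complex.conj_ofReal, ← Complex.exp_conj, map_mul, Complex.conj_I,
              Complex.conj_ofReal, mul_neg]
      have i3 : (‖w‖ : ℂ) ≠ 0 := by simpa using h3
      rw [i2, div_eq_iff (mul_ne_zero i3 (Complex.exp_ne_zero _)), mul_left_comm, ← Complex.exp_add]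
      conv_lhs => rw [← i1]
      congr 2; push_cast; ring
    rw [h5, mul_assoc, ← Complex.exp_add]
    congr 2; push_cast; ring
  obtain ⟨φ, hφ⟩ : ∃ φ ∈ Icc 0 (2 * Real.pi), Complex.exp (φ * Complex.I) = ζ' / ζ := by
    have i0 : ‖ζ' / ζ‖ = 1 := by
      rw [norm_div, Complex.norm_def, Complex.norm_def, hn, ← Complex.norm_def,
        div_self (norm_ne_zero_iff.2 hζ)]
    have i1 := Complex.norm_mul_exp_arg_mul_I (ζ' / ζ)
    rw [i0, Complex.ofReal_one, one_mul] at i1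
    have i2 := Complex.neg_pi_lt_arg (ζ' / ζ)
    have i3 := Complex.arg_le_pi (ζ' / ζ)
    have i4 := Real.pi_pos
    by_cases h0 : 0 ≤ (ζ' / ζ).arg
    · exact ⟨_, ⟨h0, by linarith⟩, i1⟩
    · push Not at h0
      refine ⟨(ζ' / ζ).arg + 2 * Real.pi, ⟨by linarith, by linarith⟩, ?_⟩
      push_cast
      rw [add_mul, Complex.exp_add, Complex.exp_two_pi_mul_I, mul_one]
      exact i1
  have := hsub hφ.1
  rw [hA] at this
  have h7 : (ζ * Complex.exp (φ * Complex.I), z) ∈ S := this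
  rwa [hφ.2, mul_div_cancel₀ _ hζ] at h7

lemma lift (C : Circ S σ c) {ζ : ℂ} {z : ℝ} (h : (ζ, z) ∈ S) (hζ : ζ ≠ 0) {ε : ℝ} (hε : 0 < ε) :
    ∃ (ζ' : ℂ) (z' : ℝ), z < z' ∧ z' < z + ε ∧ (ζ', z') ∈ S ∧
      Complex.normSq ζ' + σ * z' ^ 2 = Complex.normSq ζ + σ * z ^ 2 := by
  rcases C.sgn with hσ | hσ
  · obtain ⟨w, η, -, -, -, h1, h2, h3, -, h4⟩ := C.step h hζ univ_mem hε
    rw [hσ, one_mul] at h1 h2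
    exact ⟨_, _, by linarith, by linarith, h3, h4⟩
  · obtain ⟨w, η, -, -, -, h1, h2, h3, -, h4⟩ := C.step (C.symm _ h) (neg_ne_zero.2 hζ) univ_mem hε
    refine ⟨_, _, ?_, ?_, C.symm _ h3, ?_⟩
    · show z < -(-z + η)
      rw [hσ] at h1; linarith
    · show -(-z + η) < z + ε
      rw [hσ] at h2; linarith
    · rw [Complex.normSq_neg, neg_sq, h4]
      show Complex.normSq (-ζ) + σ * (-z) ^ 2 = _
      rw [Complex.normSq_neg, neg_sq]

lemma lift_to (C : Circ S σ c) {ζ : ℂ} {z M : ℝ} (h : (ζ, z) ∈ S)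
    (hM : ∀ w ∈ Ico z M, 0 < Complex.normSq ζ + σ * z ^ 2 - σ * w ^ 2) {w : ℝ} (hw : w ∈ Icc z M)
    {ζ' : ℂ} (hn : Complex.normSq ζ' = Complex.normSq ζ + σ * z ^ 2 - σ * w ^ 2) :
    (ζ', w) ∈ S := by
  obtain ⟨ρ, hρ⟩ : ∃ ρ, ρ = Complex.normSq ζ + σ * z ^ 2 := ⟨_, rfl⟩
  rw [← hρ] at hM hn
  obtain ⟨T, hT⟩ : ∃ T : Set ℝ, T = {w | (((√(ρ - σ * w ^ 2) : ℝ) : ℂ), w) ∈ S} := ⟨_, rfl⟩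
  have hT' : ∀ w, w ∈ T ↔ (((√(ρ - σ * w ^ 2) : ℝ) : ℂ), w) ∈ S := fun w => by rw [hT]; rfl
  have hTc : IsClosed T := by
    have : T = (fun w : ℝ => (((√(ρ - σ * w ^ 2) : ℝ) : ℂ), w)) ⁻¹' S := by
      ext w; exact hT' w
    rw [this]
    exact C.cpt.isClosed.preimage (by fun_prop)
  have hsub : Icc z M ⊆ T := by
    refine (hTc.inter isClosed_Icc).Icc_subset_of_forall_exists_gt ?_ ?_
    · rw [hT']
      refine C.rotate h ?_
      rw [Complex.normSq_ofReal, hρ, add_sub_cancel_right,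
        Real.mul_self_sqrt (Complex.normSq_nonneg _)]
    · rintro u ⟨hu, hu'⟩ y hy
      have hy' : u < y := hy
      rw [hT'] at hu
      have hp := hM u hu'
      obtain ⟨ζ₁, z₁, h1, h2, h3, h4⟩ := C.lift hu
        (by simpa using (Real.sqrt_pos.2 hp).ne') (sub_pos.2 hy')
      refine ⟨z₁, ?_, h1, by linarith⟩
      rw [hT']
      rw [Complex.normSq_ofReal, Real.mul_self_sqrt hp.le] at h4
      refine C.rotate h3 ?_
      have : ρ - σ * z₁ ^ 2 = Complex.normSq ζ₁ := by linarith
      rw [Complex.normSq_ofReal, this, Real.mul_self_sqrt (Complex.normSq_nonneg _)]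
  have := (hT' w).1 (hsub hw)
  refine C.rotate this ?_
  rw [Complex.normSq_ofReal, ← hn, Real.mul_self_sqrt (Complex.normSq_nonneg _)]

lemma sgn_eq_one (C : Circ S σ c) {y : ℂ × ℝ} (hy : y ∈ S) (hy0 : y.1 ≠ 0) : σ = 1 := by
  refine C.sgn.resolve_right fun hσ => ?_
  wlog hz : 0 ≤ y.2 generalizing y
  · exact this (C.symm y hy) (neg_ne_zero.2 hy0) (by push Not at hz; simpa using hz.le)
  obtain ⟨ζ, z⟩ := y
  have hz' : 0 ≤ z := hz
  have hr : 0 < Complex.normSq ζ := Complex.normSq_pos.2 hy0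
  obtain ⟨b, hb⟩ := (C.cpt.image continuous_snd).bddAbove
  have hp : ∀ w, z ≤ w → 0 < Complex.normSq ζ + σ * z ^ 2 - σ * w ^ 2 := by
    intro w hw; rw [hσ]; nlinarith
  obtain ⟨w, hw⟩ : ∃ w, w = max z (b + 1) := ⟨_, rfl⟩
  have hzw : z ≤ w := by rw [hw]; exact le_max_left _ _
  have h1 := C.lift_to (M := w) (w := w) hy (fun u hu => hp u hu.1) ⟨hzw, le_rfl⟩
    (ζ' := ((√(Complex.normSq ζ + σ * z ^ 2 - σ * w ^ 2) : ℝ) : ℂ))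
    (by rw [Complex.normSq_ofReal, Real.mul_self_sqrt (hp w hzw).le])
  have h2 : w ≤ b := hb ⟨_, h1, rfl⟩
  have h3 : b + 1 ≤ w := by rw [hw]; exact le_max_right _ _
  linarith

/-- The squared Euclidean norm on `ℂ × ℝ`. -/
def nsq (y : ℂ × ℝ) : ℝ := Complex.normSq y.1 + y.2 ^ 2

lemma continuous_nsq : Continuous nsq := by
  unfold nsq; exact (Complex.continuous_normSq.comp continuous_fst).add (by fun_prop)

lemma nsq_neg (y : ℂ × ℝ) : nsq (-y) = nsq y := by simp [nsq]

lemma nsq_smul (t : ℝ) (y : ℂ × ℝ) : nsq (t • y) = t ^ 2 * nsq y := by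
  simp [nsq, Complex.normSq_apply]; ring

lemma sphere (C : Circ S σ c) {y y' : ℂ × ℝ} (hy : y ∈ S) (hy0 : y.1 ≠ 0) (hn : nsq y' = nsq y) :
    y' ∈ S := by
  have hσ := C.sgn_eq_one hy hy0
  wlog hz : y.2 ≤ y'.2 generalizing y y'
  · push Not at hz
    have := this (y := -y) (y' := -y') (C.symm y hy) (neg_ne_zero.2 hy0)
      (by rw [nsq_neg, nsq_neg, hn]) (by simpa using hz.le)
    simpa using C.symm _ this
  obtain ⟨ζ, z⟩ := y
  obtain ⟨ζ', z'⟩ := y'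
  have hn' : Complex.normSq ζ' + z' ^ 2 = Complex.normSq ζ + z ^ 2 := hn
  have hr : 0 < Complex.normSq ζ := Complex.normSq_pos.2 hy0
  have hr' := Complex.normSq_nonneg ζ'
  have hz' : z ≤ z' := hz
  refine C.lift_to (M := z') (w := z') hy (fun u hu => ?_) ⟨hz, le_rfl⟩ (by rw [hσ]; linarith)
  rw [hσ]
  obtain ⟨h1, h2⟩ := hu
  rcases le_or_gt 0 u with h | h
  · nlinarith
  · nlinarith

lemma ball_sub (C : Circ S σ c) {y y' : ℂ × ℝ} (hy : y ∈ S) (hy0 : y.1 ≠ 0)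
    (hn : nsq y' ≤ nsq y) : y' ∈ S := by
  have hnn : ∀ y, 0 ≤ nsq y := fun y => add_nonneg (Complex.normSq_nonneg _) (sq_nonneg _)
  have hmid : ∀ u ∈ S, ∀ t : ℝ, 0 ≤ t → t ≤ 1 → t • u ∈ S := by
    intro u hu t h0 h1
    have := C.conv hu (C.symm u hu) (a := (1 + t) / 2) (b := (1 - t) / 2) (by linarith)
      (by linarith) (by ring)
    convert this using 1
    module
  rcases (hnn y').eq_or_lt with h0 | h0
  · have h1 : y' = (0 : ℝ) • y := by
      have i1 := Complex.normSq_nonneg y'.1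
      have i2 := sq_nonneg y'.2
      have i3 : Complex.normSq y'.1 + y'.2 ^ 2 = 0 := h0.symm
      ext1
      · have : y'.1 = 0 := Complex.normSq_eq_zero.1 (by linarith)
        rw [this]; simp
      · have : y'.2 = 0 := by
          have : y'.2 ^ 2 = 0 := by linarith
          exact pow_eq_zero_iff (two_ne_zero) |>.1 this
        rw [this]; simp
    rw [h1]; exact hmid y hy 0 le_rfl zero_le_one
  · have hd : 0 < nsq y := h0.trans_le hn
    obtain ⟨t, ht⟩ : ∃ t, t = √(nsq y' / nsq y) := ⟨_, rfl⟩
    have ht0 : 0 < t := by rw [ht]; exact Real.sqrt_pos.2 (div_pos h0 hd)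
    have ht2 : t ^ 2 = nsq y' / nsq y := by rw [ht]; exact Real.sq_sqrt (div_pos h0 hd).le
    have ht1 : t ≤ 1 := by
      rw [ht, Real.sqrt_le_one]; exact (div_le_one hd).2 hn
    have h1 : t⁻¹ • y' ∈ S := C.sphere hy hy0 (by
      rw [nsq_smul, inv_pow, ht2]; field_simp)
    have := hmid _ h1 t ht0.le ht1
    rwa [smul_smul, mul_inv_cancel₀ ht0.ne', one_smul] at this

lemma eq_ball (C : Circ S σ c) {u : ℂ × ℝ} (hu : u ∈ S) (hu0 : u.1 ≠ 0) :
    ∃ R : ℝ, 0 < R ∧ ∀ y, y ∈ S ↔ nsq y ≤ R ^ 2 := by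
  obtain ⟨m, hm, hmax⟩ := C.cpt.exists_isMaxOn ⟨u, hu⟩ continuous_nsq.continuousOn
  have hup : 0 < nsq u := add_pos_of_pos_of_nonneg (Complex.normSq_pos.2 hu0) (sq_nonneg _)
  have hmp : 0 < nsq m := hup.trans_le (hmax hu)
  refine ⟨√(nsq m), Real.sqrt_pos.2 hmp, fun y => ?_⟩
  rw [Real.sq_sqrt hmp.le]
  refine ⟨fun hy => hmax hy, fun hy => ?_⟩
  by_cases hm0 : m.1 = 0
  swap
  · exact C.ball_sub hm hm0 hy
  have hlt : ∀ y, nsq y < nsq m → y ∈ S := by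
    intro y hy
    have hc : Continuous fun t : ℝ => nsq ((1 - t) • m + t • u) :=
      continuous_nsq.comp (by fun_prop)
    have ev : ∀ᶠ t in 𝓝 (0 : ℝ), nsq y < nsq ((1 - t) • m + t • u) :=
      hc.continuousAt.eventually_const_lt (by simpa using hy)
    obtain ⟨t, ⟨ht, h1⟩, h2⟩ := (((frequently_gt_nhds (0 : ℝ)).and_eventually
      (eventually_lt_nhds (zero_lt_one (α := ℝ)))).and_eventually ev).exists
    refine C.ball_sub (C.conv hm hu (by linarith) ht.le (by ring)) ?_ h2.le
    simpa [hm0] using ⟨ht.ne', hu0⟩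
  have hcl : IsClosed ((fun t : ℝ => (1 - t) • y) ⁻¹' S) := C.cpt.isClosed.preimage (by fun_prop)
  have h0 : (0 : ℝ) ∈ closure (Ioo (0 : ℝ) 1) := by
    rw [closure_Ioo (zero_ne_one)]; simp
  have h1 : Ioo (0 : ℝ) 1 ⊆ (fun t : ℝ => (1 - t) • y) ⁻¹' S := by
    rintro t ⟨h1, h2⟩
    refine hlt _ ?_
    rw [nsq_smul]
    have h3 := mul_le_mul_of_nonneg_left hy (sq_nonneg (1 - t))
    have h4 : (1 - t) ^ 2 < 1 := by nlinarith
    nlinarith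
  have h2 : (1 - (0 : ℝ)) • y ∈ S := hcl.closure_subset_iff.2 h1 h0
  simpa using h2

end Circ

end

section

lemma FC.eq_ellipsoid {K : Set V3} {e : V3} {v : V3 → V3} (F : FC K e v) :
    ∃ (h₁ h₂ h₃ : V3) (R : ℝ), (h₁ ⨯₃ h₂) ⬝ᵥ h₃ ≠ 0 ∧ 0 < R ∧
      ∀ y, y ∈ K ↔ (h₁ ⬝ᵥ y) ^ 2 + (h₂ ⬝ᵥ y) ^ 2 + (h₃ ⬝ᵥ y) ^ 2 ≤ R ^ 2 := by
  obtain ⟨h₁, h₂, h₃, σ, π, hσ, hπ, hdet, H⟩ := F.normal_form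
  obtain ⟨Λ, hΛ⟩ : ∃ Λ : V3 →ₗ[ℝ] ℂ × ℝ, ∀ y, Λ y = (⟨h₁ ⬝ᵥ y, h₂ ⬝ᵥ y⟩, h₃ ⬝ᵥ y) := by
    refine ⟨{ toFun := fun y => (⟨h₁ ⬝ᵥ y, h₂ ⬝ᵥ y⟩, h₃ ⬝ᵥ y), map_add' := ?_, map_smul' := ?_ },
      fun y => rfl⟩
    · intro a b
      refine Prod.ext (Complex.ext ?_ ?_) ?_ <;> simp [dotProduct_add]
    · intro t a
      refine Prod.ext (Complex.ext ?_ ?_) ?_ <;> simp [dotProduct_smul]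
  have hinj : Function.Injective Λ := by
    refine (injective_iff_map_eq_zero Λ).2 fun y hy => ?_
    rw [hΛ] at hy
    have i1 : h₁ ⬝ᵥ y = 0 := congrArg (fun q : ℂ × ℝ => q.1.re) hy
    have i2 : h₂ ⬝ᵥ y = 0 := congrArg (fun q : ℂ × ℝ => q.1.im) hy
    have i3 : h₃ ⬝ᵥ y = 0 := congrArg (fun q : ℂ × ℝ => q.2) hy
    refine dotProduct_eq_zero _ fun w => ?_
    rw [dotProduct_comm, coord_decomp hdet w]
    simp only [add_dotProduct, smul_dotProduct, i1, i2, i3, smul_zero, add_zero]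
  have C : Circ (Λ '' K) σ π := by
    refine ⟨F.cpt.image (LinearMap.continuous_of_finiteDimensional Λ), F.conv.linear_image Λ, ?_,
      hσ, hπ, ?_⟩
    · rintro _ ⟨y, hy, rfl⟩
      exact ⟨-y, F.symm y hy, map_neg Λ y⟩
    · intro α hα
      have hα' : α.re ≠ 0 ∨ α.im ≠ 0 := by
        by_contra! h
        exact hα (Complex.ext h.1 h.2)
      have ht : Tendsto (fun q : ℂ × ℝ => (q.1.re, q.1.im, q.2)) (𝓝 (α, 0))
          (𝓝 (α.re, α.im, 0)) := by
        have : Continuous fun q : ℂ × ℝ => (q.1.re, q.1.im, q.2) :=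
          (Complex.continuous_re.comp continuous_fst).prodMk
            ((Complex.continuous_im.comp continuous_fst).prodMk continuous_snd)
        exact this.tendsto (α, 0)
      filter_upwards [ht.eventually (H α.re α.im hα')] with q hq hq0
      rintro _ ⟨y, hy, rfl⟩ hp
      rw [hΛ] at hp
      obtain ⟨y', hy', l, hl, j1, j2, j3⟩ := hq hq0 y hy hp
      refine ⟨l, ?_, y', hy', ?_⟩
      · rw [hl, Complex.normSq_apply, sq, sq]
      · rw [hΛ, hΛ]
        refine Prod.ext (Complex.ext ?_ ?_) ?_
        · simp [j1]
        · simp [j2]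
        · simp [j3]
  obtain ⟨y, hy, hy0⟩ : ∃ y ∈ K, h₁ ⬝ᵥ y ≠ 0 := by
    by_contra! h
    have h1 : h₁ ≠ 0 := by rintro rfl; simp at hdet
    have hev : ∀ᶠ t in 𝓝 (0 : ℝ), t • h₁ ∈ K := by
      have hc : Continuous fun t : ℝ => t • h₁ := by fun_prop
      refine hc.tendsto 0 ?_
      rw [zero_smul]
      exact mem_interior_iff_mem_nhds.1 F.zero_int
    obtain ⟨t, ht, htK⟩ := ((frequently_gt_nhds (0 : ℝ)).and_eventually hev).exists
    have := h _ htK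
    rw [dotProduct_smul, smul_eq_mul] at this
    exact (mul_pos ht (dot_self_pos h1)).ne' this
  obtain ⟨R, hR, hball⟩ := C.eq_ball (u := Λ y) ⟨y, hy, rfl⟩ (by
    rw [hΛ]; exact fun h => hy0 (congrArg Complex.re h))
  refine ⟨h₁, h₂, h₃, R, hdet, hR, fun y => ?_⟩
  rw [← hinj.mem_set_image (s := K), hball, hΛ, Circ.nsq, Complex.normSq_apply, sq (h₁ ⬝ᵥ y),
    sq (h₂ ⬝ᵥ y)]

lemma symm_or_ellipsoid {K : Set V3} (hK : IsCompact K) (hconv : Convex ℝ K)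
    (hint : (interior K).Nonempty) (hs : SectSym K 0) :
    (∀ y ∈ K, -y ∈ K) ∨ ∃ (o h₁ h₂ h₃ : V3) (R : ℝ), (h₁ ⨯₃ h₂) ⬝ᵥ h₃ ≠ 0 ∧ 0 < R ∧
      ∀ y, y + o ∈ K ↔ (h₁ ⬝ᵥ y) ^ 2 + (h₂ ⬝ᵥ y) ^ 2 + (h₃ ⬝ᵥ y) ^ 2 ≤ R ^ 2 := by
  classical
  obtain ⟨o, ho⟩ := exists_centre hK hconv hint hs
  by_cases ho0 : o = 0
  · left
    intro y hy
    simpa [ho0] using ho y hy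
  right
  have hv : ∀ g : V3, ∃ v : V3, g ≠ 0 → g ⬝ᵥ v = g ⬝ᵥ o ∧
      ∀ y, y + o ∈ K → g ⬝ᵥ y = -(g ⬝ᵥ o) → y + (2 : ℝ) • v + o ∈ K := by
    intro g
    by_cases hne : ∃ y, y + o ∈ K ∧ g ⬝ᵥ y = -(g ⬝ᵥ o)
    · by_cases hg : g = 0
      · exact ⟨0, fun h => absurd hg h⟩
      obtain ⟨c, hc⟩ := hs g hg
      obtain ⟨y, hy, hgy⟩ := hne
      have i1 := (hc _ hy (by rw [dotProduct_add, hgy]; simp)).2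
      simp only [dotProduct_sub, dotProduct_smul, dotProduct_add, dotProduct_zero, hgy,
        smul_eq_mul] at i1
      refine ⟨o - c, fun _ => ⟨by rw [dotProduct_sub]; linarith, fun y hy hgy => ?_⟩⟩
      have := ho _ (hc _ hy (by rw [dotProduct_add, hgy]; simp)).1
      convert this using 1
      module
    · exact ⟨o, fun _ => ⟨rfl, fun y hy hgy => absurd ⟨y, hy, hgy⟩ hne⟩⟩
  choose v hv using hv
  have hc : Continuous fun y : V3 => y + o := by fun_prop
  have hcm : {y | y + o ∈ K} = (fun y => y - o) '' K := by
    ext y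
    refine ⟨fun h => ⟨_, h, by simp⟩, ?_⟩
    rintro ⟨z, hz, rfl⟩
    show z - o + o ∈ K
    rwa [sub_add_cancel]
  have F : FC {y | y + o ∈ K} o v := by
    refine ⟨?_, ?_, ?_, ?_, ho0, fun g hg => (hv g hg).1, fun g hg => (hv g hg).2⟩
    · rw [hcm]; exact hK.image (by fun_prop)
    · exact hconv.translate_preimage_left o
    · obtain ⟨z, hz⟩ := hint
      refine ⟨z - o, ?_⟩
      rw [mem_interior_iff_mem_nhds] at hz ⊢
      exact hc.tendsto (z - o) (by simpa using hz)
    · intro y hy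
      have := ho _ hy
      show -y + o ∈ K
      convert this using 1
      module
  obtain ⟨h₁, h₂, h₃, R, hdet, hR, h⟩ := F.eq_ellipsoid
  exact ⟨o, h₁, h₂, h₃, R, hdet, hR, h⟩

lemma plane_exists (p : EuclideanSpace ℝ (Fin 3)) {g : V3} (hg : g ≠ 0) :
    ∃ H : AffineSubspace ℝ (EuclideanSpace ℝ (Fin 3)), p ∈ H ∧
    Module.finrank ℝ H.direction = 2 ∧ ∀ x, x ∈ H ↔ g ⬝ᵥ (x - p).ofLp = 0 := by
  obtain ⟨f, hf⟩ : ∃ f : EuclideanSpace ℝ (Fin 3) →ₗ[ℝ] ℝ, ∀ x, f x = g ⬝ᵥ x.ofLp := by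
    refine ⟨{ toFun := fun x => g ⬝ᵥ x.ofLp, map_add' := ?_, map_smul' := ?_ }, fun x => rfl⟩
    · intro a b; simp [dotProduct_add]
    · intro t a; simp [dotProduct_smul]
  have hf0 : f ≠ 0 := by
    intro h
    have := hf (WithLp.toLp 2 g)
    rw [h] at this
    exact (dot_self_pos hg).ne this
  refine ⟨AffineSubspace.mk' p (LinearMap.ker f), AffineSubspace.self_mem_mk' _ _, ?_, fun x => ?_⟩
  · rw [AffineSubspace.direction_mk']
    have h1 := f.finrank_range_add_finrank_ker
    rw [LinearMap.range_eq_top.2 (LinearMap.surjective hf0), finrank_top, Module.finrank_self,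
      finrank_euclideanSpace_fin] at h1
    omega
  · rw [AffineSubspace.mem_mk', LinearMap.mem_ker, hf, vsub_eq_sub]

lemma affine_ball {K : Set (EuclideanSpace ℝ (Fin 3))} (o : EuclideanSpace ℝ (Fin 3))
    {h₁ h₂ h₃ : V3} {R : ℝ} (hdet : (h₁ ⨯₃ h₂) ⬝ᵥ h₃ ≠ 0)
    (hR : 0 < R) (h : ∀ x, x + o ∈ K ↔
      (h₁ ⬝ᵥ x.ofLp) ^ 2 + (h₂ ⬝ᵥ x.ofLp) ^ 2 + (h₃ ⬝ᵥ x.ofLp) ^ 2 ≤ R ^ 2) :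
    ∃ T : EuclideanSpace ℝ (Fin 3) ≃ᵃ[ℝ] EuclideanSpace ℝ (Fin 3),
      K = T '' Metric.closedBall (0 : EuclideanSpace ℝ (Fin 3)) 1 := by
  obtain ⟨f, hf⟩ : ∃ f : EuclideanSpace ℝ (Fin 3) →ₗ[ℝ] EuclideanSpace ℝ (Fin 3), ∀ x, f x =
      WithLp.toLp 2 ![R⁻¹ * h₁ ⬝ᵥ x.ofLp, R⁻¹ * h₂ ⬝ᵥ x.ofLp, R⁻¹ * h₃ ⬝ᵥ x.ofLp] := by
    refine ⟨{ toFun := fun x => WithLp.toLp 2 ![R⁻¹ * h₁ ⬝ᵥ x.ofLp, R⁻¹ * h₂ ⬝ᵥ x.ofLp,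
      R⁻¹ * h₃ ⬝ᵥ x.ofLp], map_add' := ?_, map_smul' := ?_ }, fun x => rfl⟩
    · intro a b
      ext i; fin_cases i <;> simp [dotProduct_add, mul_add]
    · intro t a
      ext i; fin_cases i <;> simp [dotProduct_smul] <;> ring
  have hinj : Function.Injective f := by
    refine (injective_iff_map_eq_zero f).2 fun y hy => ?_
    rw [hf] at hy
    have i1 : R⁻¹ * h₁ ⬝ᵥ y.ofLp = 0 := congrArg (fun x : EuclideanSpace ℝ (Fin 3) => x 0) hy
    have i2 : R⁻¹ * h₂ ⬝ᵥ y.ofLp = 0 := congrArg (fun x : EuclideanSpace ℝ (Fin 3) => x 1) hy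
    have i3 : R⁻¹ * h₃ ⬝ᵥ y.ofLp = 0 := congrArg (fun x : EuclideanSpace ℝ (Fin 3) => x 2) hy
    have hR' := inv_ne_zero hR.ne'
    rw [mul_eq_zero, or_iff_right hR'] at i1 i2 i3
    have : y.ofLp = 0 := by
      refine dotProduct_eq_zero _ fun w => ?_
      rw [dotProduct_comm, coord_decomp hdet w]
      simp only [add_dotProduct, smul_dotProduct, i1, i2, i3, smul_zero, add_zero]
    ext i
    exact congrFun this i
  have hnorm : ∀ x, ‖f x‖ ≤ 1 ↔ x + o ∈ K := by
    intro x
    rw [h, ← sq_le_one_iff₀ (norm_nonneg _), EuclideanSpace.real_norm_sq_eq, hf,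
      Fin.sum_univ_three]
    simp only [cons_val_zero, cons_val_one, cons_val, mul_pow, inv_pow]
    rw [← mul_add, ← mul_add, inv_mul_le_iff₀ (by positivity), mul_one]
  refine ⟨(LinearEquiv.ofInjectiveEndo f hinj).symm.toAffineEquiv.trans
    (AffineEquiv.constVAdd ℝ (EuclideanSpace ℝ (Fin 3)) o), ?_⟩
  ext x
  constructor
  · intro hx
    refine ⟨f (x - o), ?_, ?_⟩
    · rw [mem_closedBall_zero_iff, hnorm, sub_add_cancel]; exact hx
    · have : (LinearEquiv.ofInjectiveEndo f hinj).symm (f (x - o)) = x - o :=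
        (LinearEquiv.ofInjectiveEndo f hinj).symm_apply_apply (x - o)
      show o + (LinearEquiv.ofInjectiveEndo f hinj).symm (f (x - o)) = x
      rw [this]; abel
  · rintro ⟨z, hz, rfl⟩
    obtain ⟨w, rfl⟩ := (LinearEquiv.ofInjectiveEndo f hinj).surjective z
    rw [mem_closedBall_zero_iff] at hz
    have h1 := (hnorm w).1 hz
    show o + (LinearEquiv.ofInjectiveEndo f hinj).symm (LinearEquiv.ofInjectiveEndo f hinj w) ∈ K
    rw [LinearEquiv.symm_apply_apply, add_comm]
    exact h1

end

section

theorem false_centre {K : Set (EuclideanSpace ℝ (Fin 3))} {p : EuclideanSpace ℝ (Fin 3)}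
    (hKcomp : IsCompact K) (hKconv : Convex ℝ K) (hKint : (interior K).Nonempty)
    (hsym : ∀ H : AffineSubspace ℝ (EuclideanSpace ℝ (Fin 3)),
      p ∈ H → Module.finrank ℝ H.direction = 2 →
      ∃ c, SymmWith ((H : Set (EuclideanSpace ℝ (Fin 3))) ∩ K) c) :
    SymmWith K p ∨
      ∃ T : EuclideanSpace ℝ (Fin 3) ≃ᵃ[ℝ] EuclideanSpace ℝ (Fin 3),
        K = T '' Metric.closedBall (0 : EuclideanSpace ℝ (Fin 3)) 1 := by
  obtain ⟨L, hL⟩ : ∃ L : Set V3, ∀ y, y ∈ L ↔ WithLp.toLp 2 y + p ∈ K :=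
    ⟨{y | WithLp.toLp 2 y + p ∈ K}, fun y => Iff.rfl⟩
  have hc : Continuous fun y : V3 => WithLp.toLp 2 y + p :=
    (PiLp.continuous_toLp 2 _).add continuous_const
  have hc' : Continuous fun x : EuclideanSpace ℝ (Fin 3) => (x - p).ofLp :=
    (PiLp.continuous_ofLp 2 _).comp (by fun_prop)
  have hLi : L = (fun x : EuclideanSpace ℝ (Fin 3) => (x - p).ofLp) '' K := by
    ext y
    rw [hL]
    refine ⟨fun h => ⟨_, h, by simp⟩, ?_⟩
    rintro ⟨x, hx, rfl⟩
    simpa using hx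
  have hLc : IsCompact L := by rw [hLi]; exact hKcomp.image hc'
  have hLconv : Convex ℝ L := by
    intro a ha b hb s t hs ht hst
    rw [hL] at ha hb ⊢
    convert hKconv ha hb hs ht hst using 1
    rw [WithLp.toLp_add, WithLp.toLp_smul, WithLp.toLp_smul]
    calc _ = s • WithLp.toLp 2 a + t • WithLp.toLp 2 b + (1 : ℝ) • p := by rw [one_smul]
      _ = _ := by rw [← hst]; module
  have hLint : (interior L).Nonempty := by
    obtain ⟨x, hx⟩ := hKint
    refine ⟨(x - p).ofLp, ?_⟩
    rw [mem_interior_iff_mem_nhds] at hx ⊢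
    have h1 : ∀ᶠ y in 𝓝 (x - p).ofLp, WithLp.toLp 2 y + p ∈ K :=
      hc.tendsto (x - p).ofLp (by simpa using hx)
    exact h1.mono fun y hy => (hL y).2 hy
  have hs : SectSym L 0 := by
    intro g hg
    obtain ⟨H, hpH, hdim, hH⟩ := plane_exists p hg
    obtain ⟨c, hcS⟩ := hsym H hpH hdim
    refine ⟨(c - p).ofLp, fun y hy hgy => ?_⟩
    rw [dotProduct_zero] at hgy ⊢
    have h1 : WithLp.toLp 2 y + p ∈ (H : Set (EuclideanSpace ℝ (Fin 3))) ∩ K :=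
      ⟨(hH _).2 (by simpa using hgy), (hL y).1 hy⟩
    have h2 : (2 : ℝ) • c - (WithLp.toLp 2 y + p) ∈
        (H : Set (EuclideanSpace ℝ (Fin 3))) ∩ K := hcS.subset ⟨_, h1, rfl⟩
    have h3 : WithLp.toLp 2 ((2 : ℝ) • (c - p).ofLp - y) + p =
        (2 : ℝ) • c - (WithLp.toLp 2 y + p) := by
      rw [WithLp.toLp_sub, WithLp.toLp_smul, WithLp.toLp_ofLp]; module
    refine ⟨(hL _).2 (by rw [h3]; exact h2.2), ?_⟩
    have h4 := (hH _).1 h2.1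
    rwa [← h3, add_sub_cancel_right] at h4
  rcases symm_or_ellipsoid hLc hLconv hLint hs with h | ⟨o, h₁, h₂, h₃, R, hdet, hR, h⟩
  · left
    have h1 : ∀ x ∈ K, (2 : ℝ) • p - x ∈ K := by
      intro x hx
      have := (hL _).1 (h ((x - p).ofLp) ((hL _).2 (by simpa using hx)))
      convert this using 1
      rw [WithLp.toLp_neg, WithLp.toLp_ofLp]; module
    refine Subset.antisymm ?_ fun x hx => ⟨_, h1 x hx, by simp⟩
    rintro _ ⟨x, hx, rfl⟩
    exact h1 x hx
  · right
    refine affine_ball (WithLp.toLp 2 o + p) hdet hR fun x => ?_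
    rw [← h, hL, WithLp.toLp_add, WithLp.toLp_ofLp, add_assoc]

end

end FalseCentre

/-- **False Centre Theorem.** If `K` is a convex body in `ℝ³` and every plane (2-dimensional
affine subspace) through `p` meets `K` in a centrally symmetric section, then either `p` is a
centre of symmetry of `K` or `K` is an ellipsoid (affine image of the closed unit ball). -/
theorem false_centre_theorem
    (K : Set (EuclideanSpace ℝ (Fin 3))) (p : EuclideanSpace ℝ (Fin 3))
    (hKcomp : IsCompact K) (hKconv : Convex ℝ K) (hKint : (interior K).Nonempty)
    (hsym : ∀ H : AffineSubspace ℝ (EuclideanSpace ℝ (Fin 3)),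
      p ∈ H → Module.finrank ℝ H.direction = 2 →
      ∃ c, SymmWith ((H : Set (EuclideanSpace ℝ (Fin 3))) ∩ K) c) :
    SymmWith K p ∨
      ∃ T : EuclideanSpace ℝ (Fin 3) ≃ᵃ[ℝ] EuclideanSpace ℝ (Fin 3),
        K = T '' Metric.closedBall (0 : EuclideanSpace ℝ (Fin 3)) 1 := by
  exact FalseCentre.false_centre hKcomp hKconv hKint hsym
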